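/- For every prime p there exists a constant C_p > 0 such that, as x → ∞, the number of positive integers d ≤ x failing to satisfy |log φ(d_p) − log λ(d_p) − (1/3)·(log_2 x)·(log_3 x)| ≤ C_p·(log_2 x)·(log_4 x) is o(x). -/

import Mathlib

open scoped Classical

/-- The iterated logarithm: `logI 0 x = x`, `logI (ν+1) x = max (log (logI ν x)) 1`,
so that `logI 1 x = log_1 x = max (log x, 1)` and `logI ν x = log_ν x`. -/
noncomputable def logI : ℕ → ℝ → ℝ
  | 0, x => x
  | ν + 1, x => max (Real.log (logI ν x)) 1

/-- `r ∈ R_{p,k}`: `r` is an odd prime, `r ≠ p`, and `v₂(ℓ_p(r)) = k`. -/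
def memR (p k r : ℕ) : Prop :=
  r.Prime ∧ Odd r ∧ r ≠ p ∧ padicValNat 2 (orderOf ((p : ZMod r))) = k

/-- `r ∈ R_p`, where `R_p = R_{p,1}` for `p > 2` and `R_2 = R_{2,2}`. -/
def memRp (p r : ℕ) : Prop :=
  if p = 2 then memR 2 2 r else memR p 1 r

/-- `d_p = Π_{r ∈ R_p} r^{v_r(d)}`, the largest divisor of `d` all of whose
prime factors lie in `R_p`. -/
noncomputable def dPart (p d : ℕ) : ℕ :=
  ∏ r ∈ d.primeFactors.filter (fun r => memRp p r), r ^ d.factorization r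

/-- The Carmichael function `λ(m)`, the exponent of `(ℤ/mℤ)ˣ`. -/
noncomputable def carmichael (m : ℕ) : ℕ :=
  Monoid.exponent (ZMod m)ˣ

section SelbergUpperBound

/-- Squarefree integers up to `z` coprime to `m`. -/
noncomputable def sieveSupport (m z : ℕ) : Finset ℕ :=
  (Finset.Icc 1 z).filter (fun f => Squarefree f ∧ f.Coprime m)

lemma mem_sieveSupport {m z f : ℕ} :
    f ∈ sieveSupport m z ↔ (1 ≤ f ∧ f ≤ z) ∧ Squarefree f ∧ f.Coprime m := by
  simp [sieveSupport]

lemma mem_sieveSupport_of_dvd {m z d f : ℕ} (hf : f ∈ sieveSupport m z) (hd : d ∣ f) :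
    d ∈ sieveSupport m z := by
  rw [mem_sieveSupport] at *
  obtain ⟨⟨h1, h2⟩, h3, h4⟩ := hf
  exact ⟨⟨Nat.pos_of_dvd_of_pos hd h1, (Nat.le_of_dvd h1 hd).trans h2⟩,
    h3.squarefree_of_dvd hd, h4.coprime_dvd_left hd⟩

/-- The normalising sum in the Selberg sieve. -/
noncomputable def sieveMass (m z : ℕ) : ℝ := ∑ f ∈ sieveSupport m z, 1 / (f.totient : ℝ)

/-- The diagonalised Selberg weights. -/
noncomputable def sieveDiag (m z f : ℕ) : ℝ :=
  (ArithmeticFunction.moebius f : ℝ) / (f.totient * sieveMass m z)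

/-- The Selberg weights. -/
noncomputable def sieveWeight (m z d : ℕ) : ℝ :=
  d * ∑ f ∈ (sieveSupport m z).filter (fun f => d ∣ f),
    (ArithmeticFunction.moebius (f / d) : ℝ) * sieveDiag m z f

lemma one_mem_sieveSupport (m : ℕ) {z : ℕ} (hz : 1 ≤ z) : 1 ∈ sieveSupport m z := by
  rw [mem_sieveSupport]; simp [hz]

lemma one_le_sieveMass (m : ℕ) {z : ℕ} (hz : 1 ≤ z) : 1 ≤ sieveMass m z := by
  have := Finset.single_le_sum (f := fun f : ℕ => 1 / (f.totient : ℝ))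
    (fun i _ => by positivity) (one_mem_sieveSupport m hz)
  simpa [sieveMass] using this

lemma sieveWeight_one (m : ℕ) {z : ℕ} (hz : 1 ≤ z) : sieveWeight m z 1 = 1 := by
  have hG := one_le_sieveMass m hz
  have : sieveWeight m z 1 = ∑ f ∈ sieveSupport m z, (1 / (f.totient : ℝ)) / sieveMass m z := by
    simp only [sieveWeight, one_dvd, Finset.filter_true, Nat.cast_one, one_mul, Nat.div_one]
    apply Finset.sum_congr rfl
    intro f hf
    have hsf := (mem_sieveSupport.1 hf).2.1
    have h2 : ((ArithmeticFunction.moebius f : ℤ) : ℝ) * (ArithmeticFunction.moebius f : ℤ) = 1 := by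
      have := ArithmeticFunction.moebius_sq_eq_one_of_squarefree hsf
      rw [sq] at this; exact_mod_cast this
    rw [sieveDiag, ← mul_div_assoc, h2, div_div]
  rw [this, ← Finset.sum_div, ← sieveMass, div_self (by linarith)]

lemma sum_moebius_div_between {f g : ℕ} (hg : g ≠ 0) (D : Finset ℕ) (hD : ∀ d, d ∣ g → d ∈ D) :
    ∑ d ∈ D.filter (fun d => f ∣ d ∧ d ∣ g), (ArithmeticFunction.moebius (g / d) : ℤ)
      = if f = g then 1 else 0 := by
  by_cases hfg : f ∣ g
  · obtain ⟨h, rfl⟩ := hfg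
    have hf0 : f ≠ 0 := by rintro rfl; simp at hg
    have hh0 : h ≠ 0 := by rintro rfl; simp at hg
    have : ∑ d ∈ D.filter (fun d => f ∣ d ∧ d ∣ f * h), (ArithmeticFunction.moebius (f * h / d) : ℤ)
        = ∑ e ∈ h.divisors, ArithmeticFunction.moebius (h / e) := by
      symm
      apply Finset.sum_bij (fun e _ => f * e)
      · intro e he
        have := Nat.dvd_of_mem_divisors he
        simp only [Finset.mem_filter]
        exact ⟨hD _ (mul_dvd_mul_left f this), dvd_mul_right _ _, mul_dvd_mul_left f this⟩
      · intro a _ b _ hab; exact Nat.eq_of_mul_eq_mul_left (Nat.pos_of_ne_zero hf0) hab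
      · rintro d hd
        simp only [Finset.mem_filter] at hd
        obtain ⟨_, ⟨e, rfl⟩, h2⟩ := hd
        exact ⟨e, by simp [hh0, Nat.dvd_of_mul_dvd_mul_left (Nat.pos_of_ne_zero hf0) h2], rfl⟩
      · intro e he
        rw [Nat.mul_div_mul_left _ _ (Nat.pos_of_ne_zero hf0)]
    rw [this, Nat.sum_div_divisors h (fun e => ArithmeticFunction.moebius e),
      ← ArithmeticFunction.coe_mul_zeta_apply, ArithmeticFunction.moebius_mul_coe_zeta,
      ArithmeticFunction.one_apply]
    by_cases h1 : h = 1
    · simp [h1]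
    · simp [h1, hf0]
  · rw [Finset.sum_eq_zero, if_neg]
    · rintro rfl; exact hfg dvd_rfl
    · intro d hd
      simp only [Finset.mem_filter] at hd
      exact absurd (hd.2.1.trans hd.2.2) hfg

lemma sum_sieveWeight_div {m z f : ℕ} (hf : f ∈ sieveSupport m z) :
    ∑ d ∈ (sieveSupport m z).filter (fun d => f ∣ d), sieveWeight m z d / d
      = sieveDiag m z f := by
  have h1 : ∀ d ∈ (sieveSupport m z).filter (fun d => f ∣ d), sieveWeight m z d / d
      = ∑ g ∈ sieveSupport m z, if d ∣ g then
        (ArithmeticFunction.moebius (g / d) : ℝ) * sieveDiag m z g else 0 := by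
    intro d hd
    have hd0 : (d : ℝ) ≠ 0 := by
      have := (mem_sieveSupport.1 (Finset.mem_filter.1 hd).1).1.1
      positivity
    rw [sieveWeight, mul_div_cancel_left₀ _ hd0, Finset.sum_filter]
  rw [Finset.sum_congr rfl h1, Finset.sum_comm]
  have h2 : ∀ g ∈ sieveSupport m z, (∑ d ∈ (sieveSupport m z).filter (fun d => f ∣ d),
      if d ∣ g then (ArithmeticFunction.moebius (g / d) : ℝ) * sieveDiag m z g else 0)
      = if f = g then sieveDiag m z g else 0 := by
    intro g hg
    rw [← Finset.sum_filter, Finset.filter_filter, ← Finset.sum_mul]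
    have := sum_moebius_div_between (f := f) (g := g)
      (by have := (mem_sieveSupport.1 hg).1.1; omega) (sieveSupport m z)
      (fun d hd => mem_sieveSupport_of_dvd hg hd)
    have h3 : (∑ d ∈ (sieveSupport m z).filter (fun d => f ∣ d ∧ d ∣ g),
      ((ArithmeticFunction.moebius (g / d) : ℤ) : ℝ)) = if f = g then 1 else 0 := by
      rw [← Int.cast_sum, this]; split_ifs <;> simp
    rw [h3]; split_ifs <;> simp
  rw [Finset.sum_congr rfl h2, Finset.sum_ite_eq, if_pos hf]

lemma sum_sieveWeight_mul_div_lcm (m : ℕ) {z : ℕ} (hz : 1 ≤ z) :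
    ∑ d ∈ sieveSupport m z, ∑ e ∈ sieveSupport m z,
      sieveWeight m z d * sieveWeight m z e / (d.lcm e : ℝ) = 1 / sieveMass m z := by
  have hG := one_le_sieveMass m hz
  have h1 : ∀ d ∈ sieveSupport m z, ∀ e ∈ sieveSupport m z,
      sieveWeight m z d * sieveWeight m z e / (d.lcm e : ℝ)
      = ∑ f ∈ sieveSupport m z, (f.totient : ℝ) *
        ((if f ∣ d then sieveWeight m z d / d else 0) *
          (if f ∣ e then sieveWeight m z e / e else 0)) := by
    intro d hd e he
    have hd0 : 0 < d := (mem_sieveSupport.1 hd).1.1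
    have he0 : 0 < e := (mem_sieveSupport.1 he).1.1
    have hg : ((d.gcd e : ℕ) : ℝ) = ∑ f ∈ (sieveSupport m z).filter (fun f => f ∣ d ∧ f ∣ e),
        (f.totient : ℝ) := by
      rw [← Nat.cast_sum, ← Nat.sum_totient (d.gcd e)]
      congr 1
      apply Finset.sum_congr _ (fun _ _ => rfl)
      ext f
      simp only [Nat.mem_divisors, Finset.mem_filter, Nat.dvd_gcd_iff]
      constructor
      · rintro ⟨⟨h1, h2⟩, _⟩
        exact ⟨mem_sieveSupport_of_dvd hd h1, h1, h2⟩
      · rintro ⟨_, h1, h2⟩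
        exact ⟨⟨h1, h2⟩, (Nat.gcd_pos_of_pos_left _ hd0).ne'⟩
    have hl : ((d.lcm e : ℕ) : ℝ) * (d.gcd e : ℕ) = d * e := by
      rw [mul_comm]; exact_mod_cast Nat.gcd_mul_lcm d e
    have hl0 : ((d.lcm e : ℕ) : ℝ) ≠ 0 := by
      exact_mod_cast (Nat.lcm_pos hd0 he0).ne'
    have : sieveWeight m z d * sieveWeight m z e / (d.lcm e : ℝ)
        = (d.gcd e : ℕ) * (sieveWeight m z d / d * (sieveWeight m z e / e)) := by
      have hd0' : (d : ℝ) ≠ 0 := by positivity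
      have he0' : (e : ℝ) ≠ 0 := by positivity
      field_simp
      linear_combination (-(sieveWeight m z d * sieveWeight m z e)) * hl
    rw [this, hg, Finset.sum_mul, Finset.sum_filter]
    apply Finset.sum_congr rfl
    intro f _
    by_cases h1 : f ∣ d <;> by_cases h2 : f ∣ e <;> simp [h1, h2]
  have h2 : ∑ d ∈ sieveSupport m z, ∑ e ∈ sieveSupport m z,
      sieveWeight m z d * sieveWeight m z e / (d.lcm e : ℝ)
      = ∑ f ∈ sieveSupport m z, (f.totient : ℝ) * sieveDiag m z f ^ 2 := by
    rw [Finset.sum_congr rfl (fun d hd => Finset.sum_congr rfl (fun e he => h1 d hd e he))]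
    rw [Finset.sum_congr rfl (fun d _ => Finset.sum_comm), Finset.sum_comm]
    apply Finset.sum_congr rfl
    intro f hf
    rw [← sum_sieveWeight_div hf, sq, Finset.sum_filter, Finset.sum_mul_sum, Finset.mul_sum]
    apply Finset.sum_congr rfl
    intro d _
    rw [Finset.mul_sum]
  rw [h2]
  have h3 : ∀ f ∈ sieveSupport m z, (f.totient : ℝ) * sieveDiag m z f ^ 2
      = (1 / (f.totient : ℝ)) / sieveMass m z ^ 2 := by
    intro f hf
    have hsf := (mem_sieveSupport.1 hf).2.1
    have hf0 : (f.totient : ℝ) ≠ 0 := by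
      have := Nat.totient_pos.2 (mem_sieveSupport.1 hf).1.1
      positivity
    have h2 : ((ArithmeticFunction.moebius f : ℤ) : ℝ) ^ 2 = 1 := by
      exact_mod_cast ArithmeticFunction.moebius_sq_eq_one_of_squarefree hsf
    rw [sieveDiag, div_pow, h2]
    field_simp
  rw [Finset.sum_congr rfl h3, ← Finset.sum_div, ← sieveMass]
  field_simp

lemma abs_sieveWeight_le (m : ℕ) {z : ℕ} (hz : 1 ≤ z) {d : ℕ} (hd : d ∈ sieveSupport m z) :
    |sieveWeight m z d| ≤ z ^ 2 := by
  have hG := one_le_sieveMass m hz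
  have hd' := mem_sieveSupport.1 hd
  rw [sieveWeight, abs_mul, Nat.abs_cast]
  have h1 : |∑ f ∈ (sieveSupport m z).filter (fun f => d ∣ f),
    (ArithmeticFunction.moebius (f / d) : ℝ) * sieveDiag m z f| ≤
      ∑ f ∈ (sieveSupport m z).filter (fun f => d ∣ f), (1 : ℝ) := by
    refine (Finset.abs_sum_le_sum_abs _ _).trans (Finset.sum_le_sum fun f hf => ?_)
    have hf := (mem_sieveSupport.1 (Finset.mem_filter.1 hf).1)
    have ha : ∀ n : ℕ, |((ArithmeticFunction.moebius n : ℤ) : ℝ)| ≤ 1 := by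
      intro n; exact_mod_cast ArithmeticFunction.abs_moebius_le_one
    have hphi : (1 : ℝ) ≤ f.totient := by exact_mod_cast Nat.totient_pos.2 hf.1.1
    have hb : |sieveDiag m z f| ≤ 1 := by
      rw [sieveDiag, abs_div]
      have : (1 : ℝ) ≤ f.totient * sieveMass m z := by nlinarith
      rw [abs_of_nonneg (by linarith : (0 : ℝ) ≤ f.totient * sieveMass m z)]
      exact div_le_one_of_le₀ ((ha f).trans this) (by linarith)
    rw [abs_mul]
    exact mul_le_one₀ (ha _) (abs_nonneg _) hb
  have h2 : (∑ f ∈ (sieveSupport m z).filter (fun f => d ∣ f), (1 : ℝ)) ≤ z := by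
    rw [Finset.sum_const, nsmul_eq_mul, mul_one]
    have : ((sieveSupport m z).filter (fun f => d ∣ f)).card ≤ (Finset.Icc 1 z).card :=
      Finset.card_le_card ((Finset.filter_subset _ _).trans (Finset.filter_subset _ _))
    rw [Nat.card_Icc] at this
    exact_mod_cast this
  have h3 : (d : ℝ) ≤ z := by exact_mod_cast hd'.1.2
  calc (d : ℝ) * _ ≤ z * z := mul_le_mul h3 (h1.trans h2) (abs_nonneg _) (by positivity)
    _ = _ := by ring

lemma sum_abs_sieveWeight_le (m : ℕ) {z : ℕ} (hz : 1 ≤ z) :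
    ∑ d ∈ sieveSupport m z, |sieveWeight m z d| ≤ z ^ 3 := by
  calc ∑ d ∈ sieveSupport m z, |sieveWeight m z d| ≤ ∑ d ∈ sieveSupport m z, (z : ℝ) ^ 2 :=
        Finset.sum_le_sum fun d hd => abs_sieveWeight_le m hz hd
    _ ≤ z * (z : ℝ) ^ 2 := by
      rw [Finset.sum_const, nsmul_eq_mul]
      have : (sieveSupport m z).card ≤ (Finset.Icc 1 z).card :=
        Finset.card_le_card (Finset.filter_subset _ _)
      rw [Nat.card_Icc] at this
      gcongr
      exact_mod_cast this
    _ = _ := by ring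

/-- The number of `k ≤ K` in a residue class coprime to the modulus. -/
lemma card_dvd_mul_add_one_le {m l : ℕ} (hl : 1 ≤ l) (hlm : l.Coprime m) (K : ℕ) :
    |(((Finset.Icc 1 K).filter (fun k => l ∣ m * k + 1)).card : ℝ) - K / l| ≤ 1 := by
  obtain ⟨c, hc⟩ : ∃ c : ℕ, ∀ k : ℕ, l ∣ m * k + 1 ↔ k ≡ c [MOD l] := by
    have : NeZero l := ⟨by omega⟩
    have hu : IsUnit (m : ZMod l) := (ZMod.isUnit_iff_coprime m l).2 hlm.symm
    obtain ⟨u, hu⟩ := hu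
    refine ⟨(-(↑u⁻¹ : ZMod l)).val, fun k => ?_⟩
    rw [← ZMod.natCast_eq_natCast_iff, ZMod.natCast_zmod_val, ← ZMod.natCast_eq_zero_iff]
    push_cast
    rw [← hu]
    constructor
    · intro h
      have : (k : ZMod l) = ↑u⁻¹ * (↑u * k + 1) - ↑u⁻¹ := by
        rw [mul_add, Units.inv_mul_cancel_left]; ring
      rw [this, h]; ring
    · intro h
      rw [h, mul_neg, Units.mul_inv]; ring
  have h1 : (Finset.Icc 1 K).filter (fun k => l ∣ m * k + 1)
      = (Finset.Ioc 0 K).filter (fun k => k ≡ c [MOD l]) := by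
    ext k; simp only [Finset.mem_filter, hc, Finset.mem_Icc, Finset.mem_Ioc, Nat.succ_le_iff]
  rw [h1]
  have hl' : (0 : ℝ) < l := by exact_mod_cast hl
  have hcnt := Nat.Ioc_filter_modEq_card 0 K (r := l) (by omega) c
  have h2 : (((Finset.Ioc 0 K).filter (fun k => k ≡ c [MOD l])).card : ℤ)
      = max (⌊((K : ℚ) - c) / l⌋ - ⌊((0 : ℕ) - c : ℚ) / l⌋) 0 := by exact_mod_cast hcnt
  have hle : ⌊((0 : ℕ) - c : ℚ) / l⌋ ≤ ⌊((K : ℚ) - c) / l⌋ := by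
    apply Int.floor_mono; push_cast; gcongr; positivity
  rw [max_eq_left (by linarith)] at h2
  have h3 := Int.floor_le (((K : ℚ) - c) / l)
  have h4 := Int.lt_floor_add_one (((K : ℚ) - c) / l)
  have h5 := Int.floor_le (((0 : ℕ) - c : ℚ) / l)
  have h6 := Int.lt_floor_add_one (((0 : ℕ) - c : ℚ) / l)
  have h7 : |(((Finset.Ioc 0 K).filter (fun k => k ≡ c [MOD l])).card : ℚ) - K / l| ≤ 1 := by
    have : (((Finset.Ioc 0 K).filter (fun k => k ≡ c [MOD l])).card : ℚ)
      = (⌊((K : ℚ) - c) / l⌋ : ℚ) - ⌊((0 : ℕ) - c : ℚ) / l⌋ := by exact_mod_cast h2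
    rw [this]
    have e : (K : ℚ) / l = ((K : ℚ) - c) / l - ((0 : ℕ) - c : ℚ) / l := by push_cast; ring
    rw [e, abs_le]; constructor <;> linarith
  have h8 : ((|(((Finset.Ioc 0 K).filter (fun k => k ≡ c [MOD l])).card : ℚ) - K / l| : ℚ) : ℝ)
    ≤ ((1 : ℚ) : ℝ) := by exact_mod_cast h7
  push_cast at h8
  exact h8

/-- Selberg sieve upper bound for the number of primes in an arithmetic progression `1 mod m`. -/
lemma card_prime_mul_add_one_le (m K : ℕ) {z : ℕ} (hm : 1 ≤ m) (hz : 1 ≤ z) :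
    (((Finset.Icc 1 K).filter (fun k => (m * k + 1).Prime)).card : ℝ)
      ≤ K / sieveMass m z + z ^ 6 + z := by
  set D := sieveSupport m z with hD
  set w := sieveWeight m z with hw
  set N := (Finset.Icc 1 K).filter (fun k => (m * k + 1).Prime) with hN
  have hsplit : (N.card : ℝ) ≤ ((N.filter (fun k => z < m * k + 1)).card : ℝ) + z := by
    have h1 := Finset.card_filter_add_card_filter_not (s := N) (fun k => z < m * k + 1)
    have h2 : (N.filter (fun k => ¬ z < m * k + 1)).card ≤ (Finset.Icc 1 z).card := by
      apply Finset.card_le_card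
      intro k hk
      simp only [hN, Finset.mem_filter, Finset.mem_Icc, not_lt] at hk ⊢
      refine ⟨hk.1.1.1, ?_⟩
      nlinarith [hk.2]
    rw [Nat.card_Icc] at h2
    have : N.card ≤ (N.filter (fun k => z < m * k + 1)).card + z := by omega
    exact_mod_cast this
  have hsq : ((N.filter (fun k => z < m * k + 1)).card : ℝ)
      ≤ ∑ k ∈ Finset.Icc 1 K, (∑ d ∈ D, if d ∣ m * k + 1 then w d else 0) ^ 2 := by
    rw [Finset.card_eq_sum_ones, Nat.cast_sum]
    refine (Finset.sum_le_sum (f := fun k => ((1 : ℕ) : ℝ))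
      (g := fun k => (∑ d ∈ D, if d ∣ m * k + 1 then w d else 0) ^ 2) ?_).trans
      (Finset.sum_le_sum_of_subset_of_nonneg ?_ (fun _ _ _ => sq_nonneg _))
    · intro k hk
      simp only [hN, Finset.mem_filter] at hk
      have : (∑ d ∈ D, if d ∣ m * k + 1 then w d else 0) = 1 := by
        rw [Finset.sum_eq_single 1]
        · simp [hw, sieveWeight_one m hz]
        · intro d hd hd1
          rw [if_neg]
          intro h
          rcases (Nat.dvd_prime hk.1.2).1 h with h | h
          · exact hd1 h
          · have := (mem_sieveSupport.1 hd).1.2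
            omega
        · intro h; exact absurd (one_mem_sieveSupport m hz) h
      rw [this]; simp
    · exact (Finset.filter_subset _ _).trans (Finset.filter_subset _ _)
  have hexp : ∑ k ∈ Finset.Icc 1 K, (∑ d ∈ D, if d ∣ m * k + 1 then w d else 0) ^ 2
      = ∑ d ∈ D, ∑ e ∈ D, w d * w e *
        ((Finset.Icc 1 K).filter (fun k => d.lcm e ∣ m * k + 1)).card := by
    have : ∀ k, (∑ d ∈ D, if d ∣ m * k + 1 then w d else 0) ^ 2
        = ∑ d ∈ D, ∑ e ∈ D, if d.lcm e ∣ m * k + 1 then w d * w e else 0 := by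
      intro k
      rw [sq, Finset.sum_mul_sum]
      refine Finset.sum_congr rfl fun d _ => Finset.sum_congr rfl fun e _ => ?_
      simp only [Nat.lcm_dvd_iff]
      by_cases h1 : d ∣ m * k + 1 <;> by_cases h2 : e ∣ m * k + 1 <;> simp [h1, h2]
    simp_rw [this]
    rw [Finset.sum_comm]
    refine Finset.sum_congr rfl fun d _ => ?_
    rw [Finset.sum_comm]
    refine Finset.sum_congr rfl fun e _ => ?_
    rw [← Finset.sum_filter, Finset.sum_const, nsmul_eq_mul, mul_comm]
  have hbound : ∑ d ∈ D, ∑ e ∈ D, w d * w e *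
        ((Finset.Icc 1 K).filter (fun k => d.lcm e ∣ m * k + 1)).card
      ≤ ∑ d ∈ D, ∑ e ∈ D, (K * (w d * w e / (d.lcm e : ℝ)) + |w d| * |w e|) := by
    refine Finset.sum_le_sum fun d hd => Finset.sum_le_sum fun e he => ?_
    have hd' := mem_sieveSupport.1 hd
    have he' := mem_sieveSupport.1 he
    have hc := card_dvd_mul_add_one_le (m := m) (l := d.lcm e)
      (Nat.lcm_pos hd'.1.1 he'.1.1)
      (Nat.Coprime.coprime_dvd_left (Nat.lcm_dvd_mul d e) (hd'.2.2.mul_left he'.2.2)) K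
    set c := (((Finset.Icc 1 K).filter (fun k => d.lcm e ∣ m * k + 1)).card : ℝ)
    have : w d * w e * c = K * (w d * w e / (d.lcm e : ℝ))
        + (w d * w e) * (c - K / (d.lcm e : ℝ)) := by ring
    rw [this]
    refine add_le_add le_rfl ?_
    calc (w d * w e) * (c - K / (d.lcm e : ℝ)) ≤ |(w d * w e) * (c - K / (d.lcm e : ℝ))| :=
          le_abs_self _
      _ ≤ |w d * w e| * 1 := by rw [abs_mul]; gcongr
      _ = |w d| * |w e| := by rw [mul_one, abs_mul]
  have hfin : ∑ d ∈ D, ∑ e ∈ D, (K * (w d * w e / (d.lcm e : ℝ)) + |w d| * |w e|)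
      = K * (1 / sieveMass m z) + (∑ d ∈ D, |w d|) ^ 2 := by
    rw [← sum_sieveWeight_mul_div_lcm m hz, sq, Finset.sum_mul_sum, Finset.mul_sum]
    simp_rw [Finset.sum_add_distrib, Finset.mul_sum]
    rfl
  have h3 : (∑ d ∈ D, |w d|) ^ 2 ≤ (z : ℝ) ^ 6 := by
    calc (∑ d ∈ D, |w d|) ^ 2 ≤ ((z : ℝ) ^ 3) ^ 2 := by
          gcongr; exact sum_abs_sieveWeight_le m hz
      _ = _ := by ring
  have : (K : ℝ) * (1 / sieveMass m z) = K / sieveMass m z := by ring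
  linarith

end SelbergUpperBound

/-- The sum of reciprocals of the primes `r ≤ x` with the property `S`. -/
noncomputable def recipSum (S : ℕ → Prop) (x : ℕ) : ℝ :=
  ∑ r ∈ (Finset.Icc 1 x).filter (fun r => r.Prime ∧ S r), 1 / (r : ℝ)

lemma recipSum_nonneg (S : ℕ → Prop) (x : ℕ) : 0 ≤ recipSum S x :=
  Finset.sum_nonneg fun _ _ => by positivity

lemma recipSum_mono {S S' : ℕ → Prop} {x : ℕ} (h : ∀ r, r.Prime → S r → S' r) :
    recipSum S x ≤ recipSum S' x := by
  apply Finset.sum_le_sum_of_subset_of_nonneg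
  · intro r hr
    simp only [Finset.mem_filter] at hr ⊢
    exact ⟨hr.1, hr.2.1, h r hr.2.1 hr.2.2⟩
  · intros; positivity

lemma one_le_logI (ν : ℕ) (x : ℝ) : 1 ≤ logI (ν + 1) x := le_max_right _ _

lemma sum_inv_sq_le (X : ℕ) : ∑ k ∈ Finset.Icc 1 X, 1 / (k : ℝ) ^ 2 ≤ 2 := by
  have h : ∀ X : ℕ, ∑ k ∈ Finset.Icc 1 (X + 1), 1 / (k : ℝ) ^ 2 ≤ 2 - 1 / ((X : ℝ) + 1) := by
    intro X
    induction X with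
    | zero => norm_num
    | succ X ih =>
      rw [Finset.sum_Icc_succ_top (by omega)]
      have : 1 / (((X + 1 + 1 : ℕ) : ℝ)) ^ 2 ≤ 1 / ((X : ℝ) + 1) - 1 / ((X : ℝ) + 2) := by
        push_cast
        rw [div_sub_div _ _ (by positivity) (by positivity), div_le_div_iff₀ (by positivity) (by positivity)]
        nlinarith [(X.cast_nonneg : (0 : ℝ) ≤ X)]
      have e : 2 - 1 / (((X + 1 : ℕ) : ℝ) + 1) = 2 - 1 / ((X : ℝ) + 2) := by push_cast; ring_nf
      rw [e]; linarith
  rcases X with _ | X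
  · simp
  · have := h X
    have h2 : 0 ≤ 1 / ((X : ℝ) + 1) := by positivity
    linarith

lemma sum_biUnion_le_sum_sum {ι : Type*} (s : Finset ι) (t : ι → Finset ℕ) (f : ℕ → ℝ)
    (hf : ∀ n, 0 ≤ f n) : ∑ n ∈ s.biUnion t, f n ≤ ∑ i ∈ s, ∑ n ∈ t i, f n := by
  induction s using Finset.induction_on with
  | empty => simp
  | insert a s ha ih =>
    rw [Finset.biUnion_insert, Finset.sum_insert ha]
    have := Finset.sum_union_inter (s₁ := t a) (s₂ := s.biUnion t) (f := f)
    have h0 : 0 ≤ ∑ n ∈ t a ∩ s.biUnion t, f n := Finset.sum_nonneg fun _ _ => hf _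
    linarith

lemma sum_coprime_le_sieveMass (m z : ℕ) :
    ∑ n ∈ (Finset.Icc 1 z).filter (fun n => n.Coprime m), 1 / (n : ℝ) ≤ 2 * sieveMass m z := by
  have hex : ∀ n : ℕ, ∃ q : ℕ × ℕ, q.2 ^ 2 * q.1 = n ∧ Squarefree q.1 := by
    intro n
    obtain ⟨a, b, h, hs⟩ := Nat.sq_mul_squarefree n
    exact ⟨(a, b), h, hs⟩
  choose g hg hs using hex
  have h1 : ∑ n ∈ (Finset.Icc 1 z).filter (fun n => n.Coprime m), 1 / (n : ℝ)
      ≤ ∑ q ∈ sieveSupport m z ×ˢ Finset.Icc 1 z, 1 / ((q.2 : ℝ) ^ 2 * q.1) := by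
    have hc : ∀ n ∈ (Finset.Icc 1 z).filter (fun n => n.Coprime m),
        1 / (n : ℝ) = 1 / (((g n).2 : ℝ) ^ 2 * (g n).1) := by
      intro n _
      congr 1; exact_mod_cast (hg n).symm
    rw [Finset.sum_congr rfl hc,
      ← Finset.sum_image (g := g) (f := fun q : ℕ × ℕ => 1 / ((q.2 : ℝ) ^ 2 * q.1))]
    · apply Finset.sum_le_sum_of_subset_of_nonneg
      · intro q hq
        simp only [Finset.mem_image, Finset.mem_filter, Finset.mem_Icc] at hq
        obtain ⟨n, ⟨⟨h1, h2⟩, h3⟩, rfl⟩ := hq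
        have hn := hg n
        have hd1 : (g n).1 ∣ n := ⟨_, by rw [mul_comm]; exact hn.symm⟩
        have hd2 : (g n).2 ∣ n := (dvd_pow_self _ two_ne_zero).trans ⟨_, hn.symm⟩
        simp only [Finset.mem_product, mem_sieveSupport, Finset.mem_Icc]
        exact ⟨⟨⟨Nat.pos_of_dvd_of_pos hd1 h1, (Nat.le_of_dvd h1 hd1).trans h2⟩, hs n,
          h3.coprime_dvd_left hd1⟩, Nat.pos_of_dvd_of_pos hd2 h1, (Nat.le_of_dvd h1 hd2).trans h2⟩
      · intros; positivity
    · intro a _ b _ hab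
      rw [← hg a, ← hg b, hab]
  refine h1.trans ?_
  rw [Finset.sum_product]
  have h2 : ∀ f ∈ sieveSupport m z, ∑ k ∈ Finset.Icc 1 z, 1 / ((k : ℝ) ^ 2 * f)
      ≤ 2 * (1 / (f.totient : ℝ)) := by
    intro f hf
    have hf1 := (mem_sieveSupport.1 hf).1.1
    have hphi : (0 : ℝ) < f.totient := by exact_mod_cast Nat.totient_pos.2 hf1
    have hle : (f.totient : ℝ) ≤ f := by exact_mod_cast Nat.totient_le f
    have : ∑ k ∈ Finset.Icc 1 z, 1 / ((k : ℝ) ^ 2 * f)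
        = (∑ k ∈ Finset.Icc 1 z, 1 / (k : ℝ) ^ 2) * (1 / (f : ℝ)) := by
      rw [Finset.sum_mul]; refine Finset.sum_congr rfl fun k _ => ?_
      rw [one_div_mul_one_div]
    rw [this]
    have h3 := sum_inv_sq_le z
    have h4 : 1 / (f : ℝ) ≤ 1 / f.totient := one_div_le_one_div_of_le hphi hle
    have h5 : 0 ≤ 1 / (f : ℝ) := by positivity
    calc _ ≤ 2 * (1 / (f : ℝ)) := by gcongr
      _ ≤ _ := by gcongr
  rw [sieveMass, Finset.mul_sum]
  exact Finset.sum_le_sum h2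

lemma sum_prime_inv_le_of_card_le_two (s : Finset ℕ) (hs : ∀ l ∈ s, l.Prime) (hc : s.card ≤ 2) :
    ∑ l ∈ s, 1 / (l : ℝ) ≤ 5 / 6 := by
  have h2 : ∀ l ∈ s, 1 / (l : ℝ) ≤ 1 / 2 := fun l hl =>
    one_div_le_one_div_of_le (by norm_num) (by exact_mod_cast (hs l hl).two_le)
  have h3 : ∀ l ∈ s, l ≠ 2 → 1 / (l : ℝ) ≤ 1 / 3 := fun l hl hl2 =>
    one_div_le_one_div_of_le (by norm_num) (by
      have := (hs l hl).two_le
      have : 3 ≤ l := by omega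
      exact_mod_cast this)
  rcases Nat.lt_or_ge s.card 2 with hc' | hc'
  · have : s.card = 0 ∨ s.card = 1 := by omega
    rcases this with h | h
    · rw [Finset.card_eq_zero] at h; subst h; norm_num
    · obtain ⟨a, rfl⟩ := Finset.card_eq_one.1 h
      have := h2 a (by simp)
      simp only [Finset.sum_singleton]; linarith
  · obtain ⟨a, b, hab, rfl⟩ := Finset.card_eq_two.1 (le_antisymm hc hc')
    rw [Finset.sum_pair hab]
    by_cases ha : a = 2
    · have := h3 b (by simp) (by omega)
      have := h2 a (by simp)
      linarith
    · have := h3 a (by simp) ha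
      have := h2 b (by simp)
      linarith

lemma sieveMass_ge (m z : ℕ) (hm : 1 ≤ m) (hc : m.primeFactors.card ≤ 2) :
    Real.log (z + 1) / 12 ≤ sieveMass m z := by
  have hH : Real.log (z + 1) ≤ ∑ n ∈ Finset.Icc 1 z, 1 / (n : ℝ) := by
    have := log_add_one_le_harmonic z
    rw [harmonic_eq_sum_Icc] at this
    push_cast at this
    simpa using this
  set H := ∑ n ∈ Finset.Icc 1 z, 1 / (n : ℝ) with hHdef
  have hH0 : 0 ≤ H := Finset.sum_nonneg fun _ _ => by positivity
  have hsplit : H = ∑ n ∈ (Finset.Icc 1 z).filter (fun n => n.Coprime m), 1 / (n : ℝ)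
      + ∑ n ∈ (Finset.Icc 1 z).filter (fun n => ¬ n.Coprime m), 1 / (n : ℝ) :=
    (Finset.sum_filter_add_sum_filter_not _ _ _).symm
  have hmul : ∀ l ∈ m.primeFactors,
      ∑ n ∈ (Finset.Icc 1 z).filter (fun n => l ∣ n), 1 / (n : ℝ) ≤ (1 / (l : ℝ)) * H := by
    intro l hl
    have hl0 := (Nat.prime_of_mem_primeFactors hl).pos
    have : ∑ n ∈ (Finset.Icc 1 z).filter (fun n => l ∣ n), 1 / (n : ℝ)
        ≤ ∑ n ∈ (Finset.Icc 1 z).image (fun k => l * k), 1 / (n : ℝ) := by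
      apply Finset.sum_le_sum_of_subset_of_nonneg
      · intro n hn
        simp only [Finset.mem_filter, Finset.mem_Icc] at hn
        obtain ⟨⟨h1, h2⟩, k, rfl⟩ := hn
        simp only [Finset.mem_image, Finset.mem_Icc]
        refine ⟨k, ⟨Nat.pos_of_mul_pos_left h1, ?_⟩, rfl⟩
        nlinarith
      · intros; positivity
    refine this.trans ?_
    rw [Finset.sum_image (fun a _ b _ h => Nat.eq_of_mul_eq_mul_left hl0 h), hHdef,
      Finset.mul_sum]
    refine Finset.sum_le_sum fun k _ => ?_
    push_cast
    rw [one_div_mul_one_div]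
  have hbad : ∑ n ∈ (Finset.Icc 1 z).filter (fun n => ¬ n.Coprime m), 1 / (n : ℝ)
      ≤ ∑ l ∈ m.primeFactors, (1 / (l : ℝ)) * H := by
    refine le_trans ?_ (Finset.sum_le_sum hmul)
    have : (Finset.Icc 1 z).filter (fun n => ¬ n.Coprime m)
        ⊆ m.primeFactors.biUnion (fun l => (Finset.Icc 1 z).filter (fun n => l ∣ n)) := by
      intro n hn
      simp only [Finset.mem_filter] at hn
      obtain ⟨l, hl, h1, h2⟩ := Nat.Prime.not_coprime_iff_dvd.1 hn.2
      simp only [Finset.mem_biUnion, Finset.mem_filter, Nat.mem_primeFactors]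
      exact ⟨l, ⟨hl, h2, by omega⟩, hn.1, h1⟩
    refine (Finset.sum_le_sum_of_subset_of_nonneg this (fun _ _ _ => by positivity)).trans ?_
    exact sum_biUnion_le_sum_sum _ _ _ (fun _ => by positivity)
  rw [← Finset.sum_mul] at hbad
  have h56 := sum_prime_inv_le_of_card_le_two m.primeFactors
    (fun l hl => Nat.prime_of_mem_primeFactors hl) hc
  have := sum_coprime_le_sieveMass m z
  nlinarith

lemma card_prime_mul_add_one_le_div_log (m K : ℕ) (hm : 1 ≤ m) (hc : m.primeFactors.card ≤ 2)
    (hK : 1 ≤ K) :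
    (((Finset.Icc 1 K).filter (fun k => (m * k + 1).Prime)).card : ℝ)
      ≤ 150 * K / (1 + Real.log K) := by
  have hK' : (1 : ℝ) ≤ K := by exact_mod_cast hK
  set t := (K : ℝ) ^ (1 / 12 : ℝ) with ht
  have ht1 : 1 ≤ t := Real.one_le_rpow hK' (by norm_num)
  have ht12 : t ^ 12 = K := by
    rw [ht, ← Real.rpow_natCast, ← Real.rpow_mul (by positivity)]; norm_num
  set z := ⌊t⌋₊ with hz
  have hz1 : 1 ≤ z := Nat.floor_pos.2 ht1
  have hzt : (z : ℝ) ≤ t := Nat.floor_le (by positivity)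
  have hzt' : t < z + 1 := Nat.lt_floor_add_one t
  have hmain := card_prime_mul_add_one_le m K hm hz1
  have hG1 := one_le_sieveMass m hz1
  have hG2 := sieveMass_ge m z hm hc
  have hlogK : Real.log K = 12 * Real.log t := by
    rw [← ht12, Real.log_pow]; norm_num
  have hlog2 : Real.log t ≤ Real.log (z + 1) := Real.log_le_log (by positivity) hzt'.le
  have hG : 1 + Real.log K ≤ 145 * sieveMass m z := by linarith
  have hL0 : 0 ≤ Real.log K := Real.log_nonneg hK'
  have h1 : K / sieveMass m z ≤ 145 * K / (1 + Real.log K) := by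
    rw [div_le_div_iff₀ (by linarith) (by linarith)]
    nlinarith
  have ht6 : 1 ≤ t ^ 6 := one_le_pow₀ ht1
  have h2 : (z : ℝ) ^ 6 ≤ t ^ 6 := by gcongr
  have h3 : (z : ℝ) ≤ t ^ 6 := by
    calc (z : ℝ) ≤ t := hzt
      _ = t ^ 1 := (pow_one t).symm
      _ ≤ t ^ 6 := pow_le_pow_right₀ ht1 (by norm_num)
  have h4 : 1 + Real.log K ≤ 2 * t ^ 6 := by
    have : Real.log K = 2 * Real.log (t ^ 6) := by rw [Real.log_pow, hlogK]; push_cast; ring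
    have := Real.log_le_sub_one_of_pos (show 0 < t ^ 6 by positivity)
    linarith
  have h5 : 2 * t ^ 6 ≤ 5 * K / (1 + Real.log K) := by
    rw [le_div_iff₀ (by linarith)]
    have : t ^ 6 * t ^ 6 = K := by rw [← ht12]; ring
    nlinarith
  calc _ ≤ K / sieveMass m z + z ^ 6 + z := hmain
    _ ≤ 145 * K / (1 + Real.log K) + 5 * K / (1 + Real.log K) := by linarith
    _ = _ := by ring

lemma sum_inv_le_of_card_le_div_log {A : ℕ → Prop} [DecidablePred A] {C : ℝ} (hC : 0 ≤ C)
    (hA : ∀ K : ℕ, 1 ≤ K →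
      (((Finset.Icc 1 K).filter A).card : ℝ) ≤ C * K / (1 + Real.log K)) (X : ℕ) :
    ∑ k ∈ (Finset.Icc 1 X).filter A, 1 / (k : ℝ) ≤ 12 * C * logI 2 X := by
  set J := Nat.log 2 X with hJ
  have hmaps : ∀ k ∈ (Finset.Icc 1 X).filter A, Nat.log 2 k ∈ Finset.range (J + 1) := by
    intro k hk
    simp only [Finset.mem_filter, Finset.mem_Icc] at hk
    rw [Finset.mem_range, Nat.lt_succ_iff]
    exact Nat.log_mono_right hk.1.2
  rw [← Finset.sum_fiberwise_of_maps_to hmaps]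
  have hl2 : (0.69 : ℝ) ≤ Real.log 2 := by have := Real.log_two_gt_d9; linarith
  have hl2' : Real.log 2 ≤ 0.7 := by have := Real.log_two_lt_d9; linarith
  have hj : ∀ j ∈ Finset.range (J + 1),
      ∑ k ∈ ((Finset.Icc 1 X).filter A).filter (fun k => Nat.log 2 k = j), 1 / (k : ℝ)
      ≤ 3 * C * (1 / ((j + 1 : ℕ) : ℝ)) := by
    intro j _
    have h1 : ∑ k ∈ ((Finset.Icc 1 X).filter A).filter (fun k => Nat.log 2 k = j), 1 / (k : ℝ)
        ≤ ∑ k ∈ (Finset.Icc 1 (2 ^ (j + 1))).filter A, 1 / (2 : ℝ) ^ j := by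
      refine (Finset.sum_le_sum (g := fun _ => 1 / (2 : ℝ) ^ j) ?_).trans
        (Finset.sum_le_sum_of_subset_of_nonneg ?_ (fun _ _ _ => by positivity))
      · intro k hk
        simp only [Finset.mem_filter, Finset.mem_Icc] at hk
        apply one_div_le_one_div_of_le (by positivity)
        have := Nat.pow_log_le_self 2 (x := k) (by omega)
        rw [hk.2] at this
        exact_mod_cast this
      · intro k hk
        simp only [Finset.mem_filter, Finset.mem_Icc] at hk ⊢
        refine ⟨⟨hk.1.1.1, ?_⟩, hk.1.2⟩
        have := Nat.lt_pow_succ_log_self (b := 2) (by norm_num) k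
        rw [hk.2] at this
        exact this.le
    refine h1.trans ?_
    rw [Finset.sum_const, nsmul_eq_mul]
    have h2 := hA (2 ^ (j + 1)) Nat.one_le_two_pow
    push_cast at h2
    rw [Real.log_pow] at h2
    have hden : 0.69 * ((j : ℝ) + 1) ≤ 1 + ((j + 1 : ℕ) : ℝ) * Real.log 2 := by
      push_cast; nlinarith [(j.cast_nonneg : (0 : ℝ) ≤ j)]
    have hjpos : (0 : ℝ) < (j : ℝ) + 1 := by positivity
    calc _ ≤ C * 2 ^ (j + 1) / (1 + ((j + 1 : ℕ) : ℝ) * Real.log 2) * (1 / 2 ^ j) := by gcongr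
      _ ≤ C * 2 ^ (j + 1) / (0.69 * ((j : ℝ) + 1)) * (1 / 2 ^ j) := by gcongr
      _ = (2 / 0.69) * C * (1 / ((j : ℝ) + 1)) := by rw [pow_succ]; field_simp
      _ ≤ 3 * C * (1 / ((j : ℝ) + 1)) := by gcongr; norm_num
      _ = _ := by push_cast; rfl
  refine (Finset.sum_le_sum hj).trans ?_
  rw [← Finset.mul_sum]
  have hH : ∑ j ∈ Finset.range (J + 1), 1 / ((j + 1 : ℕ) : ℝ) ≤ 1 + Real.log ((J + 1 : ℕ) : ℝ) := by
    have := harmonic_le_one_add_log (J + 1)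
    rw [harmonic] at this
    push_cast at this ⊢
    simpa using this
  have hJle : Real.log ((J + 1 : ℕ) : ℝ) ≤ 1 + logI 2 X := by
    have h1 : ((J + 1 : ℕ) : ℝ) ≤ 2.5 * logI 1 X := by
      have hL1 : 1 ≤ logI 1 (X : ℝ) := one_le_logI 0 _
      rcases Nat.eq_zero_or_pos X with h0 | h0
      · have : J = 0 := by rw [hJ, h0]; rfl
        rw [this]; push_cast; linarith
      · have h2 : (2 : ℝ) ^ J ≤ X := by exact_mod_cast Nat.pow_log_le_self 2 (by omega)
        have h3 := Real.log_le_log (by positivity) h2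
        rw [Real.log_pow] at h3
        have h4 : Real.log X ≤ logI 1 X := le_max_left _ _
        push_cast
        have : (J : ℝ) * 0.69 ≤ J * Real.log 2 := by gcongr
        linarith
    have h2 : Real.log (2.5 * logI 1 X) ≤ 1 + logI 2 X := by
      have hL1 : 1 ≤ logI 1 (X : ℝ) := one_le_logI 0 _
      rw [Real.log_mul (by norm_num) (by linarith)]
      have h3 : Real.log 2.5 ≤ 1 := by
        rw [Real.log_le_iff_le_exp (by norm_num)]
        have := Real.exp_one_gt_d9; linarith
      have h4 : Real.log (logI 1 X) ≤ logI 2 X := le_max_left _ _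
      linarith
    exact (Real.log_le_log (by positivity) h1).trans h2
  have hL2 : 1 ≤ logI 2 (X : ℝ) := one_le_logI 1 _
  calc 3 * C * ∑ j ∈ Finset.range (J + 1), 1 / ((j + 1 : ℕ) : ℝ)
      ≤ 3 * C * (4 * logI 2 X) := by gcongr; linarith
    _ = _ := by ring

/-- A uniform Brun–Titchmarsh type bound for reciprocals of primes `1 mod m`. -/
lemma recipSum_dvd_sub_one_le (m x : ℕ) (hm : 1 ≤ m) (hc : m.primeFactors.card ≤ 2) :
    recipSum (fun r => m ∣ r - 1) x ≤ 1800 * logI 2 x / m := by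
  have hm' : (0 : ℝ) < m := by exact_mod_cast hm
  have h := sum_inv_le_of_card_le_div_log (A := fun k => (m * k + 1).Prime) (C := 150) (by norm_num)
    (fun K hK => card_prime_mul_add_one_le_div_log m K hm hc hK) x
  have h1 : recipSum (fun r => m ∣ r - 1) x
      ≤ ∑ r ∈ ((Finset.Icc 1 x).filter (fun k => (m * k + 1).Prime)).image (fun k => m * k + 1),
        1 / (r : ℝ) := by
    apply Finset.sum_le_sum_of_subset_of_nonneg
    · intro r hr
      simp only [Finset.mem_filter, Finset.mem_Icc] at hr
      obtain ⟨⟨h1, h2⟩, h3, k, hk⟩ := hr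
      have hr2 := h3.two_le
      have hrk : m * k + 1 = r := by omega
      simp only [Finset.mem_image, Finset.mem_filter, Finset.mem_Icc]
      refine ⟨k, ⟨⟨?_, ?_⟩, hrk ▸ h3⟩, hrk⟩
      · rcases Nat.eq_zero_or_pos k with h | h
        · subst h; omega
        · exact h
      · nlinarith
    · intros; positivity
  refine h1.trans ?_
  rw [Finset.sum_image (fun a _ b _ h => by
    have : m * a = m * b := by simpa using h
    exact Nat.eq_of_mul_eq_mul_left hm this)]
  have h2 : ∑ k ∈ (Finset.Icc 1 x).filter (fun k => (m * k + 1).Prime), 1 / ((m * k + 1 : ℕ) : ℝ)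
      ≤ (1 / (m : ℝ)) * ∑ k ∈ (Finset.Icc 1 x).filter (fun k => (m * k + 1).Prime), 1 / (k : ℝ) := by
    rw [Finset.mul_sum]
    refine Finset.sum_le_sum fun k hk => ?_
    simp only [Finset.mem_filter, Finset.mem_Icc] at hk
    have hk' : (0 : ℝ) < k := by exact_mod_cast hk.1.1
    rw [one_div_mul_one_div]
    apply one_div_le_one_div_of_le (by positivity)
    push_cast; linarith
  calc _ ≤ _ := h2
    _ ≤ (1 / (m : ℝ)) * (12 * 150 * logI 2 x) := by gcongr
    _ = _ := by ring

section Equidistribution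

variable {ι : Type*} [Fintype ι]

open scoped Pointwise in
lemma card_image_linear_box_ge {r : ℕ} [Fact r.Prime] (c : ι → ZMod r) {s : ℕ} (hs : 1 ≤ s)
    (hinj : ∀ b : ι → ℤ, b ≠ 0 → (∀ i, |b i| < s) → ∑ i, (b i : ZMod r) * c i ≠ 0) (k : ℕ) :
    min r (k * (s ^ Fintype.card ι - 1) + 1) ≤
      ((Fintype.piFinset (fun _ : ι => Finset.range (k * (s - 1) + 1))).image
        (fun v => ∑ i, (v i : ZMod r) * c i)).card := by
  induction k with
  | zero =>
    simp only [zero_mul, zero_add]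
    refine (min_le_right _ _).trans (Finset.card_pos.2 (Finset.Nonempty.image ?_ _))
    exact ⟨fun _ => 0, by simp⟩
  | succ k ih =>
    set V : ℕ → Finset (ZMod r) := fun k =>
      (Fintype.piFinset (fun _ : ι => Finset.range (k * (s - 1) + 1))).image
        (fun v => ∑ i, (v i : ZMod r) * c i) with hV
    have hne : ∀ k, (V k).Nonempty := fun k =>
      Finset.Nonempty.image ⟨fun _ => 0, by simp⟩ _
    have h1 : (V 1).card = s ^ Fintype.card ι := by
      have hs1 : 1 * (s - 1) + 1 = s := by omega
      simp only [hV, hs1]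
      rw [Finset.card_image_of_injOn, Fintype.card_piFinset, Finset.prod_const, Finset.card_range,
        Finset.card_univ]
      intro v hv w hw hvw
      simp only [Finset.mem_coe, Fintype.mem_piFinset, Finset.mem_range] at hv hw
      by_contra hne
      refine hinj (fun i => (v i : ℤ) - w i) ?_ ?_ ?_
      · intro h0; apply hne; ext i
        have := congrFun h0 i
        simp only [Pi.zero_apply] at this; omega
      · intro i
        have := hv i; have := hw i
        rw [abs_lt]; constructor <;> omega
      · push_cast
        simp only [sub_mul, Finset.sum_sub_distrib]
        exact sub_eq_zero.2 hvw
    have hsub : V k + V 1 ⊆ V (k + 1) := by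
      intro a ha
      obtain ⟨x, hx, y, hy, rfl⟩ := Finset.mem_add.1 ha
      simp only [hV, Finset.mem_image, Fintype.mem_piFinset, Finset.mem_range] at hx hy ⊢
      obtain ⟨v, hv, rfl⟩ := hx
      obtain ⟨w, hw, rfl⟩ := hy
      refine ⟨fun i => v i + w i, fun i => ?_, ?_⟩
      · have := hv i; have := hw i; rw [add_mul]; dsimp only; omega
      · push_cast
        simp only [add_mul, Finset.sum_add_distrib]
    have hcd := ZMod.cauchy_davenport (Fact.out : r.Prime) (hne k) (hne 1)
    have hcard := Finset.card_le_card hsub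
    have hpos : 1 ≤ s ^ Fintype.card ι := Nat.one_le_pow _ _ hs
    change min r (k * (s ^ Fintype.card ι - 1) + 1) ≤ (V k).card at ih
    change _ ≤ (V (k + 1)).card
    rw [h1] at hcd
    rw [add_mul]
    omega

lemma pow_le_mul_card_box_ker {r : ℕ} [Fact r.Prime] (c : ι → ZMod r) {s k B : ℕ} (hs : 1 ≤ s)
    (hinj : ∀ b : ι → ℤ, b ≠ 0 → (∀ i, |b i| < s) → ∑ i, (b i : ZMod r) * c i ≠ 0)
    (hk : r ≤ k * (s ^ Fintype.card ι - 1) + 1) :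
    (B - k * s) ^ Fintype.card ι ≤
      r * ((Fintype.piFinset (fun _ : ι => Finset.Icc 1 B)).filter
        (fun v => ∑ i, (v i : ZMod r) * c i = 0)).card := by
  have himg := card_image_linear_box_ge c hs hinj k
  rw [min_eq_left hk] at himg
  have hall : ∀ a : ZMod r, ∃ v : ι → ℕ, (∀ i, v i ≤ k * s) ∧ ∑ i, (v i : ZMod r) * c i = a := by
    intro a
    have huniv : ((Fintype.piFinset (fun _ : ι => Finset.range (k * (s - 1) + 1))).image
        (fun v => ∑ i, (v i : ZMod r) * c i)) = Finset.univ := by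
      apply Finset.eq_univ_of_card
      rw [ZMod.card]
      refine le_antisymm ?_ himg
      exact (Finset.card_le_univ _).trans (ZMod.card r).le
    have ha := Finset.mem_univ a
    rw [← huniv] at ha
    simp only [Finset.mem_image, Fintype.mem_piFinset, Finset.mem_range] at ha
    obtain ⟨v, hv, rfl⟩ := ha
    refine ⟨v, fun i => ?_, rfl⟩
    have := hv i
    have : k * (s - 1) ≤ k * s := Nat.mul_le_mul_left _ (by omega)
    have := hv i
    omega
  choose g hg1 hg2 using hall
  set P := Fintype.piFinset (fun _ : ι => Finset.Icc 1 (B - k * s)) with hP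
  set Q := (Fintype.piFinset (fun _ : ι => Finset.Icc 1 B)).filter
        (fun v => ∑ i, (v i : ZMod r) * c i = 0) with hQ
  have hPc : P.card = (B - k * s) ^ Fintype.card ι := by
    rw [hP, Fintype.card_piFinset, Finset.prod_const, Nat.card_Icc, Finset.card_univ]; simp
  rw [← hPc]
  have := Finset.card_le_mul_card_image_of_maps_to (s := P) (t := (Finset.univ : Finset (ZMod r)))
    (f := fun v => ∑ i, (v i : ZMod r) * c i) (fun _ _ => Finset.mem_univ _) Q.card ?_
  · rw [Finset.card_univ, ZMod.card] at this
    rw [mul_comm]; exact this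
  · intro a _
    apply Finset.card_le_card_of_injOn (fun v i => v i + g (-a) i)
    · intro v hv
      simp only [Finset.coe_filter, Set.mem_ofPred_eq, hP, Fintype.mem_piFinset,
        Finset.mem_Icc] at hv
      simp only [hQ, Finset.coe_filter, Set.mem_ofPred_eq, Fintype.mem_piFinset, Finset.mem_Icc]
      refine ⟨fun i => ?_, ?_⟩
      · have := hv.1 i; have := hg1 (-a) i; omega
      · push_cast
        simp only [add_mul, Finset.sum_add_distrib]
        rw [hv.2, hg2]; ring
    · intro v _ w _ h
      ext i
      have := congrFun h i
      simpa using this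

end Equidistribution

section NumberFieldNorm

open NumberField

variable {K : Type*} [Field K] [NumberField K]

lemma absNorm_span_eq_prod_embeddings (x : 𝓞 K) :
    (Ideal.absNorm (Ideal.span {x}) : ℝ) = ∏ σ : K →+* ℂ, ‖σ x‖ := by
  rw [Ideal.absNorm_span_singleton]
  have h := Algebra.norm_eq_prod_embeddings ℚ ℂ (x : K)
  have h2 : Algebra.norm ℚ (x : K) = ((Algebra.norm ℤ x : ℤ) : ℚ) :=
    (Algebra.coe_norm_int x).symm
  have h3 : ‖(algebraMap ℚ ℂ) (Algebra.norm ℚ (x : K))‖ = ((Algebra.norm ℤ x).natAbs : ℝ) := by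
    rw [h2]
    simp
  rw [← h3, h, norm_prod]
  rw [← Fintype.prod_equiv (RingHom.equivRatAlgHom K ℂ) (fun f => ‖f (x : K)‖)
    (fun φ => ‖φ (x : K)‖) fun _ => by simp [RingHom.equivRatAlgHom_apply]]

lemma absNorm_le_of_norm_le {x : 𝓞 K} {A : ℝ} (h : ∀ σ : K →+* ℂ, ‖σ x‖ ≤ A) :
    (Ideal.absNorm (Ideal.span {x}) : ℝ) ≤ A ^ Module.finrank ℚ K := by
  rw [absNorm_span_eq_prod_embeddings, ← NumberField.Embeddings.card K ℂ]
  refine (Finset.prod_le_prod (fun _ _ => norm_nonneg _) (fun σ _ => h σ)).trans ?_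
  rw [Finset.prod_const, Finset.card_univ]

lemma le_absNorm_of_mem {P : Ideal (𝓞 K)} (hP : P.IsPrime) {r : ℕ} (hr : r.Prime)
    (h : (r : 𝓞 K) ∈ P) : r ≤ Ideal.absNorm P := by
  have hbot : P ≠ ⊥ := by
    rintro rfl
    rw [Ideal.mem_bot] at h
    exact hr.ne_zero (by exact_mod_cast h)
  have hne : Ideal.absNorm P ≠ 0 := by rwa [Ne, Ideal.absNorm_eq_zero_iff]
  refine Nat.le_of_dvd (Nat.pos_of_ne_zero hne) ?_
  by_contra hd
  have hco := (Nat.Prime.coprime_iff_not_dvd hr).2 hd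
  have hmem := Ideal.absNorm_mem P
  apply hP.ne_top
  rw [Ideal.eq_top_iff_one]
  have hz : IsCoprime (r : ℤ) (Ideal.absNorm P : ℤ) := Nat.isCoprime_iff_coprime.2 hco
  obtain ⟨a, b, hab⟩ := hz
  have : (1 : 𝓞 K) = (a : 𝓞 K) * r + b * (Ideal.absNorm P : ℕ) := by exact_mod_cast hab.symm
  rw [this]
  exact P.add_mem (P.mul_mem_left _ h) (P.mul_mem_left _ hmem)

lemma prod_absNorm_le_of_mem {x : 𝓞 K} (hx : x ≠ 0) (S : Finset (Ideal (𝓞 K)))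
    (hS : ∀ P ∈ S, P.IsPrime ∧ x ∈ P) :
    ∏ P ∈ S, Ideal.absNorm P ≤ Ideal.absNorm (Ideal.span {x}) := by
  have hne : Ideal.absNorm (Ideal.span {x}) ≠ 0 := by
    rw [Ne, Ideal.absNorm_eq_zero_iff, Ideal.span_singleton_eq_bot]; exact hx
  refine Nat.le_of_dvd (Nat.pos_of_ne_zero hne) ?_
  rw [← map_prod]
  apply Ideal.absNorm_dvd_absNorm_of_le
  rw [← Ideal.dvd_iff_le]
  apply Finset.prod_primes_dvd
  · intro P hP
    have hbot : P ≠ ⊥ := by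
      rintro rfl; exact hx (by simpa using (hS _ hP).2)
    exact Ideal.prime_of_isPrime hbot (hS P hP).1
  · intro P hP
    rw [Ideal.dvd_iff_le, Ideal.span_singleton_le_iff_mem]
    exact (hS P hP).2

end NumberFieldNorm

section SplitPrimesUpper

open NumberField

variable {K : Type*} [Field K] [NumberField K] {ι : Type*} [Fintype ι]

/-- The integer combination of the integers `ω i` with coefficients `b i`. -/
noncomputable def intComb (ω : ι → 𝓞 K) (b : ι → ℤ) : 𝓞 K := ∑ i, (b i : 𝓞 K) * ω i

/-- There are `[K : ℚ]` primes above `r`, modulo each of which every `ω i` is a rational integer. -/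
def SplitsAt (ω : ι → 𝓞 K) (r : ℕ) : Prop :=
  ∃ S : Finset (Ideal (𝓞 K)), S.card = Module.finrank ℚ K ∧
    ∀ P ∈ S, P.IsPrime ∧ (r : 𝓞 K) ∈ P ∧ ∀ i, ∃ c : ℤ, ω i - c ∈ P

lemma norm_embedding_intComb_le {ω : ι → 𝓞 K} {Ω : ℕ}
    (hΩ : ∀ (σ : K →+* ℂ) (i : ι), ‖σ (ω i)‖ ≤ Ω) {b : ι → ℤ} {B : ℝ}
    (hb : ∀ i, |(b i : ℝ)| ≤ B) (σ : K →+* ℂ) :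
    ‖σ (intComb ω b)‖ ≤ Fintype.card ι * Ω * B := by
  have hB : ι → 0 ≤ B := fun i => (abs_nonneg _).trans (hb i)
  rw [intComb]
  push_cast
  rw [map_sum]
  refine (norm_sum_le _ _).trans ?_
  calc ∑ i, ‖σ ((b i : K) * ω i)‖ ≤ ∑ _i : ι, B * Ω := by
        refine Finset.sum_le_sum fun i _ => ?_
        rw [map_mul, norm_mul, map_intCast, Complex.norm_intCast]
        exact mul_le_mul (hb i) (hΩ σ i) (norm_nonneg _) (hB i)
    _ = _ := by rw [Finset.sum_const, Finset.card_univ, nsmul_eq_mul]; ring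

lemma absNorm_intComb_le {ω : ι → 𝓞 K} {Ω : ℕ} (hcard : Fintype.card ι = Module.finrank ℚ K)
    (hΩ : ∀ (σ : K →+* ℂ) (i : ι), ‖σ (ω i)‖ ≤ Ω) {b : ι → ℤ} {B : ℝ}
    (hb : ∀ i, |(b i : ℝ)| ≤ B) :
    (Ideal.absNorm (Ideal.span {intComb ω b}) : ℝ)
      ≤ (Module.finrank ℚ K * Ω * B) ^ Module.finrank ℚ K := by
  apply absNorm_le_of_norm_le
  intro σ
  rw [← hcard]
  exact norm_embedding_intComb_le hΩ hb σ

lemma one_le_absNorm_span {x : 𝓞 K} (hx : x ≠ 0) : 1 ≤ Ideal.absNorm (Ideal.span {x}) := by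
  have : Ideal.absNorm (Ideal.span {x}) ≠ 0 := by
    rw [Ne, Ideal.absNorm_eq_zero_iff, Ideal.span_singleton_eq_bot]; exact hx
  omega

lemma intCast_mem_iff_of_prime_mem {P : Ideal (𝓞 K)} (hP : P.IsPrime) {r : ℕ} (hr : r.Prime)
    (h : (r : 𝓞 K) ∈ P) (a : ℤ) : (a : 𝓞 K) ∈ P ↔ (r : ℤ) ∣ a := by
  constructor
  · intro ha
    by_contra hd
    obtain ⟨u, v, huv⟩ := ((Nat.prime_iff_prime_int.1 hr).coprime_iff_not_dvd.2 hd)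
    apply hP.ne_top
    rw [Ideal.eq_top_iff_one]
    have : (1 : 𝓞 K) = (u : 𝓞 K) * r + v * a := by exact_mod_cast huv.symm
    rw [this]
    exact P.add_mem (P.mul_mem_left _ h) (P.mul_mem_left _ ha)
  · rintro ⟨c, rfl⟩
    push_cast
    exact P.mul_mem_right _ h

lemma pow_le_mul_card_box_mem {ω : ι → 𝓞 K} {Ω : ℕ}
    (hcard : Fintype.card ι = Module.finrank ℚ K) (hΩ1 : 1 ≤ Ω)
    (hΩ : ∀ (σ : K →+* ℂ) (i : ι), ‖σ (ω i)‖ ≤ Ω) (hli : ∀ b : ι → ℤ, intComb ω b = 0 → b = 0)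
    {r : ℕ} (hr : r.Prime) {P : Ideal (𝓞 K)} (hP : P.IsPrime) (hrP : (r : 𝓞 K) ∈ P)
    (hω : ∀ i, ∃ c : ℤ, ω i - c ∈ P) {n M τ B : ℕ} (hn : n = Module.finrank ℚ K) (hM : M = n * Ω)
    (hr1 : (2 * M) ^ n ≤ r) (hr2 : r ≤ τ ^ n) :
    (B - 2 * (2 * M) ^ n * τ) ^ n ≤
      r * ((Fintype.piFinset (fun _ : ι => Finset.Icc 1 B)).filter
        (fun v => intComb ω (fun i => (v i : ℤ)) ∈ P)).card := by
  have : Fact r.Prime := ⟨hr⟩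
  have hn1 : 1 ≤ n := hn ▸ Module.finrank_pos
  have hM1 : 1 ≤ M := hM ▸ Nat.mul_pos hn1 hΩ1
  choose c hc using hω
  have hmem : ∀ b : ι → ℤ, intComb ω b ∈ P ↔ ∑ i, (b i : ZMod r) * (c i : ZMod r) = 0 := by
    intro b
    have h1 : intComb ω b - ((∑ i, b i * c i : ℤ) : 𝓞 K) ∈ P := by
      have : intComb ω b - ((∑ i, b i * c i : ℤ) : 𝓞 K)
          = ∑ i, (b i : 𝓞 K) * (ω i - c i) := by
        rw [intComb]; push_cast; rw [← Finset.sum_sub_distrib]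
        refine Finset.sum_congr rfl fun i _ => ?_
        ring
      rw [this]
      exact P.sum_mem fun i _ => P.mul_mem_left _ (hc i)
    have h2 : intComb ω b ∈ P ↔ ((∑ i, b i * c i : ℤ) : 𝓞 K) ∈ P := by
      constructor
      · intro h
        have := P.sub_mem h h1
        simpa using this
      · intro h
        have := P.add_mem h1 h
        simpa using this
    rw [h2, intCast_mem_iff_of_prime_mem hP hr hrP, ← ZMod.intCast_zmod_eq_zero_iff_dvd]
    push_cast
    rfl
  set ρ := (r : ℝ) ^ (1 / n : ℝ) with hρ
  have hn0 : (n : ℝ) ≠ 0 := by positivity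
  have hρn : ρ ^ n = r := by
    rw [hρ, ← Real.rpow_natCast, ← Real.rpow_mul (by positivity), one_div_mul_cancel hn0,
      Real.rpow_one]
  have hρ0 : 0 ≤ ρ := by positivity
  have hM0 : (0 : ℝ) < M := by exact_mod_cast hM1
  have hρ1 : 2 * (M : ℝ) ≤ ρ := by
    refine le_of_pow_le_pow_left₀ (n := n) (by omega) hρ0 ?_
    rw [hρn]; exact_mod_cast hr1
  have hρ2 : ρ ≤ τ := by
    refine le_of_pow_le_pow_left₀ (n := n) (by omega) (by positivity) ?_
    rw [hρn]; exact_mod_cast hr2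
  set s := ⌊ρ / M⌋₊ with hs
  have hs2 : 2 ≤ s := by
    rw [hs, Nat.le_floor_iff (by positivity), le_div_iff₀ hM0]; exact_mod_cast hρ1
  have hs3 : (s : ℝ) * M ≤ ρ := by
    rw [← le_div_iff₀ hM0]; exact Nat.floor_le (by positivity)
  have hs4 : ρ < ((s : ℝ) + 1) * M := by
    rw [← div_lt_iff₀ hM0]; exact Nat.lt_floor_add_one _
  have hinj : ∀ b : ι → ℤ, b ≠ 0 → (∀ i, |b i| < s) →
      ∑ i, (b i : ZMod r) * (c i : ZMod r) ≠ 0 := by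
    intro b hb0 hb h0
    have hbP := (hmem b).2 h0
    have hne : intComb ω b ≠ 0 := fun h => hb0 (hli b h)
    have h1 := prod_absNorm_le_of_mem hne {P} (by simpa using ⟨hP, hbP⟩)
    rw [Finset.prod_singleton] at h1
    have h2 := le_absNorm_of_mem hP hr hrP
    have h3 := absNorm_intComb_le hcard hΩ (b := b) (B := (s : ℝ) - 1) (by
      intro i
      have := hb i
      have h' : |b i| ≤ (s : ℤ) - 1 := by omega
      exact_mod_cast h')
    have h4 : (r : ℝ) ≤ (Module.finrank ℚ K * Ω * ((s : ℝ) - 1)) ^ Module.finrank ℚ K :=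
      le_trans (by exact_mod_cast h2.trans h1) h3
    rw [← hn] at h4
    have hMR : (M : ℝ) = n * Ω := by exact_mod_cast hM
    rw [← hMR, ← hρn] at h4
    have hs1 : (0 : ℝ) ≤ (s : ℝ) - 1 := by
      have : (2 : ℝ) ≤ s := by exact_mod_cast hs2
      linarith
    have h5 := le_of_pow_le_pow_left₀ (by omega) (by positivity) h4
    nlinarith
  have hk : r ≤ 2 * (2 * M) ^ n * (s ^ Fintype.card ι - 1) + 1 := by
    rw [hcard, ← hn]
    have h1 : (r : ℝ) ≤ (2 * M * s) ^ n := by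
      rw [← hρn]
      refine pow_le_pow_left₀ hρ0 ?_ n
      have : (2 : ℝ) ≤ s := by exact_mod_cast hs2
      nlinarith
    have h2 : r ≤ (2 * M) ^ n * s ^ n := by
      rw [← mul_pow]; exact_mod_cast h1
    have h3 : 2 ≤ s ^ n := hs2.trans (Nat.le_self_pow (by omega) s)
    have h4 : s ^ n ≤ 2 * (s ^ n - 1) := by omega
    calc r ≤ (2 * M) ^ n * s ^ n := h2
      _ ≤ (2 * M) ^ n * (2 * (s ^ n - 1)) := by gcongr
      _ ≤ _ := by rw [← mul_assoc, mul_comm _ 2]; omega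
  have hmain := pow_le_mul_card_box_ker (fun i => (c i : ZMod r)) (s := s)
    (k := 2 * (2 * M) ^ n) (B := B) (by omega) hinj hk
  rw [hcard, ← hn] at hmain
  have hsτ : s ≤ τ := by
    have : (s : ℝ) ≤ τ := by
      have : (1 : ℝ) ≤ M := by exact_mod_cast hM1
      nlinarith
    exact_mod_cast this
  refine le_trans (Nat.pow_le_pow_left (Nat.sub_le_sub_left (Nat.mul_le_mul_left _ hsτ) _) n)
    (hmain.trans ?_)
  apply Nat.mul_le_mul_left
  apply Finset.card_le_card
  intro v hv
  simp only [Finset.mem_filter] at hv ⊢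
  refine ⟨hv.1, (hmem _).2 ?_⟩
  simpa using hv.2

lemma sum_log_div_mul_pow_le {ω : ι → 𝓞 K} {Ω : ℕ}
    (hcard : Fintype.card ι = Module.finrank ℚ K) (hΩ1 : 1 ≤ Ω)
    (hΩ : ∀ (σ : K →+* ℂ) (i : ι), ‖σ (ω i)‖ ≤ Ω) (hli : ∀ b : ι → ℤ, intComb ω b = 0 → b = 0)
    {n M τ B : ℕ} (hn : n = Module.finrank ℚ K) (hM : M = n * Ω)
    (R : Finset ℕ) (hR : ∀ r ∈ R, r.Prime ∧ (2 * M) ^ n ≤ r ∧ r ≤ τ ^ n ∧ SplitsAt ω r) :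
    (∑ r ∈ R, Real.log r / r) * ((B - 2 * (2 * M) ^ n * τ : ℕ) : ℝ) ^ n
      ≤ (B : ℝ) ^ n * Real.log (M * B) := by
  have hn1 : 1 ≤ n := hn ▸ Module.finrank_pos
  have hM1 : 1 ≤ M := hM ▸ Nat.mul_pos hn1 hΩ1
  have hMR : (M : ℝ) = n * Ω := by exact_mod_cast hM
  have hι : Nonempty ι := Fintype.card_pos_iff.1 (by rw [hcard, ← hn]; exact hn1)
  set Box := Fintype.piFinset (fun _ : ι => Finset.Icc 1 B) with hBox
  have hBoxc : Box.card = B ^ n := by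
    rw [hBox, Fintype.card_piFinset, Finset.prod_const, Nat.card_Icc, Finset.card_univ, hcard,
      ← hn]; simp
  set β : (ι → ℕ) → 𝓞 K := fun v => intComb ω (fun i => (v i : ℤ)) with hβ
  have hne : ∀ v ∈ Box, β v ≠ 0 := by
    intro v hv h0
    have := hli _ h0
    obtain ⟨i⟩ := hι
    have hvi := congrFun this i
    have := Fintype.mem_piFinset.1 hv i
    simp only [Finset.mem_Icc] at this
    simp only [Pi.zero_apply] at hvi
    omega
  have hS : ∀ r : ℕ, ∃ S : Finset (Ideal (𝓞 K)), r ∈ R → S.card = n ∧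
    ∀ P ∈ S, P.IsPrime ∧ (r : 𝓞 K) ∈ P ∧ ∀ i, ∃ c : ℤ, ω i - c ∈ P := by
    intro r
    by_cases h : r ∈ R
    · obtain ⟨S, h1, h2⟩ := (hR r h).2.2.2
      exact ⟨S, fun _ => ⟨h1.trans hn.symm, h2⟩⟩
    · exact ⟨∅, fun h' => absurd h' h⟩
  choose S hS using hS
  -- upper bound for the norms
  have hup : ∑ v ∈ Box, Real.log (Ideal.absNorm (Ideal.span {β v}))
      ≤ (B : ℝ) ^ n * (n * Real.log (M * B)) := by
    have : ∀ v ∈ Box, Real.log (Ideal.absNorm (Ideal.span {β v})) ≤ n * Real.log (M * B) := by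
      intro v hv
      have h1 := absNorm_intComb_le hcard hΩ (b := fun i => (v i : ℤ)) (B := (B : ℝ)) (by
        intro i
        have := Fintype.mem_piFinset.1 hv i
        simp only [Finset.mem_Icc] at this
        simp only [Int.cast_natCast, Nat.abs_cast]
        exact_mod_cast this.2)
      rw [← hn, ← hMR] at h1
      have h2 : (0 : ℝ) < Ideal.absNorm (Ideal.span {β v}) := by
        exact_mod_cast one_le_absNorm_span (hne v hv)
      have h3 := Real.log_le_log h2 h1
      rwa [Real.log_pow] at h3
    refine (Finset.sum_le_sum this).trans ?_
    rw [Finset.sum_const, hBoxc, nsmul_eq_mul]; push_cast; exact le_rfl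
  -- lower bound
  have hlow : ∀ v ∈ Box, ∑ r ∈ R, ∑ P ∈ S r, (if β v ∈ P then Real.log r else 0)
      ≤ Real.log (Ideal.absNorm (Ideal.span {β v})) := by
    intro v hv
    set F : ℕ → Finset (Ideal (𝓞 K)) := fun r => (S r).filter (fun P => β v ∈ P) with hF
    have hdisj : (R : Set ℕ).PairwiseDisjoint F := by
      intro r hr r' hr' hrr'
      rw [Function.onFun, Finset.disjoint_left]
      intro P hP hP'
      simp only [hF, Finset.mem_filter] at hP hP'
      have h1 := (hS r hr).2 P hP.1
      have h2 := (hS r' hr').2 P hP'.1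
      have h3 := (intCast_mem_iff_of_prime_mem h1.1 (hR r hr).1 h1.2.1 (r' : ℤ)).1
        (by exact_mod_cast h2.2.1)
      have h4 : r ∣ r' := by exact_mod_cast h3
      exact hrr' ((Nat.prime_dvd_prime_iff_eq (hR r hr).1 (hR r' hr').1).1 h4)
    have hprod := prod_absNorm_le_of_mem (hne v hv) (R.biUnion F) (by
      intro P hP
      simp only [hF, Finset.mem_biUnion, Finset.mem_filter] at hP
      obtain ⟨r, hr, hP, hv⟩ := hP
      exact ⟨((hS r hr).2 P hP).1, hv⟩)
    rw [Finset.prod_biUnion hdisj] at hprod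
    have hle : ∏ r ∈ R, ∏ P ∈ F r, r ≤ ∏ r ∈ R, ∏ P ∈ F r, Ideal.absNorm P := by
      refine Finset.prod_le_prod' fun r hr => Finset.prod_le_prod' fun P hP => ?_
      have h1 := (hS r hr).2 P (Finset.mem_filter.1 hP).1
      exact le_absNorm_of_mem h1.1 (hR r hr).1 h1.2.1
    have hle2 : ((∏ r ∈ R, ∏ P ∈ F r, r : ℕ) : ℝ) ≤ Ideal.absNorm (Ideal.span {β v}) := by
      exact_mod_cast hle.trans hprod
    have hpos : (0 : ℝ) < ((∏ r ∈ R, ∏ P ∈ F r, r : ℕ) : ℝ) := by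
      rw [Nat.cast_pos]
      exact Finset.prod_pos fun r hr => Finset.prod_pos fun P _ => (hR r hr).1.pos
    have hlog := Real.log_le_log hpos hle2
    refine le_trans (le_of_eq ?_) hlog
    push_cast
    rw [Real.log_prod (fun r hr => by
      have := (hR r hr).1.pos
      exact (Finset.prod_pos fun P _ => by positivity).ne')]
    refine Finset.sum_congr rfl fun r hr => ?_
    rw [Real.log_prod (fun P _ => by
      have := (hR r hr).1.pos
      positivity), hF, Finset.sum_filter]
  have hsum := (Finset.sum_le_sum hlow).trans hup
  rw [Finset.sum_comm] at hsum
  have hr : ∀ r ∈ R, n * (Real.log r / r * ((B - 2 * (2 * M) ^ n * τ : ℕ) : ℝ) ^ n) ≤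
      ∑ v ∈ Box, ∑ P ∈ S r, (if β v ∈ P then Real.log r else 0) := by
    intro r hr
    have hr' := hR r hr
    have hr0 : (0 : ℝ) < r := by exact_mod_cast hr'.1.pos
    have hlogr : 0 ≤ Real.log r := Real.log_natCast_nonneg r
    rw [Finset.sum_comm]
    have hP : ∀ P ∈ S r, Real.log r / r * ((B - 2 * (2 * M) ^ n * τ : ℕ) : ℝ) ^ n ≤
        ∑ v ∈ Box, (if β v ∈ P then Real.log r else 0) := by
      intro P hP
      have h1 := (hS r hr).2 P hP
      have h2 := pow_le_mul_card_box_mem hcard hΩ1 hΩ hli hr'.1 h1.1 h1.2.1 h1.2.2 (B := B) hn hM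
        hr'.2.1 hr'.2.2.1
      rw [← Finset.sum_filter, Finset.sum_const, nsmul_eq_mul]
      have h3 : ((B - 2 * (2 * M) ^ n * τ : ℕ) : ℝ) ^ n ≤
        r * ((Box.filter (fun v => β v ∈ P)).card : ℝ) := by exact_mod_cast h2
      calc Real.log r / r * ((B - 2 * (2 * M) ^ n * τ : ℕ) : ℝ) ^ n
          ≤ Real.log r / r * (r * ((Box.filter (fun v => β v ∈ P)).card : ℝ)) := by gcongr
        _ = _ := by field_simp
    calc _ = ∑ P ∈ S r, Real.log r / r * ((B - 2 * (2 * M) ^ n * τ : ℕ) : ℝ) ^ n := by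
          rw [Finset.sum_const, (hS r hr).1, nsmul_eq_mul]
      _ ≤ _ := Finset.sum_le_sum hP
  have hfin := (Finset.sum_le_sum hr).trans hsum
  rw [← Finset.mul_sum, ← Finset.sum_mul] at hfin
  have hn0 : (0 : ℝ) < n := by exact_mod_cast hn1
  have : (n : ℝ) * ((∑ r ∈ R, Real.log r / r) * ((B - 2 * (2 * M) ^ n * τ : ℕ) : ℝ) ^ n)
      ≤ n * ((B : ℝ) ^ n * Real.log (M * B)) := by linarith
  exact le_of_mul_le_mul_left this hn0

end SplitPrimesUpper

lemma one_sub_log_div_log_le {t : ℝ} (ht : 1 < t) {u : ℝ} (hu : t ≤ u) :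
    1 - Real.log t / Real.log u ≤ Real.log (Real.log u) - Real.log (Real.log t) := by
  have h1 : 0 < Real.log t := Real.log_pos ht
  have h2 : 0 < Real.log u := Real.log_pos (ht.trans_le hu)
  have := Real.log_le_sub_one_of_pos (div_pos h1 h2)
  rw [Real.log_div h1.ne' h2.ne'] at this
  linarith

lemma sum_inv_le_of_sum_log_div_le (Q : ℕ → Prop) {c E : ℝ} (hc : 0 ≤ c)
    {T₀ x : ℕ} (hT₀ : 2 ≤ T₀) (hx : T₀ ≤ x)
    (hA : ∀ T : ℕ, 2 ≤ T → T ≤ x →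
      ∑ r ∈ (Finset.Icc 1 T).filter Q, Real.log r / r ≤ c * Real.log T + E) :
    ∑ r ∈ (Finset.Ioc T₀ x).filter Q, 1 / (r : ℝ) ≤
      c * (Real.log (Real.log x) - Real.log (Real.log T₀) + 1) + E / Real.log T₀ := by
  set A : ℕ → ℝ := fun T => ∑ r ∈ (Finset.Icc 1 T).filter Q, Real.log r / r with hAdef
  have hlog : ∀ t : ℕ, 2 ≤ t → 0 < Real.log t := fun t ht =>
    Real.log_pos (by exact_mod_cast ht)
  have key : ∀ T : ℕ, T₀ ≤ T → T ≤ x →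
      ∑ r ∈ (Finset.Ioc T₀ T).filter Q, 1 / (r : ℝ) - A T / Real.log T ≤
        c * (Real.log (Real.log T) - Real.log (Real.log T₀)) + E * (1 / Real.log T₀ - 1 / Real.log T) := by
    intro T hT
    induction T, hT using Nat.le_induction with
    | base =>
      intro _
      have : 0 ≤ A T₀ := Finset.sum_nonneg fun r _ =>
        div_nonneg (Real.log_natCast_nonneg r) (Nat.cast_nonneg r)
      have := div_nonneg this (hlog T₀ hT₀).le
      simp; linarith
    | succ T hT ih =>
      intro hTx
      have ih := ih (by omega)
      have hl := hlog T (by omega)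
      have hl' := hlog (T + 1) (by omega)
      have h1 : ∑ r ∈ (Finset.Ioc T₀ (T + 1)).filter Q, 1 / (r : ℝ)
          = ∑ r ∈ (Finset.Ioc T₀ T).filter Q, 1 / (r : ℝ) +
            (if Q (T + 1) then 1 / ((T + 1 : ℕ) : ℝ) else 0) := by
        rw [Finset.sum_filter, Finset.sum_filter, Finset.sum_Ioc_succ_top (by omega)]
      have h2 : A (T + 1) = A T +
            (if Q (T + 1) then Real.log ((T + 1 : ℕ) : ℝ) / ((T + 1 : ℕ) : ℝ) else 0) := by
        simp only [hAdef]
        rw [Finset.sum_filter, Finset.sum_filter, Finset.sum_Icc_succ_top (by omega)]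
      have h3 : A (T + 1) / Real.log ((T + 1 : ℕ) : ℝ) = A T / Real.log ((T + 1 : ℕ) : ℝ) +
            (if Q (T + 1) then 1 / ((T + 1 : ℕ) : ℝ) else 0) := by
        rw [h2, add_div]
        congr 1
        split_ifs
        · field_simp
        · simp
      rw [h1, h3]
      have hmono : Real.log T ≤ Real.log ((T + 1 : ℕ) : ℝ) :=
        Real.log_le_log (by exact_mod_cast (by omega : 0 < T)) (by push_cast; linarith)
      have h4 := hA T (by omega) (by omega)
      have h5 := one_sub_log_div_log_le (t := (T : ℝ)) (u := ((T + 1 : ℕ) : ℝ))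
        (by exact_mod_cast (by omega : 1 < T)) (by push_cast; linarith)
      have h6 : 0 ≤ 1 / Real.log T - 1 / Real.log ((T + 1 : ℕ) : ℝ) :=
        sub_nonneg.2 (one_div_le_one_div_of_le hl hmono)
      have h7 : A T * (1 / Real.log T - 1 / Real.log ((T + 1 : ℕ) : ℝ)) ≤
          (c * Real.log T + E) * (1 / Real.log T - 1 / Real.log ((T + 1 : ℕ) : ℝ)) :=
        mul_le_mul_of_nonneg_right h4 h6
      have h8 : (c * Real.log T + E) * (1 / Real.log T - 1 / Real.log ((T + 1 : ℕ) : ℝ))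
          = c * (1 - Real.log T / Real.log ((T + 1 : ℕ) : ℝ)) +
            E * (1 / Real.log T - 1 / Real.log ((T + 1 : ℕ) : ℝ)) := by
        field_simp
      have h9 := mul_le_mul_of_nonneg_left h5 hc
      have h10 : A T * (1 / Real.log T - 1 / Real.log ((T + 1 : ℕ) : ℝ))
        = A T / Real.log T - A T / Real.log ((T + 1 : ℕ) : ℝ) := by ring
      nlinarith
  have h1 := key x hx le_rfl
  have hlx := hlog x (by omega)
  have h2 := hA x (by omega) le_rfl
  have h3 : A x / Real.log x ≤ c + E * (1 / Real.log x) := by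
    rw [div_le_iff₀ hlx]
    calc A x ≤ c * Real.log x + E := h2
      _ = _ := by field_simp
  have h4 : E * (1 / Real.log T₀) = E / Real.log T₀ := by ring
  linarith

section SplitPrimesUpper

open NumberField

variable {K : Type*} [Field K] [NumberField K] {ι : Type*} [Fintype ι]

lemma sum_log_div_le_of_splitsAt {ω : ι → 𝓞 K} {Ω : ℕ}
    (hcard : Fintype.card ι = Module.finrank ℚ K) (hΩ1 : 1 ≤ Ω)
    (hΩ : ∀ (σ : K →+* ℂ) (i : ι), ‖σ (ω i)‖ ≤ Ω) (hli : ∀ b : ι → ℤ, intComb ω b = 0 → b = 0)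
    {n M : ℕ} (hn : n = Module.finrank ℚ K) (hM : M = n * Ω)
    {T t : ℕ} (hT : 2 ≤ T) (htT : Real.log T ≤ t)
    (Q : ℕ → Prop) (hQ : ∀ r, Q r → r.Prime ∧ (2 * M) ^ n ≤ r ∧ SplitsAt ω r) :
    ∑ r ∈ (Finset.Icc 1 T).filter Q, Real.log r / r ≤
      1 / n * Real.log T + (1 + 2 * Real.log (8 * n * M * (2 * (2 * M) ^ n) * t)) := by
  have hn1 : 1 ≤ n := hn ▸ Module.finrank_pos
  have hM1 : 1 ≤ M := hM ▸ Nat.mul_pos hn1 hΩ1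
  have hT1 : (2 : ℝ) ≤ T := by exact_mod_cast hT
  have hlT : 0 < Real.log T := Real.log_pos (by linarith)
  have ht1 : 1 ≤ t := by
    have : (0 : ℝ) < t := hlT.trans_le htT
    exact_mod_cast this
  have hn0 : (0 : ℝ) < n := by exact_mod_cast hn1
  have hM0 : (0 : ℝ) < M := by exact_mod_cast hM1
  have ht0 : (1 : ℝ) ≤ t := by exact_mod_cast ht1
  set k := 2 * (2 * M) ^ n with hk
  have hk1 : 1 ≤ k := by
    have : 0 < (2 * M) ^ n := by positivity
    omega
  have hk0 : (0 : ℝ) < k := by exact_mod_cast hk1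
  set ρ := (T : ℝ) ^ (1 / n : ℝ) with hρ
  have hρ1 : 1 ≤ ρ := Real.one_le_rpow (by linarith) (by positivity)
  have hρn : ρ ^ n = T := by
    rw [hρ, ← Real.rpow_natCast, ← Real.rpow_mul (by positivity), one_div_mul_cancel hn0.ne',
      Real.rpow_one]
  have hlogρ : Real.log ρ = 1 / n * Real.log T := Real.log_rpow (by linarith) _
  set τ := ⌈ρ⌉₊ with hτ
  have hτ1 : ρ ≤ τ := Nat.le_ceil ρ
  have hτ2 : (τ : ℝ) ≤ 2 * ρ := by
    have := Nat.ceil_lt_add_one (by linarith : 0 ≤ ρ)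
    linarith
  have hτ0 : (0 : ℝ) < τ := by linarith
  set B := 4 * n * k * τ * t with hB
  have hmain := sum_log_div_mul_pow_le hcard hΩ1 hΩ hli (τ := τ) (B := B) hn hM
    ((Finset.Icc 1 T).filter Q) (by
      intro r hr
      simp only [Finset.mem_filter, Finset.mem_Icc] at hr
      obtain ⟨h1, h2, h3⟩ := hQ r hr.2
      refine ⟨h1, h2, ?_, h3⟩
      have : (r : ℝ) ≤ (τ : ℝ) ^ n := by
        calc (r : ℝ) ≤ T := by exact_mod_cast hr.1.2
          _ = ρ ^ n := hρn.symm
          _ ≤ _ := by gcongr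
      exact_mod_cast this)
  set S := ∑ r ∈ (Finset.Icc 1 T).filter Q, Real.log r / r with hS
  have hS0 : 0 ≤ S := Finset.sum_nonneg fun r _ =>
    div_nonneg (Real.log_natCast_nonneg r) (Nat.cast_nonneg r)
  have hBr : (B : ℝ) = 4 * n * k * τ * t := by rw [hB]; push_cast; ring
  have hB0 : (0 : ℝ) < B := by rw [hBr]; positivity
  have hsub : (B : ℝ) * (1 - 1 / (4 * n * t)) ≤ ((B - k * τ : ℕ) : ℝ) := by
    have : (B : ℝ) - k * τ ≤ ((B - k * τ : ℕ) : ℝ) := by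
      have : B ≤ (B - k * τ) + k * τ := by omega
      have : (B : ℝ) ≤ ((B - k * τ : ℕ) : ℝ) + k * τ := by exact_mod_cast this
      linarith
    refine le_trans (le_of_eq ?_) this
    rw [hBr]; field_simp
  have h1t : 1 / (4 * n * t) ≤ (1 : ℝ) / 4 := by
    apply one_div_le_one_div_of_le (by norm_num)
    have : (1 : ℝ) ≤ n := by exact_mod_cast hn1
    nlinarith
  have hbern : 1 - 1 / (4 * t) ≤ (1 - 1 / (4 * n * t) : ℝ) ^ n := by
    have := one_add_mul_le_pow (a := -(1 / (4 * n * t) : ℝ)) (by linarith) n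
    rw [← sub_eq_add_neg] at this
    refine le_trans (le_of_eq ?_) this
    field_simp; ring
  have hpow : (B : ℝ) ^ n * (1 - 1 / (4 * t)) ≤ ((B - k * τ : ℕ) : ℝ) ^ n := by
    calc (B : ℝ) ^ n * (1 - 1 / (4 * t)) ≤ (B : ℝ) ^ n * (1 - 1 / (4 * n * t) : ℝ) ^ n := by gcongr
      _ = (B * (1 - 1 / (4 * n * t) : ℝ)) ^ n := (mul_pow _ _ _).symm
      _ ≤ _ := by
        apply pow_le_pow_left₀ _ hsub
        exact mul_nonneg hB0.le (by linarith)
  set Λ := Real.log (M * B) with hΛ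
  have h2 : S * (1 - 1 / (4 * t)) ≤ Λ := by
    have : (B : ℝ) ^ n * (S * (1 - 1 / (4 * t))) ≤ (B : ℝ) ^ n * Λ := by
      calc (B : ℝ) ^ n * (S * (1 - 1 / (4 * t))) = S * ((B : ℝ) ^ n * (1 - 1 / (4 * t))) := by ring
        _ ≤ S * ((B - k * τ : ℕ) : ℝ) ^ n := by gcongr
        _ ≤ _ := hmain
    exact le_of_mul_le_mul_left this (by positivity)
  set c0 := Real.log (8 * n * M * k * t) with hc0
  have hc0' : 0 ≤ c0 := by
    apply Real.log_nonneg
    have : 1 ≤ 8 * n * M * k * t := Nat.succ_le_of_lt (by positivity)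
    exact_mod_cast this
  have hΛ2 : Λ ≤ 1 / n * Real.log T + c0 := by
    rw [hΛ, hc0, ← hlogρ, ← Real.log_mul (by linarith) (by positivity)]
    apply Real.log_le_log (by positivity)
    rw [hBr]
    calc (M : ℝ) * (4 * n * k * τ * t) = (4 * n * M * k * t) * τ := by ring
      _ ≤ (4 * n * M * k * t) * (2 * ρ) := by gcongr
      _ = _ := by ring
  have h3 : S ≤ Λ + S / (4 * t) := by
    have : S * (1 - 1 / (4 * t)) = S - S / (4 * t) := by ring
    linarith
  have hdiv : S / (4 * t) ≤ S / 4 := div_le_div_of_nonneg_left hS0 (by norm_num) (by linarith)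
  have hS2 : S ≤ 2 * (1 / n * Real.log T + c0) := by linarith
  have hcast : Real.log (8 * n * M * (2 * (2 * M) ^ n) * t) = c0 := by
    rw [hc0, hk]; push_cast; rfl
  rw [hcast]
  have h5 : S / (4 * t) ≤ 1 / 2 + c0 / 2 := by
    rw [div_le_iff₀ (by linarith)]
    have : 1 / n * Real.log T ≤ Real.log T := by
      have : 1 / (n : ℝ) ≤ 1 := by
        rw [div_le_one hn0]; exact_mod_cast hn1
      nlinarith
    nlinarith
  linarith

lemma two_add_two_mul_log_le {n : ℕ} {M t Y : ℝ} (hn : 1 ≤ n) (hnM : (n : ℝ) ≤ M)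
    (ht : 1 ≤ t) (hY : 1 ≤ Y) (hlt : Real.log t ≤ 1 + Y) :
    2 + 2 * Real.log (8 * n * M * (2 * (2 * M) ^ n) * t) ≤ 20 * M ^ 2 * Y := by
  have hn1R : (1 : ℝ) ≤ n := by exact_mod_cast hn
  have hM1R : 1 ≤ M := hn1R.trans hnM
  have hc0le : Real.log (8 * n * M * (2 * (2 * M) ^ n) * t) =
      Real.log 16 + Real.log n + Real.log M + n * Real.log (2 * M) + Real.log t := by
    rw [show (8 * n * M * (2 * (2 * M) ^ n) * t : ℝ) = 16 * n * M * (2 * M) ^ n * t by ring,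
      Real.log_mul (by positivity) (by positivity), Real.log_mul (by positivity) (by positivity),
      Real.log_mul (by positivity) (by positivity), Real.log_mul (by positivity) (by positivity),
      Real.log_pow]
  have h16 : Real.log 16 ≤ 3 := by
    rw [show (16 : ℝ) = 2 ^ 4 by norm_num, Real.log_pow]
    have h2 := Real.log_two_lt_d9
    push_cast; linarith
  have hln := Real.log_le_sub_one_of_pos (by linarith : (0 : ℝ) < n)
  have hlM := Real.log_le_sub_one_of_pos (by linarith : (0 : ℝ) < M)
  have hl2M := Real.log_le_sub_one_of_pos (by linarith : (0 : ℝ) < 2 * M)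
  have h3 : n * Real.log (2 * M) ≤ M * (2 * M) :=
    mul_le_mul hnM (by linarith) (Real.log_nonneg (by linarith)) (by linarith)
  have h4 : 2 + 2 * Real.log (8 * n * M * (2 * (2 * M) ^ n) * t) ≤
      10 + 4 * M + 4 * M ^ 2 + 2 * Y := by
    rw [hc0le]; linarith only [h16, hln, hlM, h3, hlt, hnM, sq M]
  have h5 : (1 : ℝ) ≤ M ^ 2 := by nlinarith only [hM1R]
  have h6 : (M : ℝ) ≤ M ^ 2 := by nlinarith only [hM1R]
  nlinarith only [mul_nonneg (sub_nonneg.2 h5) (sub_nonneg.2 hY), h4, h5, h6, hY]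

lemma log_twenty_mul_le {M Y : ℝ} (hM : 1 ≤ M) (hY : 1 ≤ Y) :
    Real.log (20 * M ^ 2 * Y) ≤ 4 + 2 * Real.log M + Real.log Y := by
  rw [Real.log_mul (by positivity) (by positivity), Real.log_mul (by norm_num) (by positivity),
    Real.log_pow]
  have h20 : Real.log 20 ≤ 4 := by
    have h1 : Real.log 20 ≤ Real.log (2 ^ 5) := Real.log_le_log (by norm_num) (by norm_num)
    rw [Real.log_pow] at h1
    have h2 := Real.log_two_lt_d9
    push_cast at h1; linarith
  push_cast
  linarith

set_option maxHeartbeats 1000000 in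
lemma recipSum_le_of_splitsAt {ω : ι → 𝓞 K} {Ω : ℕ}
    (hcard : Fintype.card ι = Module.finrank ℚ K) (hΩ1 : 1 ≤ Ω)
    (hΩ : ∀ (σ : K →+* ℂ) (i : ι), ‖σ (ω i)‖ ≤ Ω) (hli : ∀ b : ι → ℤ, intComb ω b = 0 → b = 0)
    {n M : ℕ} (hn : n = Module.finrank ℚ K) (hM : M = n * Ω)
    (P : ℕ → Prop) (hP : ∀ r, r.Prime → P r → SplitsAt ω r) (x : ℕ) :
    recipSum P x ≤ logI 2 x / n +
      20000 * (1 + Real.log M + Real.log (logI 2 x)) := by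
  have hn1 : 1 ≤ n := hn ▸ Module.finrank_pos
  have hM1 : 1 ≤ M := hM ▸ Nat.mul_pos hn1 hΩ1
  have hn1R : (1 : ℝ) ≤ n := by exact_mod_cast hn1
  have hM1R : (1 : ℝ) ≤ M := by exact_mod_cast hM1
  have hnM : (n : ℝ) ≤ M := by
    have : n ≤ M := hM ▸ Nat.le_mul_of_pos_right n hΩ1
    exact_mod_cast this
  set Y := logI 2 (x : ℝ) with hY
  have hY1 : 1 ≤ Y := one_le_logI 1 _
  have hlogY : 0 ≤ Real.log Y := Real.log_nonneg hY1
  have hlogM : 0 ≤ Real.log M := Real.log_nonneg hM1R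
  have hL1 : 1 ≤ logI 1 (x : ℝ) := one_le_logI 0 _
  have hlogx : Real.log x ≤ logI 1 x := le_max_left _ _
  set t := ⌈logI 1 (x : ℝ)⌉₊ with ht
  have ht1 : logI 1 (x : ℝ) ≤ t := Nat.le_ceil _
  have ht2 : (t : ℝ) ≤ 2 * logI 1 x := by
    have := Nat.ceil_lt_add_one (by linarith : 0 ≤ logI 1 (x : ℝ))
    linarith
  have ht0 : (1 : ℝ) ≤ t := hL1.trans ht1
  set c0 := Real.log (8 * n * M * (2 * (2 * M) ^ n) * t) with hc0
  set E := 1 + 2 * c0 with hE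
  have hc0n : n * Real.log (2 * M) ≤ c0 := by
    rw [hc0, ← Real.log_pow]
    apply Real.log_le_log (by positivity)
    have h1 : (1 : ℝ) ≤ 8 * n * M * 2 * t := by
      have : (1 : ℝ) ≤ n * M := by nlinarith
      have : (1 : ℝ) ≤ n * M * t := by nlinarith
      nlinarith
    calc (2 * (M : ℝ)) ^ n = 1 * (2 * (M : ℝ)) ^ n := (one_mul _).symm
      _ ≤ (8 * n * M * 2 * t) * (2 * (M : ℝ)) ^ n := by gcongr
      _ = _ := by ring
  have hc00 : 0 ≤ c0 := le_trans (mul_nonneg (by linarith) (Real.log_nonneg (by linarith))) hc0n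
  have hE1 : 1 ≤ E := by linarith
  set T₀ := ⌈Real.exp E⌉₊ with hT₀
  have hT₀1 : Real.exp E ≤ T₀ := Nat.le_ceil _
  have hexp2 : (2 : ℝ) ≤ Real.exp E := by
    have := Real.add_one_le_exp E; linarith
  have hT₀2 : (T₀ : ℝ) ≤ Real.exp (E + 1) := by
    have h1 := Nat.ceil_lt_add_one (by positivity : 0 ≤ Real.exp E)
    have h2 : Real.exp (E + 1) = Real.exp E * Real.exp 1 := Real.exp_add _ _
    have h3 := Real.add_one_le_exp (1 : ℝ)
    nlinarith
  have hT₀0 : 2 ≤ T₀ := by exact_mod_cast hexp2.trans hT₀1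
  have hlogT₀ : E ≤ Real.log T₀ := by
    rw [Real.le_log_iff_exp_le (by linarith)]; exact hT₀1
  have hMT₀ : (2 * M) ^ n ≤ T₀ := by
    have : ((2 * M : ℕ) : ℝ) ^ n ≤ T₀ := by
      refine le_trans ?_ hT₀1
      rw [← Real.log_le_iff_le_exp (by positivity), Real.log_pow]
      push_cast; linarith
    exact_mod_cast this
  -- the contribution of the small primes
  have hsmall : recipSum P T₀ ≤ 1800 * (4 + 2 * Real.log M + Real.log Y) := by
    have h1 : recipSum P T₀ ≤ 1800 * logI 2 T₀ / (1 : ℕ) :=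
      (recipSum_mono (fun r _ _ => one_dvd _)).trans
        (recipSum_dvd_sub_one_le 1 T₀ le_rfl (by simp))
    have h2 : logI 1 (T₀ : ℝ) ≤ E + 1 := by
      apply max_le _ (by linarith)
      change Real.log (T₀ : ℝ) ≤ E + 1
      rw [Real.log_le_iff_le_exp (by linarith)]; exact hT₀2
    have hlogt : Real.log t ≤ 1 + Y := by
      refine (Real.log_le_log (by linarith) ht2).trans ?_
      rw [Real.log_mul (by norm_num) (by linarith)]
      have h1 : Real.log (logI 1 x) ≤ Y := le_max_left _ _
      have h2 := Real.log_two_lt_d9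
      linarith
    have hEle : E + 1 ≤ 20 * M ^ 2 * Y := by
      have := two_add_two_mul_log_le hn1 hnM ht0 hY1 hlogt
      rw [hE, hc0]; linarith only [this]
    have h3 : logI 2 (T₀ : ℝ) ≤ 4 + 2 * Real.log M + Real.log Y := by
      apply max_le _ (by linarith only [hlogM, hlogY])
      have h4 : Real.log (logI 1 (T₀ : ℝ)) ≤ Real.log (20 * M ^ 2 * Y) :=
        Real.log_le_log (by have := one_le_logI 0 (T₀ : ℝ); linarith only [this]) (h2.trans hEle)
      exact h4.trans (log_twenty_mul_le hM1R hY1)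
    rw [Nat.cast_one, div_one] at h1
    linarith only [h1, h3]
  rcases le_or_gt x T₀ with hx | hx
  · have : recipSum P x ≤ recipSum P T₀ := by
      apply Finset.sum_le_sum_of_subset_of_nonneg
      · intro r hr
        simp only [Finset.mem_filter, Finset.mem_Icc] at hr ⊢
        exact ⟨⟨hr.1.1, by omega⟩, hr.2⟩
      · intros; positivity
    have h0 : 0 ≤ Y / n := by positivity
    linarith
  · obtain ⟨Q, hQ⟩ : ∃ Q : ℕ → Prop, Q = fun r => r.Prime ∧ (2 * M) ^ n ≤ r ∧ P r := ⟨_, rfl⟩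
    have hA : ∀ T : ℕ, 2 ≤ T → T ≤ x →
        ∑ r ∈ (Finset.Icc 1 T).filter Q, Real.log r / r ≤ 1 / n * Real.log T + E := by
      intro T hT hTx
      have hTx' : Real.log T ≤ t := by
        refine le_trans ?_ (hlogx.trans ht1)
        exact Real.log_le_log (by exact_mod_cast (by omega : 0 < T)) (by exact_mod_cast hTx)
      exact sum_log_div_le_of_splitsAt hcard hΩ1 hΩ hli hn hM hT hTx' Q
        (fun r hr => by rw [hQ] at hr; exact ⟨hr.1, hr.2.1, hP r hr.1 hr.2.2⟩)
    have hbig := sum_inv_le_of_sum_log_div_le Q (c := 1 / n) (by positivity) hT₀0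
      hx.le hA
    have hsplit : recipSum P x ≤ recipSum P T₀ + ∑ r ∈ (Finset.Ioc T₀ x).filter Q, 1 / (r : ℝ) := by
      rw [recipSum, recipSum, ← Finset.sum_union]
      · apply Finset.sum_le_sum_of_subset_of_nonneg
        · intro r hr
          simp only [Finset.mem_filter, Finset.mem_Icc, Finset.mem_union, Finset.mem_Ioc, hQ] at hr ⊢
          by_cases h : r ≤ T₀
          · exact Or.inl ⟨⟨hr.1.1, h⟩, hr.2⟩
          · exact Or.inr ⟨⟨by omega, hr.1.2⟩, hr.2.1, by omega, hr.2.2⟩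
        · intros; positivity
      · rw [Finset.disjoint_left]
        intro r hr hr'
        simp only [Finset.mem_filter, Finset.mem_Icc, Finset.mem_Ioc] at hr hr'
        omega
    have h1 : E / Real.log T₀ ≤ 1 := by
      apply div_le_one_of_le₀ hlogT₀ (by linarith)
    have h2 : 0 ≤ Real.log (Real.log T₀) := Real.log_nonneg (by linarith)
    have h3 : Real.log (Real.log x) ≤ Y := by
      rcases le_or_gt (Real.log x) 0 with h | h
      · rw [le_antisymm h (Real.log_natCast_nonneg x), Real.log_zero]; linarith
      · exact (Real.log_le_log h hlogx).trans (le_max_left _ _)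
    have h4 : 1 / (n : ℝ) * (Real.log (Real.log x) - Real.log (Real.log T₀) + 1) ≤ Y / n + 1 := by
      have : 1 / (n : ℝ) ≤ 1 := by rw [div_le_one (by linarith)]; exact hn1R
      have h0 : 0 ≤ 1 / (n : ℝ) := by positivity
      calc 1 / (n : ℝ) * (Real.log (Real.log x) - Real.log (Real.log T₀) + 1)
          ≤ 1 / (n : ℝ) * (Y + 1) := by gcongr; linarith
        _ = Y / n + 1 / n := by ring
        _ ≤ _ := by linarith
    linarith

end SplitPrimesUpper

section IdealsLower

open NumberField

lemma sum_multiset_prod_le {α : Type*} (S : Finset α) (f : α → ℝ) (h0 : ∀ a ∈ S, 0 ≤ f a)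
    (h1 : ∀ a ∈ S, f a < 1) (W : Finset (Multiset α)) (hW : ∀ m ∈ W, ∀ a ∈ m, a ∈ S) :
    ∑ m ∈ W, (m.map f).prod ≤ ∏ a ∈ S, (1 - f a)⁻¹ := by
  set N := W.sup Multiset.card with hN
  calc ∑ m ∈ W, (m.map f).prod
      = ∑ m ∈ W, ∏ a : S, f a ^ m.count a.1 := by
        refine Finset.sum_congr rfl fun m hm => ?_
        rw [Finset.prod_multiset_map_count, Finset.prod_coe_sort S (fun a => f a ^ m.count a)]
        apply Finset.prod_subset
        · intro a ha
          exact hW m hm a (Multiset.mem_toFinset.1 ha)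
        · intro a _ ha
          rw [Multiset.count_eq_zero_of_notMem (fun h => ha (Multiset.mem_toFinset.2 h)), pow_zero]
    _ = ∑ e ∈ W.image (fun m (a : S) => m.count a.1), ∏ a : S, f a ^ e a := by
        rw [Finset.sum_image]
        intro m hm m' hm' h
        ext a
        by_cases ha : a ∈ S
        · exact congrFun h ⟨a, ha⟩
        · rw [Multiset.count_eq_zero_of_notMem (fun h => ha (hW m hm a h)),
            Multiset.count_eq_zero_of_notMem (fun h => ha (hW m' hm' a h))]
    _ ≤ ∑ e ∈ Fintype.piFinset (fun _ : S => Finset.range (N + 1)), ∏ a : S, f a ^ e a := by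
        apply Finset.sum_le_sum_of_subset_of_nonneg
        · intro e he
          obtain ⟨m, hm, rfl⟩ := Finset.mem_image.1 he
          rw [Fintype.mem_piFinset]
          intro a
          rw [Finset.mem_range, Nat.lt_succ_iff]
          exact (Multiset.count_le_card _ _).trans (Finset.le_sup (f := Multiset.card) hm)
        · intro e _ _
          exact Finset.prod_nonneg fun a _ => pow_nonneg (h0 a a.2) _
    _ = ∏ a : S, ∑ j ∈ Finset.range (N + 1), f a ^ j :=
        (Finset.prod_univ_sum (fun _ : S => Finset.range (N + 1)) (fun a j => f a.1 ^ j)).symm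
    _ = ∏ a ∈ S, ∑ j ∈ Finset.range (N + 1), f a ^ j :=
        Finset.prod_coe_sort S (fun a => ∑ j ∈ Finset.range (N + 1), f a ^ j)
    _ ≤ _ := by
        refine Finset.prod_le_prod (fun a ha => Finset.sum_nonneg fun j _ => pow_nonneg (h0 a ha) _)
          fun a ha => ?_
        have h := (summable_geometric_of_lt_one (h0 a ha) (h1 a ha)).sum_le_tsum
          (Finset.range (N + 1)) (fun j _ => pow_nonneg (h0 a ha) j)
        rwa [tsum_geometric_of_lt_one (h0 a ha) (h1 a ha)] at h

lemma inv_one_sub_le_exp {u : ℝ} (h0 : 0 ≤ u) (h1 : u ≤ 1 / 2) :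
    (1 - u)⁻¹ ≤ Real.exp (u + 2 * u ^ 2) := by
  have h := Real.add_one_le_exp (u + 2 * u ^ 2)
  rw [inv_le_iff_one_le_mul₀ (by linarith)]
  nlinarith [mul_nonneg h0 h0, mul_nonneg (mul_nonneg h0 h0) (sub_nonneg.2 h1)]

variable {K : Type*} [Field K] [NumberField K]

/-- Some prime of `K` has absolute norm `r`. -/
def HasDegreeOnePrime (K : Type*) [Field K] [NumberField K] (r : ℕ) : Prop :=
  ∃ P : Ideal (𝓞 K), P.IsPrime ∧ Ideal.absNorm P = r

lemma exists_absNorm_eq_prime_pow {P : Ideal (𝓞 K)} (hP : P.IsPrime) (hP0 : P ≠ ⊥) :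
    ∃ r f : ℕ, r.Prime ∧ 1 ≤ f ∧ Ideal.absNorm P = r ^ f ∧ (r : 𝓞 K) ∈ P := by
  have hN1 : Ideal.absNorm P ≠ 1 := fun h => hP.ne_top (Ideal.absNorm_eq_one_iff.1 h)
  have hN0 : Ideal.absNorm P ≠ 0 := fun h => hP0 (Ideal.absNorm_eq_zero_iff.1 h)
  have hmem := Ideal.absNorm_mem P
  obtain ⟨r, hr, hrP⟩ : ∃ r : ℕ, r.Prime ∧ (r : 𝓞 K) ∈ P := by
    rw [← Nat.prod_primeFactorsList hN0, Nat.cast_list_prod, ← Multiset.prod_coe] at hmem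
    obtain ⟨z, hz, hzP⟩ := (Ideal.IsPrime.multiset_prod_mem_iff_exists_mem hP _).1 hmem
    obtain ⟨r, hr, rfl⟩ := List.mem_map.1 (Multiset.mem_coe.1 hz)
    exact ⟨r, Nat.prime_of_mem_primeFactorsList hr, hzP⟩
  have hdvd : Ideal.absNorm P ∣ r ^ Module.finrank ℚ K := by
    have h := Ideal.absNorm_dvd_absNorm_of_le ((Ideal.span_singleton_le_iff_mem P).2 hrP)
    rwa [Ideal.absNorm_span_natCast, RingOfIntegers.rank] at h
  obtain ⟨f, _, hf⟩ := (Nat.dvd_prime_pow hr).1 hdvd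
  refine ⟨r, f, hr, ?_, hf, hrP⟩
  rcases Nat.eq_zero_or_pos f with rfl | h
  · exact absurd hf hN1
  · exact h

lemma card_primes_above_le {r : ℕ} (hr : r.Prime) (S : Finset (Ideal (𝓞 K)))
    (hS : ∀ P ∈ S, P.IsPrime ∧ (r : 𝓞 K) ∈ P) : S.card ≤ Module.finrank ℚ K := by
  have hr0 : (r : 𝓞 K) ≠ 0 := by exact_mod_cast hr.ne_zero
  have h1 := prod_absNorm_le_of_mem hr0 S hS
  rw [Ideal.absNorm_span_natCast, RingOfIntegers.rank] at h1
  have h2 : r ^ S.card ≤ ∏ P ∈ S, Ideal.absNorm P :=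
    Finset.pow_card_le_prod _ _ _ (fun P hP => le_absNorm_of_mem (hS P hP).1 hr (hS P hP).2)
  exact (Nat.pow_le_pow_iff_right hr.one_lt).1 (h2.trans h1)

lemma sum_primes_inv_absNorm_le (T : ℕ) (S : Finset (Ideal (𝓞 K)))
    (hS : ∀ P ∈ S, P.IsPrime ∧ P ≠ ⊥ ∧ Ideal.absNorm P ≤ T) :
    ∑ P ∈ S, (1 / (Ideal.absNorm P : ℝ) + 2 * (1 / (Ideal.absNorm P : ℝ)) ^ 2) ≤
      Module.finrank ℚ K * (recipSum (HasDegreeOnePrime K) T + 6) := by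
  choose! rp f hr hf hNf hmem using
    fun (P : Ideal (𝓞 K)) (h : P.IsPrime ∧ P ≠ ⊥) => exists_absNorm_eq_prime_pow h.1 h.2
  have hS' : ∀ P ∈ S, P.IsPrime ∧ P ≠ ⊥ := fun P hP => ⟨(hS P hP).1, (hS P hP).2.1⟩
  set h : ℕ → ℝ := fun r => (if HasDegreeOnePrime K r then 1 / (r : ℝ) else 0) + 3 / (r : ℝ) ^ 2
    with hdef
  have hh0 : ∀ r, 0 ≤ h r := fun r => by
    simp only [hdef]; split_ifs <;> positivity
  set U := (Finset.Icc 1 T).filter Nat.Prime with hU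
  have hmaps : ∀ P ∈ S, rp P ∈ U := by
    intro P hP
    have h1 := hr P (hS' P hP)
    have h2 := le_absNorm_of_mem (hS P hP).1 h1 (hmem P (hS' P hP))
    simp only [hU, Finset.mem_filter, Finset.mem_Icc]
    exact ⟨⟨h1.one_lt.le, h2.trans (hS P hP).2.2⟩, h1⟩
  calc ∑ P ∈ S, (1 / (Ideal.absNorm P : ℝ) + 2 * (1 / (Ideal.absNorm P : ℝ)) ^ 2)
      ≤ ∑ P ∈ S, h (rp P) := by
        refine Finset.sum_le_sum fun P hP => ?_
        have hP' := hS' P hP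
        have hr1 : (1 : ℝ) < rp P := by exact_mod_cast (hr P hP').one_lt
        rw [hNf P hP']
        simp only [hdef]
        rcases (hf P hP').eq_or_lt with h1 | h1
        · rw [if_pos ⟨P, hP'.1, by rw [hNf P hP', ← h1, pow_one]⟩, ← h1]
          push_cast
          have : (0 : ℝ) ≤ 1 / (rp P : ℝ) ^ 2 := by positivity
          rw [pow_one, div_pow, one_pow, show (3 : ℝ) / (rp P) ^ 2 = 3 * (1 / (rp P) ^ 2) by ring]
          linarith
        · have h2 : (rp P : ℝ) ^ 2 ≤ (rp P : ℝ) ^ f P := pow_le_pow_right₀ hr1.le h1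
          have h3 : 1 / ((rp P ^ f P : ℕ) : ℝ) ≤ 1 / (rp P : ℝ) ^ 2 := by
            push_cast
            exact one_div_le_one_div_of_le (by positivity) h2
          have h4 : 1 / (rp P : ℝ) ^ 2 ≤ 1 := by
            rw [div_le_one (by positivity)]; nlinarith
          have h5 : 0 ≤ 1 / ((rp P ^ f P : ℕ) : ℝ) := by positivity
          have h6 : (0 : ℝ) ≤ if HasDegreeOnePrime K (rp P) then 1 / (rp P : ℝ) else 0 := by
            split_ifs <;> positivity
          rw [show (3 : ℝ) / (rp P) ^ 2 = 3 * (1 / (rp P) ^ 2) by ring]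
          nlinarith
    _ = ∑ r ∈ U, ∑ P ∈ S.filter (fun P => rp P = r), h (rp P) :=
        (Finset.sum_fiberwise_of_maps_to hmaps _).symm
    _ ≤ ∑ r ∈ U, Module.finrank ℚ K * h r := by
        refine Finset.sum_le_sum fun r hrU => ?_
        rw [Finset.sum_congr rfl (g := fun _ => h r)
          (fun P hP => by rw [(Finset.mem_filter.1 hP).2]), Finset.sum_const, nsmul_eq_mul]
        refine mul_le_mul_of_nonneg_right ?_ (hh0 r)
        exact_mod_cast card_primes_above_le (Finset.mem_filter.1 hrU).2 _ fun P hP => by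
          rw [Finset.mem_filter] at hP
          exact ⟨(hS P hP.1).1, hP.2 ▸ hmem P (hS' P hP.1)⟩
    _ = Module.finrank ℚ K * ∑ r ∈ U, h r := by rw [Finset.mul_sum]
    _ ≤ _ := by
        refine mul_le_mul_of_nonneg_left ?_ (by positivity)
        simp only [hdef]
        rw [Finset.sum_add_distrib]
        refine add_le_add (le_of_eq ?_) ?_
        · rw [recipSum, ← Finset.filter_filter]
          exact (Finset.sum_filter _ _).symm
        · calc ∑ r ∈ U, 3 / (r : ℝ) ^ 2 ≤ ∑ r ∈ Finset.Icc 1 T, 3 / (r : ℝ) ^ 2 :=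
                Finset.sum_le_sum_of_subset_of_nonneg (Finset.filter_subset _ _)
                  (fun _ _ _ => by positivity)
            _ = 3 * ∑ r ∈ Finset.Icc 1 T, 1 / (r : ℝ) ^ 2 := by
                rw [Finset.mul_sum]; exact Finset.sum_congr rfl fun _ _ => by ring
            _ ≤ 6 := by linarith [sum_inv_sq_le T]

lemma log_sum_inv_absNorm_le (T : ℕ) (W : Finset (Ideal (𝓞 K)))
    (hW : ∀ I ∈ W, I ≠ ⊥ ∧ Ideal.absNorm I ≤ T) :
    Real.log (∑ I ∈ W, 1 / (Ideal.absNorm I : ℝ)) ≤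
      Module.finrank ℚ K * (recipSum (HasDegreeOnePrime K) T + 6) := by
  have hRHS : 0 ≤ Module.finrank ℚ K * (recipSum (HasDegreeOnePrime K) T + 6) := by
    have := recipSum_nonneg (HasDegreeOnePrime K) T
    positivity
  rcases (Finset.sum_nonneg (fun I (_ : I ∈ W) =>
    (by positivity : 0 ≤ 1 / (Ideal.absNorm I : ℝ)))).eq_or_lt with h0 | h0
  · rw [← h0, Real.log_zero]; exact hRHS
  rw [Real.log_le_iff_le_exp h0]
  set S := (Ideal.finite_setOfPred_absNorm_le T (S := 𝓞 K)).toFinset.filter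
    (fun P => P.IsPrime ∧ P ≠ ⊥) with hSdef
  have hS : ∀ P ∈ S, P.IsPrime ∧ P ≠ ⊥ ∧ Ideal.absNorm P ≤ T := by
    intro P hP
    simp only [hSdef, Finset.mem_filter, Set.Finite.mem_toFinset, Set.mem_ofPred_eq] at hP
    exact ⟨hP.2.1, hP.2.2, hP.1⟩
  have hN2 : ∀ P ∈ S, (2 : ℝ) ≤ Ideal.absNorm P := by
    intro P hP
    obtain ⟨r, f, hr, -, -, hrP⟩ := exists_absNorm_eq_prime_pow (hS P hP).1 (hS P hP).2.1
    exact_mod_cast hr.two_le.trans (le_absNorm_of_mem (hS P hP).1 hr hrP)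
  set F : Ideal (𝓞 K) → ℝ := fun P => 1 / (Ideal.absNorm P : ℝ) with hF
  have hF0 : ∀ P, 0 ≤ F P := fun P => by simp only [hF]; positivity
  have hF1 : ∀ P ∈ S, F P ≤ 1 / 2 := fun P hP =>
    one_div_le_one_div_of_le (by norm_num) (hN2 P hP)
  have key : ∑ I ∈ W, 1 / (Ideal.absNorm I : ℝ) ≤ ∏ P ∈ S, (1 - F P)⁻¹ := by
    have hprod : ∀ I : Ideal (𝓞 K), I ≠ ⊥ →
        ((UniqueFactorizationMonoid.normalizedFactors I).map F).prod
          = 1 / (Ideal.absNorm I : ℝ) := by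
      intro I hI
      have h1 : F = fun P => ((Nat.castRingHom ℝ).toMonoidHom.comp
          (Ideal.absNorm (S := 𝓞 K)).toMonoidHom P)⁻¹ := by
        ext P; simp [hF]
      rw [h1, Multiset.prod_map_inv, Multiset.prod_hom,
        Ideal.prod_normalizedFactors_eq_self hI]
      simp
    have h := sum_multiset_prod_le S F (fun P _ => hF0 P) (fun P hP => by linarith [hF1 P hP])
      (W.image UniqueFactorizationMonoid.normalizedFactors) (by
        intro m hm P hPm
        obtain ⟨I, hI, rfl⟩ := Finset.mem_image.1 hm
        have hprime := UniqueFactorizationMonoid.prime_of_normalized_factor P hPm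
        simp only [hSdef, Finset.mem_filter, Set.Finite.mem_toFinset, Set.mem_ofPred_eq]
        refine ⟨?_, Ideal.isPrime_of_prime hprime, hprime.ne_zero⟩
        refine le_trans (Nat.le_of_dvd (Nat.pos_of_ne_zero fun h =>
          (hW I hI).1 (Ideal.absNorm_eq_zero_iff.1 h)) ?_) (hW I hI).2
        exact map_dvd Ideal.absNorm (UniqueFactorizationMonoid.dvd_of_mem_normalizedFactors hPm))
    rw [Finset.sum_image] at h
    · rw [Finset.sum_congr rfl (fun I hI => hprod I (hW I hI).1)] at h
      exact h
    · intro I hI J hJ hIJ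
      rw [← Ideal.prod_normalizedFactors_eq_self (hW I hI).1, hIJ,
        Ideal.prod_normalizedFactors_eq_self (hW J hJ).1]
  refine key.trans ?_
  calc ∏ P ∈ S, (1 - F P)⁻¹ ≤ ∏ P ∈ S, Real.exp (F P + 2 * F P ^ 2) := by
        refine Finset.prod_le_prod (fun P hP => inv_nonneg.2 (by linarith [hF1 P hP]))
          fun P hP => inv_one_sub_le_exp (hF0 P) (hF1 P hP)
    _ = Real.exp (∑ P ∈ S, (F P + 2 * F P ^ 2)) := (Real.exp_sum _ _).symm
    _ ≤ _ := Real.exp_le_exp.2 (sum_primes_inv_absNorm_le T S hS)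

lemma card_le_of_span_eq (γ : 𝓞 K) (hγ : γ ≠ 0) (E : Finset (𝓞 K))
    (hE : ∀ β ∈ E, Ideal.span {β} = Ideal.span {γ} ∧
      ∀ σ : K →+* ℂ, ‖σ (β : K)‖ ≤ 3 * ‖σ (γ : K)‖) :
    E.card ≤ 169 ^ Module.finrank ℚ K := by
  have hex : ∀ β ∈ E, ∃ ε : 𝓞 K, β = γ * ε := fun β hβ =>
    Ideal.mem_span_singleton.1 ((hE β hβ).1 ▸ Ideal.mem_span_singleton_self β)
  choose! e he using hex
  have hσγ : ∀ σ : K →+* ℂ, σ (γ : K) ≠ 0 := fun σ h =>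
    hγ (RingOfIntegers.ext ((map_eq_zero σ).1 h))
  have hε : ∀ β ∈ E, ∀ σ : K →+* ℂ, ‖σ (e β : K)‖ ≤ 3 := by
    intro β hβ σ
    have h1 := (hE β hβ).2 σ
    have h2 : σ (β : K) = σ (γ : K) * σ (e β : K) := by
      conv_lhs => rw [he β hβ]
      push_cast
      rw [map_mul]
    rw [h2, norm_mul] at h1
    have h3 : 0 < ‖σ (γ : K)‖ := norm_pos_iff.2 (hσγ σ)
    nlinarith
  set cell : 𝓞 K → (K →+* ℂ) → ℤ × ℤ := fun β σ =>
    (⌊2 * (σ (e β : K)).re⌋, ⌊2 * (σ (e β : K)).im⌋) with hcell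
  have hfl : ∀ t : ℝ, |t| ≤ 3 → ⌊2 * t⌋ ∈ Finset.Icc (-6 : ℤ) 6 := by
    intro t ht
    rw [abs_le] at ht
    rw [Finset.mem_Icc]
    constructor
    · rw [Int.le_floor]; push_cast; linarith
    · have : (⌊2 * t⌋ : ℝ) ≤ 6 := (Int.floor_le _).trans (by linarith)
      exact_mod_cast this
  have hcard := Finset.card_le_card_of_injOn (s := E)
    (t := Fintype.piFinset fun _ : K →+* ℂ => Finset.Icc (-6 : ℤ) 6 ×ˢ Finset.Icc (-6 : ℤ) 6) cell
    (by
      intro β hβ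
      rw [Finset.mem_coe, Fintype.mem_piFinset]
      intro σ
      rw [Finset.mem_product]
      exact ⟨hfl _ ((Complex.abs_re_le_norm _).trans (hε β hβ σ)),
        hfl _ ((Complex.abs_im_le_norm _).trans (hε β hβ σ))⟩)
    (by
      intro β hβ β' hβ' h
      by_contra hne
      have hd : e β - e β' ≠ 0 := by
        intro h0
        apply hne
        rw [he β hβ, he β' hβ', sub_eq_zero.1 h0]
      have h1 := one_le_absNorm_span hd
      have h2 : (Ideal.absNorm (Ideal.span {e β - e β'}) : ℝ) ≤
          (3 / 4 : ℝ) ^ Module.finrank ℚ K := by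
        apply absNorm_le_of_norm_le
        intro σ
        have hc := congrFun h σ
        simp only [hcell, Prod.mk.injEq] at hc
        have hre := Int.abs_sub_lt_one_of_floor_eq_floor hc.1
        have him := Int.abs_sub_lt_one_of_floor_eq_floor hc.2
        have hcoe : ((e β - e β' : 𝓞 K) : K) = (e β : K) - (e β' : K) := by push_cast; rfl
        rw [hcoe, map_sub]
        set z := σ (e β : K)
        set w := σ (e β' : K)
        have h3 : ‖z - w‖ ^ 2 ≤ (3 / 4) ^ 2 := by
          rw [← Complex.normSq_eq_norm_sq, Complex.normSq_apply, Complex.sub_re, Complex.sub_im]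
          rw [abs_lt] at hre him
          nlinarith
        exact le_of_sq_le_sq h3 (by norm_num)
      have h3 : (3 / 4 : ℝ) ^ Module.finrank ℚ K < 1 :=
        pow_lt_one₀ (by norm_num) (by norm_num) Module.finrank_pos.ne'
      have h4 : (1 : ℝ) ≤ Ideal.absNorm (Ideal.span {e β - e β'}) := by exact_mod_cast h1
      linarith)
  refine hcard.trans (le_of_eq ?_)
  rw [Fintype.card_piFinset, Finset.prod_const, Finset.card_univ, Embeddings.card K ℂ]
  simp

variable {ι : Type*} [Fintype ι]

lemma exists_ideals_norm_range {ω : ι → 𝓞 K} {Ω : ℕ}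
    (hcard : Fintype.card ι = Module.finrank ℚ K) (hΩ1 : 1 ≤ Ω)
    (hΩ : ∀ (σ : K →+* ℂ) (i : ι), ‖σ (ω i)‖ ≤ Ω) (hli : ∀ b : ι → ℤ, intComb ω b = 0 → b = 0)
    {n M : ℕ} (hn : n = Module.finrank ℚ K) (hM : M = n * Ω) {B : ℕ} (hB : 1 ≤ B) :
    ∃ W : Finset (Ideal (𝓞 K)), B ^ n ≤ 169 ^ n * W.card ∧
      ∀ I ∈ W, (M * B) ^ n ≤ Ideal.absNorm I ∧ Ideal.absNorm I ≤ (3 * (M * B)) ^ n := by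
  have hn1 : 1 ≤ n := hn ▸ Module.finrank_pos
  have hM1 : 1 ≤ M := hM ▸ Nat.mul_pos hn1 hΩ1
  have hMB : (0 : ℝ) < M * B := by
    have : (0 : ℝ) < M := by exact_mod_cast hM1
    have : (0 : ℝ) < B := by exact_mod_cast hB
    positivity
  set s := Fintype.piFinset fun _ : ι => Finset.Ico (0 : ℤ) B with hs
  set β : (ι → ℤ) → 𝓞 K := fun b => ((2 * (M * B) : ℕ) : 𝓞 K) + intComb ω b with hβ
  have hnorm : ∀ b ∈ s, ∀ σ : K →+* ℂ, (M * B : ℝ) ≤ ‖σ (β b : K)‖ ∧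
      ‖σ (β b : K)‖ ≤ 3 * (M * B) := by
    intro b hb σ
    have h1 : ‖σ (intComb ω b : K)‖ ≤ M * B := by
      have h := norm_embedding_intComb_le hΩ (b := b) (B := B) (fun i => by
        have := Finset.mem_Ico.1 (Fintype.mem_piFinset.1 hb i)
        rw [abs_of_nonneg (by exact_mod_cast this.1)]
        exact_mod_cast this.2.le) σ
      rw [hM, hn, ← hcard]
      push_cast
      exact h
    have h2 : σ (β b : K) = ((2 * (M * B) : ℝ) : ℂ) + σ (intComb ω b : K) := by
      change σ (algebraMap (𝓞 K) K (_ + _)) = _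
      rw [map_add, map_natCast, map_add, map_natCast]
      push_cast
      rfl
    have h3 : ‖((2 * (M * B) : ℝ) : ℂ)‖ = 2 * (M * B) := by
      rw [Complex.norm_real, Real.norm_of_nonneg (by linarith)]
    rw [h2]
    constructor
    · have := norm_sub_le_norm_add ((2 * (M * B) : ℝ) : ℂ) (σ (intComb ω b : K))
      linarith
    · have := norm_add_le ((2 * (M * B) : ℝ) : ℂ) (σ (intComb ω b : K))
      linarith
  have hinj : ∀ b b', β b = β b' → b = b' := by
    intro b b' h
    have h1 : intComb ω b = intComb ω b' := add_left_cancel h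
    have h2 : intComb ω (b - b') = 0 := by
      have : intComb ω (b - b') = intComb ω b - intComb ω b' := by
        simp only [intComb, ← Finset.sum_sub_distrib, Pi.sub_apply, Int.cast_sub, sub_mul]
      rw [this, h1, sub_self]
    exact sub_eq_zero.1 (hli _ h2)
  have hβ0 : ∀ b ∈ s, β b ≠ 0 := by
    intro b hb h0
    obtain ⟨σ⟩ : Nonempty (K →+* ℂ) := inferInstance
    have h := (hnorm b hb σ).1
    rw [h0] at h
    simp only [map_zero, norm_zero] at h
    linarith
  refine ⟨s.image fun b => Ideal.span {β b}, ?_, ?_⟩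
  · have h := Finset.card_le_mul_card_image (s := s) (f := fun b => Ideal.span {β b})
      (169 ^ n) (by
        intro I hI
        obtain ⟨b₀, hb₀, rfl⟩ := Finset.mem_image.1 hI
        rw [← Finset.card_image_of_injective _ (fun b b' h => hinj b b' h), hn]
        refine card_le_of_span_eq (β b₀) (hβ0 b₀ hb₀) _ ?_
        intro γ hγ
        obtain ⟨b, hb, rfl⟩ := Finset.mem_image.1 hγ
        rw [Finset.mem_filter] at hb
        refine ⟨hb.2, fun σ => ?_⟩
        linarith [(hnorm b hb.1 σ).2, (hnorm b₀ hb₀ σ).1])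
    have hsc : s.card = B ^ n := by
      rw [hs, Fintype.card_piFinset, Finset.prod_const, Finset.card_univ, hcard, ← hn]
      simp
    rwa [hsc] at h
  · intro I hI
    obtain ⟨b, hb, rfl⟩ := Finset.mem_image.1 hI
    constructor
    · have h : (M * B : ℝ) ^ n ≤ Ideal.absNorm (Ideal.span {β b}) := by
        rw [absNorm_span_eq_prod_embeddings, hn, ← Embeddings.card K ℂ, ← Finset.card_univ,
          ← Finset.prod_const]
        exact Finset.prod_le_prod (fun _ _ => hMB.le) fun σ _ => (hnorm b hb σ).1
      exact_mod_cast h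
    · have h := absNorm_le_of_norm_le (fun σ => (hnorm b hb σ).2)
      rw [← hn] at h
      exact_mod_cast h

lemma log_mul_div_pow_le {ω : ι → 𝓞 K} {Ω : ℕ}
    (hcard : Fintype.card ι = Module.finrank ℚ K) (hΩ1 : 1 ≤ Ω)
    (hΩ : ∀ (σ : K →+* ℂ) (i : ι), ‖σ (ω i)‖ ≤ Ω) (hli : ∀ b : ι → ℤ, intComb ω b = 0 → b = 0)
    {n M : ℕ} (hn : n = Module.finrank ℚ K) (hM : M = n * Ω) {m T : ℕ}
    (hT : ∀ k < m, (3 * (M * 4 ^ k)) ^ n ≤ T) :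
    Real.log (m / (507 * M) ^ n) ≤ n * (recipSum (HasDegreeOnePrime K) T + 6) := by
  have hn1 : 1 ≤ n := hn ▸ Module.finrank_pos
  have hM1 : 1 ≤ M := hM ▸ Nat.mul_pos hn1 hΩ1
  have hM0 : (0 : ℝ) < M := by exact_mod_cast hM1
  choose W hWc hWn using fun k : ℕ => exists_ideals_norm_range hcard hΩ1 hΩ hli hn hM
    (B := 4 ^ k) (Nat.one_le_pow _ _ (by norm_num))
  set V := (Finset.range m).biUnion W with hV
  have hV0 : ∀ I ∈ V, I ≠ ⊥ ∧ Ideal.absNorm I ≤ T := by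
    intro I hI
    obtain ⟨k, hk, hIk⟩ := Finset.mem_biUnion.1 hI
    have h := hWn k I hIk
    refine ⟨?_, h.2.trans (hT k (Finset.mem_range.1 hk))⟩
    rintro rfl
    rw [Ideal.absNorm_bot] at h
    have : 0 < (M * 4 ^ k) ^ n := by positivity
    omega
  have hmain := log_sum_inv_absNorm_le T V hV0
  rw [hn]
  refine le_trans ?_ hmain
  rw [← hn]
  rcases Nat.eq_zero_or_pos m with rfl | hm
  · simp [hV]
  apply Real.log_le_log (by have : (0 : ℝ) < m := by exact_mod_cast hm
                            positivity)
  have hdisj : Set.PairwiseDisjoint (↑(Finset.range m)) W := by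
    have aux : ∀ j k, j < k → Disjoint (W j) (W k) := by
      intro j k hjk
      rw [Finset.disjoint_left]
      intro I hj hk
      have h1 := (hWn j I hj).2
      have h2 := (hWn k I hk).1
      have h3 : (3 * (M * 4 ^ j)) ^ n < (M * 4 ^ k) ^ n := by
        apply Nat.pow_lt_pow_left _ (by omega)
        have h4 : 4 ^ (j + 1) ≤ 4 ^ k := Nat.pow_le_pow_right (by norm_num) hjk
        have h5 : 0 < M * 4 ^ j := by positivity
        calc 3 * (M * 4 ^ j) < 4 * (M * 4 ^ j) := by omega
          _ = M * 4 ^ (j + 1) := by ring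
          _ ≤ _ := Nat.mul_le_mul_left _ h4
      omega
    intro j _ k _ hjk
    rcases lt_or_gt_of_ne hjk with h | h
    · exact aux j k h
    · exact (aux k j h).symm
  rw [hV, Finset.sum_biUnion hdisj]
  calc (m : ℝ) / (507 * M) ^ n = ∑ _k ∈ Finset.range m, 1 / (507 * M : ℝ) ^ n := by
        rw [Finset.sum_const, Finset.card_range, nsmul_eq_mul]; ring
    _ ≤ _ := by
        refine Finset.sum_le_sum fun k _ => ?_
        have h1 : ∀ I ∈ W k, 1 / (3 * (M * 4 ^ k) : ℝ) ^ n ≤ 1 / (Ideal.absNorm I : ℝ) := by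
          intro I hI
          have h := hWn k I hI
          have h0 : 0 < Ideal.absNorm I := lt_of_lt_of_le (by positivity) h.1
          refine one_div_le_one_div_of_le (by exact_mod_cast h0) ?_
          exact_mod_cast h.2
        refine le_trans ?_ (Finset.card_nsmul_le_sum _ _ _ h1)
        rw [nsmul_eq_mul, mul_one_div, div_le_div_iff₀ (by positivity) (by positivity), one_mul]
        have h2 : ((4 : ℝ) ^ k) ^ n ≤ 169 ^ n * (W k).card := by exact_mod_cast hWc k
        calc (3 * ((M : ℝ) * 4 ^ k)) ^ n = (3 * M) ^ n * (4 ^ k) ^ n := by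
              rw [← mul_pow]; ring
          _ ≤ (3 * M) ^ n * (169 ^ n * (W k).card) := by gcongr
          _ = _ := by
              rw [show (507 : ℝ) * M = (3 * M) * 169 by ring, mul_pow (3 * (M : ℝ)) 169]; ring

lemma le_recipSum_hasDegreeOnePrime {ω : ι → 𝓞 K} {Ω : ℕ}
    (hcard : Fintype.card ι = Module.finrank ℚ K) (hΩ1 : 1 ≤ Ω)
    (hΩ : ∀ (σ : K →+* ℂ) (i : ι), ‖σ (ω i)‖ ≤ Ω) (hli : ∀ b : ι → ℤ, intComb ω b = 0 → b = 0)
    {n M : ℕ} (hn : n = Module.finrank ℚ K) (hM : M = n * Ω) (x : ℕ) :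
    logI 2 x / n - 30 * (1 + Real.log M) ≤ recipSum (HasDegreeOnePrime K) x := by
  have hn1 : 1 ≤ n := hn ▸ Module.finrank_pos
  have hM1 : 1 ≤ M := hM ▸ Nat.mul_pos hn1 hΩ1
  have hn1R : (1 : ℝ) ≤ n := by exact_mod_cast hn1
  have hM1R : (1 : ℝ) ≤ M := by exact_mod_cast hM1
  have hnM : (n : ℝ) ≤ M := by
    have : n ≤ M := hM ▸ Nat.le_mul_of_pos_right n hΩ1
    exact_mod_cast this
  have hlogM : 0 ≤ Real.log M := Real.log_nonneg hM1R
  have hlog3 : Real.log 3 ≤ 2 := by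
    have := Real.log_le_sub_one_of_pos (by norm_num : (0 : ℝ) < 3); linarith
  have h3M : Real.log (3 * M) = Real.log 3 + Real.log M :=
    Real.log_mul (by norm_num) (by positivity)
  have h0 := recipSum_nonneg (HasDegreeOnePrime K) x
  by_cases hbig : Real.exp 1 ≤ Real.log x ∧ 2 * n * Real.log (3 * M) ≤ Real.log x
  · obtain ⟨hx1, hx2⟩ := hbig
    have hlx : 0 < Real.log x := (Real.exp_pos 1).trans_le hx1
    have hx0 : (0 : ℝ) < x := by
      rcases Nat.eq_zero_or_pos x with rfl | h
      · simp at hlx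
      · exact_mod_cast h
    have hY : logI 2 (x : ℝ) = Real.log (Real.log x) := by
      have h1 : (1 : ℝ) ≤ Real.log x := le_trans (by have := Real.add_one_le_exp (1 : ℝ); linarith) hx1
      change max (Real.log (max (Real.log x) 1)) 1 = _
      rw [max_eq_left h1, max_eq_left]
      rwa [Real.le_log_iff_exp_le hlx]
    set m := ⌈Real.log x / (4 * n)⌉₊ with hm
    have hm1 : Real.log x / (4 * n) ≤ m := Nat.le_ceil _
    have hT : ∀ k < m, (3 * (M * 4 ^ k)) ^ n ≤ x := by
      intro k hk
      have hk' : (k : ℝ) < Real.log x / (4 * n) := Nat.lt_ceil.1 hk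
      rw [lt_div_iff₀ (by positivity)] at hk'
      have h4 : Real.log 4 ≤ 2 := by
        rw [show (4 : ℝ) = 2 ^ 2 by norm_num, Real.log_pow]
        have := Real.log_two_lt_d9
        push_cast; linarith
      have : ((3 * (M * 4 ^ k) : ℕ) : ℝ) ^ n ≤ x := by
        rw [← Real.log_le_log_iff (by positivity) hx0, Real.log_pow]
        push_cast
        rw [← mul_assoc, Real.log_mul (by positivity) (by positivity), Real.log_pow]
        have : (n : ℝ) * (k * Real.log 4) ≤ n * (k * 2) := by gcongr
        linarith
      exact_mod_cast this
    have hmain := log_mul_div_pow_le hcard hΩ1 hΩ hli hn hM hT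
    have hm0 : (0 : ℝ) < m := lt_of_lt_of_le (by positivity) hm1
    rw [Real.log_div (by positivity) (by positivity), Real.log_pow] at hmain
    have h5 : Real.log (Real.log x) - Real.log (4 * n) ≤ Real.log m := by
      rw [← Real.log_div (by positivity) (by positivity)]
      exact Real.log_le_log (by positivity) hm1
    have h6 : Real.log (4 * n) ≤ 3 * n := by
      have := Real.log_le_sub_one_of_pos (by linarith : (0 : ℝ) < n)
      have h4 := Real.log_le_sub_one_of_pos (by norm_num : (0 : ℝ) < 4)
      rw [Real.log_mul (by norm_num) (by linarith)]
      have h4 : Real.log 4 ≤ 2 := by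
        rw [show (4 : ℝ) = 2 ^ 2 by norm_num, Real.log_pow]
        have := Real.log_two_lt_d9
        push_cast; linarith
      linarith
    have h7 : Real.log (507 * M) ≤ 9 + Real.log M := by
      rw [Real.log_mul (by norm_num) (by positivity)]
      have h1 : Real.log 507 ≤ Real.log (2 ^ 9) := Real.log_le_log (by norm_num) (by norm_num)
      rw [Real.log_pow] at h1
      have h2 := Real.log_two_lt_d9
      push_cast at h1; linarith
    have h8 : n * Real.log (507 * M) ≤ n * (9 + Real.log M) := by gcongr
    rw [hY, sub_le_iff_le_add, div_le_iff₀ (by linarith)]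
    nlinarith [mul_nonneg (by linarith : (0 : ℝ) ≤ n) hlogM]
  · have hY : logI 2 (x : ℝ) ≤ 30 * (1 + Real.log M) := by
      apply max_le _ (by linarith)
      have h1 := one_le_logI 0 (x : ℝ)
      have h2 : logI 1 (x : ℝ) ≤ 3 * (6 * M ^ 2) := by
        apply max_le _ (by nlinarith)
        rw [not_and_or, not_le, not_le] at hbig
        rcases hbig with h | h
        · have h3 := Real.exp_one_lt_d9
          change Real.log (x : ℝ) ≤ _
          nlinarith
        · change Real.log (x : ℝ) ≤ _
          have h3 := Real.log_le_sub_one_of_pos (by linarith : (0 : ℝ) < 3 * M)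
          have h4 : (n : ℝ) * Real.log (3 * M) ≤ M * (3 * M) :=
            mul_le_mul hnM (by linarith) (Real.log_nonneg (by linarith)) (by linarith)
          nlinarith
      have h3 : Real.log (logI 1 (x : ℝ)) ≤ Real.log (20 * M ^ 2 * 1) :=
        Real.log_le_log (by linarith) (by nlinarith)
      have h4 := log_twenty_mul_le hM1R le_rfl
      rw [Real.log_one] at h4
      linarith
    have : logI 2 (x : ℝ) / n ≤ logI 2 x :=
      div_le_self (by have := one_le_logI 1 (x : ℝ); linarith) hn1R
    linarith

end IdealsLower

section Kummer

open NumberField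

lemma eq_of_pow_eq_of_sub_mem {A : Type*} [CommRing A] [IsDomain A] {P : Ideal A} (hP : P.IsPrime)
    {x y c : A} {N : ℕ} (hx : x ^ N = c) (hy : y ^ N = c) (hN : (N : A) ∉ P) (hc : c ∉ P)
    (h : x - y ∈ P) : x = y := by
  by_contra hne
  have h1 : (∑ i ∈ Finset.range N, x ^ i * y ^ (N - 1 - i)) * (x - y) = 0 := by
    rw [Commute.geom_sum₂_mul (Commute.all x y), hx, hy, sub_self]
  have h2 := (mul_eq_zero.1 h1).resolve_right (sub_ne_zero.2 hne)
  have h3 : ((∑ i ∈ Finset.range N, x ^ i * y ^ (N - 1 - i) : A)) - (N : A) * y ^ (N - 1) ∈ P := by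
    rw [← Ideal.Quotient.eq] at h ⊢
    rw [map_sum, map_mul, map_natCast, map_pow]
    rw [← Finset.card_range N, ← nsmul_eq_mul, ← Finset.sum_const, Finset.card_range]
    refine Finset.sum_congr rfl fun i hi => ?_
    rw [map_mul, map_pow, map_pow, h, ← pow_add]
    congr 1
    have := Finset.mem_range.1 hi
    omega
  rw [h2, zero_sub, neg_mem_iff] at h3
  rcases hP.mem_or_mem h3 with h4 | h4
  · exact hN h4
  · apply hc
    have h5 := hP.mem_of_pow_mem _ h4
    rw [← hy]
    rcases Nat.eq_zero_or_pos N with rfl | hN0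
    · exact absurd P.zero_mem (by simp at hN)
    · exact P.pow_mem_of_mem h5 N hN0

lemma exists_intCast_sub_mem_of_pow_sub_one {A : Type*} [CommRing A] {P : Ideal A} (hP : P.IsPrime)
    {r : ℕ} (hr : r.Prime) (hrP : (r : A) ∈ P) {x : A} (h : x ^ (r - 1) - 1 ∈ P) :
    ∃ c : ℤ, x - c ∈ P := by
  have := Fact.mk hr
  have : CharP (A ⧸ P) r := by
    have h0 : ((r : ℕ) : A ⧸ P) = 0 := by
      rw [← map_natCast (Ideal.Quotient.mk P), Ideal.Quotient.eq_zero_iff_mem]; exact hrP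
    obtain ⟨q, hq⟩ := CharP.exists (A ⧸ P)
    have hqr : q ∣ r := (CharP.cast_eq_zero_iff (A ⧸ P) q r).1 h0
    have : Nontrivial (A ⧸ P) := Ideal.Quotient.nontrivial_iff.2 hP.ne_top
    rcases (Nat.dvd_prime hr).1 hqr with h1 | h1
    · subst h1
      exact absurd rfl (CharP.char_ne_one (A ⧸ P) 1)
    · rwa [h1] at hq
  let : Algebra (ZMod r) (A ⧸ P) := ZMod.algebra _ r
  set z : A ⧸ P := Ideal.Quotient.mk P x with hz
  have hzr : z ^ r - z = 0 := by
    have h1 : z ^ (r - 1) = 1 := by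
      rw [hz, ← map_pow, ← map_one (Ideal.Quotient.mk P), Ideal.Quotient.eq]; exact h
    calc z ^ r - z = z ^ (r - 1 + 1) - z := by rw [Nat.sub_add_cancel hr.one_lt.le]
      _ = 0 := by rw [pow_succ, h1, one_mul, sub_self]
  have hprod : (Polynomial.X ^ r - Polynomial.X : Polynomial (ZMod r)) =
      ∏ c : ZMod r, (Polynomial.X - Polynomial.C c) := by
    have hroots := FiniteField.roots_X_pow_card_sub_X (ZMod r)
    rw [ZMod.card] at hroots
    have hmonic : (Polynomial.X ^ r - Polynomial.X : Polynomial (ZMod r)).Monic :=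
      Polynomial.monic_X_pow_sub (by rw [Polynomial.degree_X]; exact_mod_cast hr.one_lt)
    have hdeg := FiniteField.X_pow_card_sub_X_natDegree_eq (ZMod r) hr.one_lt
    have := Polynomial.prod_multiset_X_sub_C_of_monic_of_roots_card_eq hmonic (by
      rw [hroots, hdeg]; simp [ZMod.card])
    rw [← this, hroots]
    rfl
  have h2 := congrArg (Polynomial.aeval z) hprod
  simp only [map_sub, map_pow, Polynomial.aeval_X, map_prod, Polynomial.aeval_C] at h2
  rw [hzr] at h2
  obtain ⟨c, -, hc⟩ := Finset.prod_eq_zero_iff.1 h2.symm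
  refine ⟨(c.val : ℤ), ?_⟩
  rw [← Ideal.Quotient.eq_zero_iff_mem, map_sub, ← hc, ← hz]
  congr 1
  rw [Int.cast_natCast, map_natCast, ← map_natCast (algebraMap (ZMod r) (A ⧸ P)),
    ZMod.natCast_zmod_val]

/-- `r ≡ 1 mod m` and `p` is an `N`-th power residue modulo `r`. -/
def ResidueCond (p m N r : ℕ) : Prop := m ∣ r - 1 ∧ (p : ZMod r) ^ ((r - 1) / N) = 1

variable {K : Type*} [Field K] [NumberField K]

lemma pow_residue_sub_one_mem {P : Ideal (𝓞 K)} (hP : P.IsPrime) {r p t : ℕ} (hr : r.Prime)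
    (hrP : (r : 𝓞 K) ∈ P) : ((p : 𝓞 K) ^ t - 1 ∈ P ↔ (p : ZMod r) ^ t = 1) := by
  have h := intCast_mem_iff_of_prime_mem hP hr hrP ((p : ℤ) ^ t - 1)
  push_cast at h
  rw [h, ← ZMod.intCast_zmod_eq_zero_iff_dvd]
  push_cast
  exact sub_eq_zero

lemma splitsAt_of_residueCond [IsGalois ℚ K] {ζ α : 𝓞 K} {p m N r : ℕ} (hm : 1 ≤ m)
    (hNm : N ∣ m) (hζ : ζ ^ m = 1) (hα : α ^ N = p)
    (htop : Algebra.adjoin ℚ {(ζ : K), (α : K)} = ⊤) {ι : Type*} (ω : ι → 𝓞 K)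
    (hω : ∀ i, ∃ a b : ℕ, ω i = ζ ^ a * α ^ b) (hr : r.Prime) (hR : ResidueCond p m N r) :
    SplitsAt ω r := by
  obtain ⟨hmr, hpr⟩ := hR
  have hN1 : 1 ≤ N := Nat.pos_of_dvd_of_pos hNm hm
  have hNr : N ∣ r - 1 := hNm.trans hmr
  have hr1 : 0 < r - 1 := by have := hr.two_le; omega
  have hrle : m ≤ r - 1 := Nat.le_of_dvd hr1 hmr
  have hNle : N ≤ m := Nat.le_of_dvd hm hNm
  have hndvd : ∀ k : ℕ, 1 ≤ k → k ≤ m → ¬ r ∣ k := fun k h1 h2 h3 => by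
    have := Nat.le_of_dvd h1 h3; omega
  have hrp : ¬ r ∣ p := by
    intro h
    rw [(ZMod.natCast_eq_zero_iff p r).2 h, zero_pow (Nat.div_pos (by omega) hN1).ne'] at hpr
    have := Fact.mk hr
    exact zero_ne_one hpr
  obtain ⟨P, hPmax, hrP⟩ : ∃ P : Ideal (𝓞 K), P.IsMaximal ∧ (r : 𝓞 K) ∈ P := by
    have hne : Ideal.span {(r : 𝓞 K)} ≠ ⊤ := by
      intro h
      have h1 := Ideal.absNorm_eq_one_iff.2 h
      rw [Ideal.absNorm_span_natCast, RingOfIntegers.rank] at h1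
      exact hr.one_lt.ne' ((Nat.pow_eq_one.1 h1).resolve_right Module.finrank_pos.ne')
    obtain ⟨P, hP, hle⟩ := Ideal.exists_le_maximal _ hne
    exact ⟨P, hP, hle (Ideal.mem_span_singleton_self _)⟩
  have hP := hPmax.isPrime
  have hnat : ∀ k : ℕ, ¬ r ∣ k → (k : 𝓞 K) ∉ P := fun k hk h => by
    have := (intCast_mem_iff_of_prime_mem hP hr hrP k).1 (by exact_mod_cast h)
    exact hk (by exact_mod_cast this)
  have hpt := (pow_residue_sub_one_mem (K := K) (p := p) (t := (r - 1) / N) hP hr hrP).2 hpr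
  have hζc : ∀ x : 𝓞 K, x ^ m = 1 → ∃ c : ℤ, x - c ∈ P := fun x hx => by
    apply exists_intCast_sub_mem_of_pow_sub_one hP hr hrP
    obtain ⟨k, hk⟩ := hmr
    rw [hk, pow_mul, hx, one_pow, sub_self]
    exact P.zero_mem
  have hαc : ∀ x : 𝓞 K, x ^ N = p → ∃ c : ℤ, x - c ∈ P := fun x hx => by
    apply exists_intCast_sub_mem_of_pow_sub_one hP hr hrP
    rw [← Nat.mul_div_cancel' hNr, pow_mul, hx]
    exact hpt
  let Φ : Gal(K/ℚ) → (𝓞 K →+* 𝓞 K) := fun σ => RingOfIntegers.mapRingHom (σ : K →+* K)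
  have hΦζ : ∀ σ, (Φ σ ζ) ^ m = 1 := fun σ => by rw [← map_pow, hζ, map_one]
  have hΦα : ∀ σ, (Φ σ α) ^ N = p := fun σ => by rw [← map_pow, hα, map_natCast]
  have hinj : Function.Injective fun σ => P.comap (Φ σ) := by
    intro σ τ h
    have key : ∀ x : 𝓞 K, (∃ c : ℤ, Φ σ x - c ∈ P) → Φ σ x - Φ τ x ∈ P := by
      rintro x ⟨c, hc⟩
      have h1 : x - c ∈ P.comap (Φ σ) := by
        rw [Ideal.mem_comap, map_sub, map_intCast]; exact hc
      have h2 : x - c ∈ P.comap (Φ τ) := by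
        have h' : P.comap (Φ σ) = P.comap (Φ τ) := h
        rwa [h'] at h1
      rw [Ideal.mem_comap, map_sub, map_intCast] at h2
      have := P.sub_mem hc h2
      rwa [sub_sub_sub_cancel_right] at this
    have e1 : Φ σ ζ = Φ τ ζ := eq_of_pow_eq_of_sub_mem hP (hΦζ σ) (hΦζ τ)
      (hnat m (hndvd m hm le_rfl)) (by have := hnat 1 (hndvd 1 le_rfl hm); simpa using this)
      (key ζ (hζc _ (hΦζ σ)))
    have e2 : Φ σ α = Φ τ α := eq_of_pow_eq_of_sub_mem hP (hΦα σ) (hΦα τ)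
      (hnat N (hndvd N hN1 hNle)) (hnat p hrp) (key α (hαc _ (hΦα σ)))
    have h3 : (σ : K →ₐ[ℚ] K) = τ := by
      apply AlgHom.ext_of_adjoin_eq_top htop
      rintro x (rfl | rfl)
      · exact congrArg (fun z : 𝓞 K => (z : K)) e1
      · exact congrArg (fun z : 𝓞 K => (z : K)) e2
    ext x
    exact DFunLike.congr_fun h3 x
  refine ⟨Finset.univ.image fun σ => P.comap (Φ σ), ?_, ?_⟩
  · rw [Finset.card_image_of_injective _ hinj, Finset.card_univ, ← Nat.card_eq_fintype_card]
    exact IsGalois.card_aut_eq_finrank ℚ K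
  · intro Q hQ
    obtain ⟨σ, -, rfl⟩ := Finset.mem_image.1 hQ
    refine ⟨Ideal.comap_isPrime _ _, ?_, ?_⟩
    · rw [Ideal.mem_comap, map_natCast]; exact hrP
    · intro i
      obtain ⟨a, b, hab⟩ := hω i
      obtain ⟨c, hc⟩ := hζc _ (hΦζ σ)
      obtain ⟨c', hc'⟩ := hαc _ (hΦα σ)
      refine ⟨c ^ a * c' ^ b, ?_⟩
      rw [Ideal.mem_comap, map_sub, map_intCast, hab, map_mul, map_pow, map_pow]
      rw [← Ideal.Quotient.eq] at hc hc' ⊢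
      push_cast
      rw [map_mul, map_mul, map_pow, map_pow, map_pow, map_pow, hc, hc']

lemma residueCond_of_hasDegreeOnePrime {ζ α : 𝓞 K} {p m N r : ℕ} (hNm : N ∣ m)
    (hζ : IsPrimitiveRoot ζ m) (hα : α ^ N = p) (hr : r.Prime) (hrm : ¬ r ∣ m) (hrp : ¬ r ∣ p)
    (h : HasDegreeOnePrime K r) : ResidueCond p m N r := by
  obtain ⟨P, hP, hPr⟩ := h
  have hrP : (r : 𝓞 K) ∈ P := hPr ▸ Ideal.absNorm_mem P
  have hnat : ∀ k : ℕ, ¬ r ∣ k → (k : 𝓞 K) ∉ P := fun k hk h => by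
    have := (intCast_mem_iff_of_prime_mem hP hr hrP k).1 (by exact_mod_cast h)
    exact hk (by exact_mod_cast this)
  have h1P : (1 : 𝓞 K) ∉ P := fun h => hP.ne_top ((Ideal.eq_top_iff_one P).2 h)
  have hcard : Nat.card (𝓞 K ⧸ P) = r := by
    rw [← hPr, Ideal.absNorm_apply]; rfl
  have : Finite (𝓞 K ⧸ P) := Nat.finite_of_card_ne_zero (by rw [hcard]; exact hr.ne_zero)
  let : Fintype (𝓞 K ⧸ P) := Fintype.ofFinite _
  let : Field (𝓞 K ⧸ P) := Fintype.fieldOfDomain _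
  have hferm : ∀ x : 𝓞 K, x ∉ P → x ^ (r - 1) - 1 ∈ P := by
    intro x hx
    rw [← Ideal.Quotient.eq, map_pow, map_one, ← hcard, Nat.card_eq_fintype_card]
    apply FiniteField.pow_card_sub_one_eq_one
    rwa [Ne, Ideal.Quotient.eq_zero_iff_mem]
  have hm0 : m ≠ 0 := fun h => hrm (h ▸ dvd_zero r)
  have hmr : m ∣ r - 1 := by
    rw [← hζ.pow_eq_one_iff_dvd]
    refine eq_of_pow_eq_of_sub_mem hP (N := m) (c := 1) ?_ (one_pow m) (hnat m hrm) h1P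
      (hferm ζ fun h => h1P ?_)
    · rw [← pow_mul, mul_comm, pow_mul, hζ.pow_eq_one, one_pow]
    · rw [← hζ.pow_eq_one]; exact P.pow_mem_of_mem h m (Nat.pos_of_ne_zero hm0)
  refine ⟨hmr, ?_⟩
  rw [← pow_residue_sub_one_mem hP hr hrP, ← hα, ← pow_mul, Nat.mul_div_cancel' (hNm.trans hmr)]
  apply hferm
  intro h
  apply hnat p hrp
  rw [← hα]
  exact P.pow_mem_of_mem h N (Nat.pos_of_dvd_of_pos hNm (Nat.pos_of_ne_zero hm0))

lemma exists_basis_of_adjoin_eq_top {ζ α : 𝓞 K} {p m N : ℕ} (hp : 1 ≤ p) (hm : 1 ≤ m) (hN : 1 ≤ N)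
    (hζ : ζ ^ m = 1) (hα : α ^ N = p) (htop : Algebra.adjoin ℚ {(ζ : K), (α : K)} = ⊤) :
    ∃ (s : Finset K) (ω : s → 𝓞 K), s.card = Module.finrank ℚ K ∧
      (∀ (σ : K →+* ℂ) (i : s), ‖σ (ω i)‖ ≤ p) ∧ (∀ b : s → ℤ, intComb ω b = 0 → b = 0) ∧
      ∀ i, ∃ a b : ℕ, ω i = ζ ^ a * α ^ b := by
  set t : Set K := {z | ∃ a b : ℕ, b ≤ N ∧ z = (ζ : K) ^ a * (α : K) ^ b} with ht
  have hαK : (α : K) ^ N = p := by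
    have := congrArg (fun z : 𝓞 K => (z : K)) hα
    simpa using this
  have hζK : (ζ : K) ^ m = 1 := by
    have := congrArg (fun z : 𝓞 K => (z : K)) hζ
    simpa using this
  have hspan : Submodule.span ℚ t = ⊤ := by
    rw [eq_top_iff, ← Algebra.top_toSubmodule, ← htop, Algebra.adjoin_eq_span, Submodule.span_le]
    intro z hz
    obtain ⟨a, b, rfl⟩ := (Submonoid.mem_closure_pair _ _ _).1 hz
    have h1 : (ζ : K) ^ a * (α : K) ^ b =
        ((p : ℚ) ^ (b / N)) • ((ζ : K) ^ a * (α : K) ^ (b % N)) := by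
      conv_lhs => rw [← Nat.div_add_mod b N, pow_add, pow_mul, hαK]
      rw [Algebra.smul_def, map_pow, map_natCast]
      ring
    rw [h1]
    exact Submodule.smul_mem _ _ (Submodule.subset_span ⟨a, b % N, (Nat.mod_lt _ hN).le, rfl⟩)
  obtain ⟨u, hut, huspan, hli⟩ := exists_linearIndependent ℚ t
  let bas := Module.Basis.mk hli (by rw [Subtype.range_coe, huspan, hspan])
  have hfin : Finite u := Module.Finite.finite_basis bas
  have hufin : u.Finite := hfin
  obtain ⟨s, rfl⟩ : ∃ s : Finset K, (s : Set K) = u := ⟨hufin.toFinset, hufin.coe_toFinset⟩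
  choose! a b hb hab using fun (z : K) (hz : z ∈ (s : Set K)) => hut hz
  have hcoe : ∀ i : s, ((ζ ^ a i * α ^ b i : 𝓞 K) : K) = i := fun i => by
    push_cast
    exact (hab i i.2).symm
  refine ⟨s, fun i => ζ ^ a i * α ^ b i, ?_, ?_, ?_, fun i => ⟨_, _, rfl⟩⟩
  · rw [Module.finrank_eq_card_basis bas]
    simp
  · intro σ i
    rw [hcoe, hab i i.2, map_mul, map_pow, map_pow, norm_mul, norm_pow, norm_pow]
    have h1 : ‖σ (ζ : K)‖ = 1 := by
      refine Complex.norm_eq_one_of_pow_eq_one (n := m) ?_ (by omega)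
      rw [← map_pow, hζK, map_one]
    have h2 : ‖σ (α : K)‖ ^ N = p := by
      rw [← norm_pow, ← map_pow, hαK, map_natCast, Complex.norm_natCast]
    have hpR : (1 : ℝ) ≤ p := by exact_mod_cast hp
    have h3 : 1 ≤ ‖σ (α : K)‖ := by
      by_contra hlt
      have := pow_lt_one₀ (norm_nonneg _) (not_le.1 hlt) (by omega : N ≠ 0)
      linarith
    rw [h1, one_pow, one_mul, ← h2]
    exact pow_le_pow_right₀ h3 (hb i i.2)
  · intro c hc
    have h1 : ∑ i : s, (c i : ℚ) • (i : K) = 0 := by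
      have h2 := congrArg (fun z : 𝓞 K => algebraMap (𝓞 K) K z) hc
      simp only [intComb, map_sum, map_mul, map_intCast, map_zero] at h2
      rw [← h2]
      refine Finset.sum_congr rfl fun i _ => ?_
      have h3 : (algebraMap (𝓞 K) K) (ζ ^ a i) * (algebraMap (𝓞 K) K) (α ^ b i) = i := by
        rw [← map_mul]
        exact hcoe i
      rw [h3, Algebra.smul_def]
      simp
    have h3 := Fintype.linearIndependent_iff.1 hli (fun i => (c i : ℚ)) h1
    funext i
    exact_mod_cast h3 i

lemma abs_recipSum_residueCond_sub_le [IsGalois ℚ K] {ζ α : 𝓞 K} {p m N : ℕ} (hp : p.Prime)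
    (hm : 1 ≤ m) (hNm : N ∣ m) (hc : m.primeFactors.card ≤ 2) (hζ : IsPrimitiveRoot ζ m)
    (hα : α ^ N = p) (htop : Algebra.adjoin ℚ {(ζ : K), (α : K)} = ⊤) (x : ℕ) :
    |recipSum (ResidueCond p m N) x - logI 2 x / Module.finrank ℚ K| ≤
      20000 * (1 + Real.log (Module.finrank ℚ K * p : ℕ) + Real.log (logI 2 x)) := by
  have hN1 : 1 ≤ N := Nat.pos_of_dvd_of_pos hNm hm
  obtain ⟨s, ω, hcard, hΩ, hli, hω⟩ := exists_basis_of_adjoin_eq_top hp.one_lt.le hm hN1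
    hζ.pow_eq_one hα htop
  have hcard' : Fintype.card s = Module.finrank ℚ K := by rw [Fintype.card_coe, hcard]
  have hup := recipSum_le_of_splitsAt hcard' hp.one_lt.le hΩ hli rfl rfl (ResidueCond p m N)
    (fun r hr hR => splitsAt_of_residueCond hm hNm hζ.pow_eq_one hα htop ω hω hr hR) x
  have hlow := le_recipSum_hasDegreeOnePrime hcard' hp.one_lt.le hΩ hli rfl rfl x
  have hcmp : recipSum (HasDegreeOnePrime K) x ≤ recipSum (ResidueCond p m N) x + 3 := by
    have h1 : recipSum (HasDegreeOnePrime K) x ≤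
        recipSum (ResidueCond p m N) x + ∑ r ∈ (m * p).primeFactors, 1 / (r : ℝ) := by
      rw [recipSum, recipSum]
      refine le_trans ?_ (Finset.sum_union_inter
        (s₁ := (Finset.Icc 1 x).filter fun r => r.Prime ∧ ResidueCond p m N r)
        (s₂ := (m * p).primeFactors) (f := fun r : ℕ => 1 / (r : ℝ))).le
      have h2 : 0 ≤ ∑ r ∈ ((Finset.Icc 1 x).filter fun r => r.Prime ∧ ResidueCond p m N r) ∩
          (m * p).primeFactors, 1 / (r : ℝ) := Finset.sum_nonneg fun _ _ => by positivity
      refine le_trans (Finset.sum_le_sum_of_subset_of_nonneg ?_ fun _ _ _ => by positivity)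
        (le_add_of_nonneg_right h2)
      intro r hr
      rw [Finset.mem_filter] at hr
      rw [Finset.mem_union, Finset.mem_filter, Nat.mem_primeFactors]
      by_cases hd : r ∣ m * p
      · exact Or.inr ⟨hr.2.1, hd, Nat.mul_ne_zero (by omega) hp.ne_zero⟩
      · exact Or.inl ⟨hr.1, hr.2.1, residueCond_of_hasDegreeOnePrime hNm hζ hα hr.2.1
          (fun h => hd (h.mul_right p)) (fun h => hd (h.mul_left m)) hr.2.2⟩
    refine h1.trans (add_le_add le_rfl ?_)
    have h3 : (m * p).primeFactors.card ≤ 3 := by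
      rw [Nat.primeFactors_mul (by omega) hp.ne_zero, hp.primeFactors]
      refine (Finset.card_union_le _ _).trans ?_
      rw [Finset.card_singleton]
      omega
    calc ∑ r ∈ (m * p).primeFactors, 1 / (r : ℝ) ≤ ∑ _r ∈ (m * p).primeFactors, (1 : ℝ) := by
          refine Finset.sum_le_sum fun r hr => ?_
          have h1 : (1 : ℝ) ≤ r := by exact_mod_cast (Nat.prime_of_mem_primeFactors hr).one_lt.le
          exact div_le_one_of_le₀ h1 (by linarith)
      _ ≤ 3 := by
          rw [Finset.sum_const, nsmul_eq_mul, mul_one]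
          exact_mod_cast h3
  have hM : 0 ≤ Real.log (Module.finrank ℚ K * p : ℕ) := Real.log_natCast_nonneg _
  have hY : 0 ≤ Real.log (logI 2 (x : ℝ)) := Real.log_nonneg (one_le_logI 1 _)
  rw [abs_le]
  constructor <;> linarith

end Kummer

section Degree

open Polynomial IntermediateField

lemma exists_multiset_prod_eq {F K : Type*} [Field F] [Field K] [Algebra F K] (α : K)
    (s : Multiset K) (hs : ∀ ρ ∈ s, ∃ e : F, e ≠ 0 ∧ ρ = algebraMap F K e * α) :
    ∃ e : F, e ≠ 0 ∧ s.prod = algebraMap F K e * α ^ s.card := by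
  induction s using Multiset.induction_on with
  | empty => exact ⟨1, one_ne_zero, by simp⟩
  | cons a s ih =>
    obtain ⟨e, he, hse⟩ := ih fun ρ hρ => hs ρ (Multiset.mem_cons_of_mem hρ)
    obtain ⟨e', he', hae⟩ := hs a (Multiset.mem_cons_self a s)
    refine ⟨e' * e, mul_ne_zero he' he, ?_⟩
    rw [Multiset.prod_cons, hse, hae, Multiset.card_cons, map_mul, pow_succ]
    ring

lemma pow_natDegree_minpoly_mem {F K : Type*} [Field F] [Field K] [Algebra F K] {N : ℕ}
    (hN : N ≠ 0) {ζ : F} (hζ : IsPrimitiveRoot ζ N) {α : K} {c : F}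
    (hα : α ^ N = algebraMap F K c) (hα0 : α ≠ 0) :
    α ^ (minpoly F α).natDegree ∈ (algebraMap F K).range := by
  have hαint : IsIntegral F α := IsIntegral.of_pow (Nat.pos_of_ne_zero hN) (hα ▸ isIntegral_algebraMap)
  have hζK : IsPrimitiveRoot (algebraMap F K ζ) N := hζ.map_of_injective (algebraMap F K).injective
  have : NeZero N := ⟨hN⟩
  have hdvd : (minpoly F α).map (algebraMap F K) ∣ X ^ N - C (α ^ N) := by
    have : minpoly F α ∣ X ^ N - C c := minpoly.dvd _ _ (by simp [hα])
    have h2 := Polynomial.map_dvd (algebraMap F K) this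
    simpa [hα] using h2
  have hne : (X ^ N - C (α ^ N) : K[X]) ≠ 0 := (monic_X_pow_sub_C _ hN).ne_zero
  have hspl : ((minpoly F α).map (algebraMap F K)).Splits :=
    (X_pow_sub_C_splits_of_isPrimitiveRoot hζK rfl).of_dvd hne hdvd
  have hmon : ((minpoly F α).map (algebraMap F K)).Monic := (minpoly.monic hαint).map _
  obtain ⟨e, he, hprod⟩ := exists_multiset_prod_eq (F := F) α
    ((minpoly F α).map (algebraMap F K)).roots (by
      intro ρ hρ
      have h1 := (mem_roots'.1 hρ).2.dvd hdvd
      have h2 : ρ ^ N = α ^ N := by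
        simpa [IsRoot, sub_eq_zero] using h1
      have h3 : (ρ / α) ^ N = 1 := by
        rw [div_pow, h2, div_self (pow_ne_zero _ hα0)]
      obtain ⟨i, -, hi⟩ := hζK.eq_pow_of_pow_eq_one h3
      refine ⟨ζ ^ i, pow_ne_zero _ (hζ.ne_zero hN), ?_⟩
      rw [map_pow, hi, div_mul_cancel₀ _ hα0])
  have h0 := hspl.coeff_zero_eq_prod_roots_of_monic hmon
  rw [hprod, ← hspl.natDegree_eq_card_roots, natDegree_map, coeff_map] at h0
  refine ⟨(-1) ^ (minpoly F α).natDegree * (minpoly F α).coeff 0 * e⁻¹, ?_⟩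
  have he' : algebraMap F K e ≠ 0 := by simpa using he
  rw [map_mul, map_mul, h0, map_inv₀, map_pow, map_neg, map_one]
  field_simp
  rw [← pow_mul, mul_comm _ 2, pow_mul]
  simp

lemma natDegree_minpoly_eq_two_pow {F K : Type*} [Field F] [Field K] [Algebra F K] {i s : ℕ}
    {ζ : F} (hζ : IsPrimitiveRoot ζ (2 ^ i)) {α : K} (hs : s ≤ i) (hα0 : α ≠ 0)
    (h1 : α ^ 2 ^ s ∈ (algebraMap F K).range)
    (h0 : s ≠ 0 → α ^ 2 ^ (s - 1) ∉ (algebraMap F K).range) :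
    (minpoly F α).natDegree = 2 ^ s := by
  obtain ⟨c, hc⟩ := h1
  set d := (minpoly F α).natDegree with hd
  have hαint : IsIntegral F α :=
    IsIntegral.of_pow (by positivity : 0 < 2 ^ s) (hc ▸ isIntegral_algebraMap)
  have hdpos : 0 < d := minpoly.natDegree_pos hαint
  have hζs : IsPrimitiveRoot (ζ ^ 2 ^ (i - s)) (2 ^ s) :=
    hζ.pow (by positivity) (by rw [← pow_add]; congr 1; omega)
  have hdmem : α ^ d ∈ (algebraMap F K).range :=
    pow_natDegree_minpoly_mem (by positivity) hζs hc.symm hα0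
  have hmin : ∀ k, 0 < k → α ^ k ∈ (algebraMap F K).range → d ≤ k := by
    rintro k hk ⟨c', hc'⟩
    have := natDegree_le_natDegree (minpoly.min F α (monic_X_pow_sub_C c' hk.ne') (by simp [hc']))
    rwa [natDegree_X_pow_sub_C] at this
  have hdvd : d ∣ 2 ^ s := by
    rw [Nat.dvd_iff_mod_eq_zero]
    by_contra hne
    refine (Nat.mod_lt (2 ^ s) hdpos).not_ge (hmin _ (Nat.pos_of_ne_zero hne) ?_)
    obtain ⟨e, he⟩ := hdmem
    have he0 : algebraMap F K e ≠ 0 := he ▸ pow_ne_zero _ hα0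
    refine ⟨c / e ^ (2 ^ s / d), ?_⟩
    rw [map_div₀, map_pow, hc, he, div_eq_iff (by rw [← he]; exact pow_ne_zero _ he0), ← pow_mul,
      ← pow_add, Nat.mod_add_div]
  obtain ⟨j, hj, hdj⟩ := (Nat.dvd_prime_pow Nat.prime_two).1 hdvd
  rcases hj.lt_or_eq with hlt | rfl
  · exfalso
    apply h0 (by omega)
    have : 2 ^ (s - 1) = d * 2 ^ (s - 1 - j) := by rw [hdj, ← pow_add]; congr 1; omega
    rw [this, pow_mul]
    exact Subring.pow_mem _ hdmem _
  · exact hdj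

lemma finrank_eq_totient_mul_natDegree {K : Type*} [Field K] [NumberField K] {m : ℕ} (hm : 1 ≤ m)
    {ζ α : K} (hζ : IsPrimitiveRoot ζ m) (htop : Algebra.adjoin ℚ {ζ, α} = ⊤) :
    Module.finrank ℚ K = m.totient * (minpoly ℚ⟮ζ⟯ α).natDegree := by
  have : NeZero m := ⟨by omega⟩
  have hcyc : IsCyclotomicExtension {m} ℚ ℚ⟮ζ⟯ :=
    IsPrimitiveRoot.intermediateField_adjoin_isCyclotomicExtension ℚ hζ
  have h1 : Module.finrank ℚ ℚ⟮ζ⟯ = m.totient :=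
    IsCyclotomicExtension.finrank _ (cyclotomic.irreducible_rat (by omega))
  have h2 : (ℚ⟮ζ⟯⟮α⟯ : IntermediateField ℚ⟮ζ⟯ K) = ⊤ := by
    rw [eq_top_iff]
    intro z _
    have hz : z ∈ Algebra.adjoin ℚ {ζ, α} := htop ▸ Algebra.mem_top
    induction hz using Algebra.adjoin_induction with
    | mem x hx =>
      rcases hx with rfl | rfl
      · exact IntermediateField.algebraMap_mem _ (⟨x, mem_adjoin_simple_self ℚ x⟩ : ℚ⟮x⟯)
      · exact mem_adjoin_simple_self _ _
    | algebraMap q =>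
      rw [eq_ratCast]
      exact SubfieldClass.ratCast_mem _ q
    | add x y _ _ hx hy => exact add_mem (hx trivial) (hy trivial)
    | mul x y _ _ hx hy => exact mul_mem (hx trivial) (hy trivial)
  rw [← Module.finrank_mul_finrank ℚ ℚ⟮ζ⟯ K, h1,
    ← IntermediateField.adjoin.finrank (Algebra.IsIntegral.isIntegral α), h2,
    IntermediateField.finrank_top']
lemma exists_isSquare_zmod_of_sq_eq {K : Type*} [Field K] [CharZero K] {m a : ℕ} (hm : 1 ≤ m) {ζ : K}
    (hζ : IsPrimitiveRoot ζ m) {f : ℚ[X]} (hf : aeval ζ f ^ 2 = (a : K)) :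
    ∃ B : ℕ, ∀ r : ℕ, r.Prime → B < r → m ∣ r - 1 → IsSquare (a : ZMod r) := by
  obtain ⟨D, hD, hg⟩ := IsLocalization.integerNormalization_spec (nonZeroDivisors ℤ) f
  set g := IsLocalization.integerNormalization (nonZeroDivisors ℤ) f
  have hD0 : D ≠ 0 := nonZeroDivisors.ne_zero hD
  refine ⟨D.natAbs, fun r hr hDr hmr => ?_⟩
  have : Fact r.Prime := ⟨hr⟩
  have h1 : aeval ζ g = (D : K) * aeval ζ f := by
    have h2 := congrArg (aeval ζ) hg
    rw [aeval_map_algebraMap] at h2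
    rw [h2]
    simp
  have h3 : aeval ζ (g ^ 2 - C (D ^ 2 * a)) = 0 := by
    rw [map_sub, map_pow, h1, mul_pow, hf]
    simp
  have h4 := minpoly.isIntegrallyClosed_dvd (hζ.isIntegral (by omega)) h3
  rw [← cyclotomic_eq_minpoly hζ (by omega)] at h4
  obtain ⟨c, hc⟩ : ∃ c : ZMod r, IsPrimitiveRoot c m := by
    obtain ⟨u, hu⟩ := IsCyclic.exists_generator (α := (ZMod r)ˣ)
    have h5 : orderOf u = r - 1 := by
      rw [orderOf_eq_card_of_forall_mem_zpowers hu, Nat.card_eq_fintype_card, ZMod.card_units]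
    have h6 : IsPrimitiveRoot (u : ZMod r) (r - 1) := by
      rw [← h5, ← orderOf_units]
      exact IsPrimitiveRoot.orderOf _
    obtain ⟨k, hk⟩ := hmr
    have := hr.two_le
    exact ⟨_, h6.pow (by omega) (hk.trans (mul_comm _ _))⟩
  have hmr0 : (m : ZMod r) ≠ 0 := by
    rw [Ne, ZMod.natCast_eq_zero_iff]
    intro h
    have h7 := hr.two_le
    have h8 := Nat.le_of_dvd (by omega) h
    have h9 := Nat.le_of_dvd (by omega) hmr
    omega
  have : NeZero (m : ZMod r) := ⟨hmr0⟩
  have h5 : eval₂ (Int.castRingHom (ZMod r)) c (g ^ 2 - C (D ^ 2 * a)) = 0 := by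
    obtain ⟨h, hh⟩ := h4
    have h6 := isRoot_cyclotomic_iff.2 hc
    rw [← map_cyclotomic_int, IsRoot.def, eval_map] at h6
    rw [hh, eval₂_mul, h6, zero_mul]
  have hDr0 : (D : ZMod r) ≠ 0 := by
    rw [Ne, ZMod.intCast_zmod_eq_zero_iff_dvd]
    intro h
    have := Nat.le_of_dvd (Int.natAbs_pos.2 hD0) (Int.natCast_dvd.1 h)
    omega
  refine ⟨eval₂ (Int.castRingHom (ZMod r)) c g / D, ?_⟩
  rw [eval₂_sub, eval₂_pow, eval₂_C, sub_eq_zero] at h5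
  rw [← sq, div_pow, eq_div_iff (pow_ne_zero _ hDr0), h5]
  simp [mul_comm]

lemma sq_ne_prime_of_mem_adjoin {K : Type*} [Field K] [NumberField K] {m p : ℕ} (hm : 1 ≤ m)
    {ζ z : K} (hζ : IsPrimitiveRoot ζ m) (hp : p.Prime) (hp2 : p ≠ 2) (hpm : ¬ p ∣ m)
    (hz : z ∈ ℚ⟮ζ⟯) : z ^ 2 ≠ p := by
  intro hzp
  have : Fact p.Prime := ⟨hp⟩
  have hz' : z ∈ Algebra.adjoin ℚ {ζ} := by
    rwa [← IntermediateField.adjoin_simple_toSubalgebra_of_isAlgebraic (Algebra.IsAlgebraic.isAlgebraic ζ)]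
  rw [Algebra.adjoin_singleton_eq_range_aeval] at hz'
  obtain ⟨f, rfl⟩ := hz'
  obtain ⟨B, hB⟩ := exists_isSquare_zmod_of_sq_eq hm hζ hzp
  obtain ⟨a, ha⟩ := FiniteField.exists_nonsquare (F := ZMod p) (by rwa [ZMod.ringChar_zmod_n])
  have hcop : Nat.Coprime (4 * m) p := by
    rw [Nat.coprime_comm, hp.coprime_iff_not_dvd, hp.dvd_mul]
    rintro (h | h)
    · exact hp2 ((Nat.prime_dvd_prime_iff_eq hp Nat.prime_two).1
        (hp.dvd_of_dvd_pow (show p ∣ 2 ^ 2 from h)))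
    · exact hpm h
  obtain ⟨k, hk1, hk2⟩ := Nat.chineseRemainder hcop 1 a.val
  have ha0 : a ≠ 0 := by
    rintro rfl
    exact ha ⟨0, by simp⟩
  have hkp : (k : ZMod p) = a := by
    rw [(ZMod.natCast_eq_natCast_iff _ _ _).2 hk2, ZMod.natCast_zmod_val]
  have hunit : IsUnit (k : ZMod (4 * m * p)) := by
    rw [ZMod.isUnit_iff_coprime, Nat.coprime_mul_iff_right]
    constructor
    · have := hk1.gcd_eq
      rwa [Nat.gcd_one_left] at this
    · rw [Nat.coprime_comm, hp.coprime_iff_not_dvd, ← ZMod.natCast_eq_zero_iff, hkp]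
      exact ha0
  have : NeZero (4 * m * p) := ⟨by have := hp.pos; positivity⟩
  obtain ⟨r, hBr, hr, hrk⟩ := Nat.forall_exists_prime_gt_and_eq_mod hunit B
  have : Fact r.Prime := ⟨hr⟩
  have hrk' : r ≡ k [MOD 4 * m * p] := (ZMod.natCast_eq_natCast_iff _ _ _).1 hrk
  have hr4m : 4 * m ∣ r - 1 :=
    (Nat.modEq_iff_dvd' hr.one_lt.le).1 ((hrk'.of_mul_right p).trans hk1).symm
  have hr4 : r % 4 = 1 := by
    have := (dvd_mul_right 4 m).trans hr4m
    have := hr.two_le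
    omega
  have hrp : (r : ZMod p) = a := by
    rw [(ZMod.natCast_eq_natCast_iff _ _ _).2 (hrk'.of_mul_left (4 * m)), hkp]
  refine ha ?_
  rw [← hrp, ← ZMod.exists_sq_eq_prime_iff_of_mod_four_eq_one hr4 hp2]
  exact hB r hr hBr ((dvd_mul_left m 4).trans hr4m)

lemma conj_eq_or_eq_neg {z : ℂ} (hz : z ^ 4 = 2) : 
    (starRingEnd ℂ) z = z ∨ (starRingEnd ℂ) z = -z := by
  rw [← sq_eq_sq_iff_eq_or_eq_neg]
  have h1 : (starRingEnd ℂ z * z) ^ 2 = 2 := by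
    have h : ‖z‖ ^ 4 = 2 := by rw [← norm_pow, hz]; simp
    rw [mul_comm, Complex.mul_conj, Complex.normSq_eq_norm_sq]
    rw [← Complex.ofReal_pow, ← pow_mul, h]
    simp
  have hz0 : z ^ 2 ≠ 0 := by
    intro h
    have : z ^ 4 = (z ^ 2) ^ 2 := by ring
    rw [this, h] at hz
    norm_num at hz
  apply mul_right_cancel₀ hz0
  rw [← mul_pow, h1, ← hz]
  ring

lemma sq_eq_one_of_conj {z : ℂ} (hz : z ^ 4 = 1) (h : starRingEnd ℂ z = z) : z ^ 2 = 1 := by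
  obtain ⟨r, rfl⟩ := Complex.conj_eq_iff_real.1 h
  have h1 : r ^ 4 = 1 := by exact_mod_cast hz
  have h2 : (r ^ 2 - 1) * (r ^ 2 + 1) = 0 := by ring_nf; linarith
  have h3 : r ^ 2 + 1 ≠ 0 := by positivity
  have h4 := (mul_eq_zero.1 h2).resolve_right h3
  have h5 : r ^ 2 = 1 := by linarith
  exact_mod_cast h5

lemma pow_four_ne_two {F : Type*} [Field F] [NumberField F] [IsGalois ℚ F]
    (hcomm : ∀ σ τ : F ≃ₐ[ℚ] F, ∀ z, σ (τ z) = τ (σ z)) (β : F) : β ^ 4 ≠ 2 := by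
  intro hβ
  obtain ⟨φ⟩ : Nonempty (F →+* ℂ) := inferInstance
  obtain ⟨τ, hτ⟩ : ∃ τ : F ≃ₐ[ℚ] F, ∀ z, φ (τ z) = starRingEnd ℂ (φ z) := by
    let _ := φ.toAlgebra
    have : IsScalarTower ℚ F ℂ := IsScalarTower.of_algebraMap_eq' (Subsingleton.elim _ _)
    refine ⟨AlgEquiv.restrictNormal (Complex.conjAe.restrictScalars ℚ) F, fun z => ?_⟩
    have := AlgEquiv.restrictNormal_commutes (Complex.conjAe.restrictScalars ℚ) F z
    exact this
  have hβ0 : β ≠ 0 := by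
    rintro rfl
    norm_num at hβ
  have hτβ : τ β = β ∨ τ β = -β := by
    have h1 : φ β ^ 4 = 2 := by rw [← map_pow, hβ, map_ofNat]
    rcases conj_eq_or_eq_neg h1 with h | h <;> rw [← hτ] at h
    · exact Or.inl (φ.injective h)
    · exact Or.inr (φ.injective (by rw [h, map_neg]))
  have hfix : ∀ σ : F ≃ₐ[ℚ] F, σ (β ^ 2) = β ^ 2 := by
    intro σ
    have h1 : τ (σ β / β) = σ β / β := by
      rw [map_div₀, ← hcomm]
      rcases hτβ with h | h <;> rw [h]
      rw [map_neg, neg_div_neg_eq]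
    have h2 : (σ β / β) ^ 4 = 1 := by
      rw [div_pow, ← map_pow, hβ, map_ofNat, div_self two_ne_zero]
    have h3 : (σ β / β) ^ 2 = 1 := by
      apply φ.injective
      rw [map_pow, map_one]
      apply sq_eq_one_of_conj
      · rw [← map_pow, h2, map_one]
      · rw [← hτ, h1]
    rw [div_pow, div_eq_one_iff_eq (pow_ne_zero _ hβ0)] at h3
    rw [map_pow, h3]
  have hbot := (IsGalois.mem_bot_iff_fixed (F := ℚ) (β ^ 2)).2 hfix
  obtain ⟨q, hq⟩ := IntermediateField.mem_bot.1 hbot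
  have h4 : q ^ 2 = 2 := by
    apply (algebraMap ℚ F).injective
    rw [map_pow, hq, map_ofNat, ← hβ]
    ring
  have h5 : (q.num : ℤ) ^ 2 = 2 * (q.den : ℤ) ^ 2 := by
    have := congrArg (fun z : ℚ => z) h4
    rw [← Rat.num_div_den q, div_pow, div_eq_iff (by positivity)] at h4
    exact_mod_cast h4
  have h6 := irrational_sqrt_two
  apply h6
  refine ⟨|q|, ?_⟩
  rw [eq_comm, Real.sqrt_eq_iff_mul_self_eq (by norm_num) (by positivity)]
  have : |q| * |q| = 2 := by rw [abs_mul_abs_self, ← h4]; ring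
  exact_mod_cast this.symm

lemma pow_four_ne_two_of_mem_adjoin {K : Type*} [Field K] [NumberField K] {m : ℕ} (hm : 1 ≤ m)
    {ζ z : K} (hζ : IsPrimitiveRoot ζ m) (hz : z ∈ ℚ⟮ζ⟯) : z ^ 4 ≠ 2 := by
  have : NeZero m := ⟨by omega⟩
  have hcyc : IsCyclotomicExtension {m} ℚ ℚ⟮ζ⟯ :=
    IsPrimitiveRoot.intermediateField_adjoin_isCyclotomicExtension ℚ hζ
  have : IsGalois ℚ ℚ⟮ζ⟯ := IsCyclotomicExtension.isGalois {m} ℚ _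
  have hc : IsMulCommutative (ℚ⟮ζ⟯ ≃ₐ[ℚ] ℚ⟮ζ⟯) := IsCyclotomicExtension.isMulCommutative {m} ℚ _
  intro h
  refine pow_four_ne_two (F := ℚ⟮ζ⟯) (fun σ τ y => ?_) ⟨z, hz⟩ (Subtype.ext h)
  exact congrArg (fun g : ℚ⟮ζ⟯ ≃ₐ[ℚ] ℚ⟮ζ⟯ => g y) (hc.is_comm.comm σ τ)

lemma exists_isSplittingField_rat (f : ℚ[X]) :
    ∃ (K : Type) (_ : Field K) (_ : CharZero K), IsSplittingField ℚ K f := by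
  refine ⟨f.SplittingField, inferInstance,
    charZero_of_injective_algebraMap (algebraMap ℚ f.SplittingField).injective, ?_⟩
  convert IsSplittingField.splittingField f
  exact Subsingleton.elim _ _

lemma exists_kummer_field {p m N : ℕ} (hp : 1 ≤ p) (hm : 1 ≤ m) (hN : N ∣ m) :
    ∃ (K : Type) (_ : Field K) (_ : NumberField K) (_ : IsGalois ℚ K) (ζ α : K),
      IsPrimitiveRoot ζ m ∧ α ^ N = p ∧ Algebra.adjoin ℚ {ζ, α} = ⊤ := by
  have hN1 : N ≠ 0 := by rintro rfl; simp at hN; omega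
  set f : ℚ[X] := (X ^ m - C 1) * (X ^ N - C (p : ℚ)) with hf
  have hf0 : f ≠ 0 := mul_ne_zero (monic_X_pow_sub_C _ (by omega)).ne_zero
    (monic_X_pow_sub_C _ hN1).ne_zero
  obtain ⟨K, _, _, hK⟩ := exists_isSplittingField_rat f
  have hK2 : FiniteDimensional ℚ K := IsSplittingField.finiteDimensional _ f
  have hK3 : Normal ℚ K := Normal.of_isSplittingField f
  have hspl := IsSplittingField.splits K f
  have hm0 : NeZero m := ⟨by omega⟩
  have hmK : NeZero (m : K) := ⟨by exact_mod_cast (by omega : m ≠ 0)⟩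
  have hf0' : f.map (algebraMap ℚ K) ≠ 0 := Polynomial.map_ne_zero hf0
  obtain ⟨ζ, hζ⟩ : ∃ ζ : K, IsPrimitiveRoot ζ m := by
    have h1 : (cyclotomic m K).Splits := by
      refine hspl.of_dvd hf0' ?_
      rw [← map_cyclotomic m (algebraMap ℚ K)]
      refine Polynomial.map_dvd _ ((cyclotomic.dvd_X_pow_sub_one m ℚ).trans ?_)
      rw [hf, C_1]
      exact dvd_mul_right _ _
    obtain ⟨ζ, hζ⟩ := h1.exists_eval_eq_zero (degree_cyclotomic_pos m _ (by omega)).ne'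
    exact ⟨ζ, isRoot_cyclotomic_iff.1 hζ⟩
  obtain ⟨α, hα⟩ : ∃ α : K, α ^ N = p := by
    have h1 : (X ^ N - C (p : K)).Splits := by
      refine hspl.of_dvd hf0' ?_
      have : X ^ N - C (p : K) =
          (X ^ N - C (p : ℚ)).map (algebraMap ℚ K) := by simp
      rw [this]
      exact Polynomial.map_dvd _ (dvd_mul_left _ _)
    obtain ⟨α, hα⟩ := h1.exists_eval_eq_zero (by
      rw [degree_X_pow_sub_C (Nat.pos_of_ne_zero hN1)]
      exact_mod_cast hN1)
    exact ⟨α, by simpa [sub_eq_zero] using hα⟩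
  refine ⟨K, inferInstance, ⟨⟩, ⟨⟩, ζ, α, hζ, hα, ?_⟩
  rw [eq_top_iff]
  have hα0 : α ≠ 0 := by
    rintro rfl
    rw [zero_pow hN1] at hα
    have : (p : K) ≠ 0 := by exact_mod_cast (by omega : p ≠ 0)
    exact this hα.symm
  have htop := IsSplittingField.adjoin_rootSet K f
  have key : Algebra.adjoin ℚ (f.rootSet K) ≤ Algebra.adjoin ℚ {ζ, α} := by
    refine Algebra.adjoin_le fun z hz => ?_
    have hζm : ζ ∈ Algebra.adjoin ℚ {ζ, α} := Algebra.subset_adjoin (by simp)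
    have hαm : α ∈ Algebra.adjoin ℚ {ζ, α} := Algebra.subset_adjoin (by simp)
    have h1 := (mem_rootSet.1 hz).2
    simp only [hf, map_mul, mul_eq_zero] at h1
    rcases h1 with h1 | h1
    · have h2 : z ^ m = 1 := by simpa [sub_eq_zero] using h1
      obtain ⟨k, -, rfl⟩ := hζ.eq_pow_of_pow_eq_one h2
      exact pow_mem hζm k
    · have h2 : z ^ N = p := by simpa [sub_eq_zero] using h1
      have h3 : (z / α) ^ m = 1 := by
        obtain ⟨c, rfl⟩ := hN
        rw [pow_mul, div_pow, h2, hα, div_self (by rw [← hα]; exact pow_ne_zero _ hα0), one_pow]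
      obtain ⟨k, -, hk⟩ := hζ.eq_pow_of_pow_eq_one h3
      have h4 : z = ζ ^ k * α := by rw [hk, div_mul_cancel₀ _ hα0]
      rw [h4]
      exact mul_mem (pow_mem hζm k) hαm
  rwa [htop] at key

lemma exists_sq_eq_two_of_isPrimitiveRoot {F : Type*} [Field F] [CharZero F] {ζ : F}
    (hζ : IsPrimitiveRoot ζ 8) : (ζ + ζ⁻¹) ^ 2 = 2 := by
  have h0 : ζ ≠ 0 := hζ.ne_zero (by norm_num)
  have h1 : ζ ^ 4 = -1 := by
    have h2 : (ζ ^ 4 - 1) * (ζ ^ 4 + 1) = 0 := by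
      have := hζ.pow_eq_one
      ring_nf
      rw [this]
      ring
    rcases mul_eq_zero.1 h2 with h3 | h3
    · exact absurd (sub_eq_zero.1 h3) (hζ.pow_ne_one_of_pos_of_lt (by norm_num) (by norm_num))
    · exact eq_neg_of_add_eq_zero_left h3
  field_simp
  ring_nf
  rw [h1]
  ring

lemma natDegree_minpoly_kummer {K : Type*} [Field K] [NumberField K] {p m i s : ℕ} {ζ α : K}
    (hp : p.Prime) (hm : 1 ≤ m) (hi : 2 ^ i ∣ m) (hζ : IsPrimitiveRoot ζ m) (hα : α ^ 2 ^ i = p)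
    (h : (s = i ∧ (i = 0 ∨ (p ≠ 2 ∧ ¬ p ∣ m))) ∨ (p = 2 ∧ 8 ∣ m ∧ s + 1 = i)) :
    (minpoly ℚ⟮ζ⟯ α).natDegree = 2 ^ s := by
  have hα0 : α ≠ 0 := by
    rintro rfl
    rw [zero_pow (by positivity)] at hα
    exact hp.ne_zero (by exact_mod_cast hα.symm)
  set Z : ℚ⟮ζ⟯ := ⟨ζ, mem_adjoin_simple_self ℚ ζ⟩ with hZ
  have hZp : IsPrimitiveRoot Z m := IsPrimitiveRoot.of_map_of_injective (f := algebraMap ℚ⟮ζ⟯ K) hζ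
    (algebraMap ℚ⟮ζ⟯ K).injective
  have hroot : ∀ t, t ∣ m → IsPrimitiveRoot (Z ^ (m / t)) t := fun t ht =>
    hZp.pow (by omega) (Nat.div_mul_cancel ht).symm
  rcases h with ⟨rfl, h⟩ | ⟨rfl, h8, rfl⟩
  · refine natDegree_minpoly_eq_two_pow (hroot _ hi) le_rfl hα0 ⟨(p : ℚ⟮ζ⟯), by simp [hα]⟩ ?_
    rintro hs ⟨z, hz⟩
    obtain ⟨hp2, hpm⟩ := h.resolve_left hs
    refine sq_ne_prime_of_mem_adjoin hm hζ hp hp2 hpm z.2 ?_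
    have : (z : K) = α ^ 2 ^ (s - 1) := hz
    rw [this, ← pow_mul, ← pow_succ, Nat.sub_add_cancel (Nat.pos_of_ne_zero hs), hα]
  · have h2 := exists_sq_eq_two_of_isPrimitiveRoot (hroot 8 h8)
    set w := Z ^ (m / 8) + (Z ^ (m / 8))⁻¹
    refine natDegree_minpoly_eq_two_pow (hroot _ hi) (Nat.le_succ s) hα0 ?_ ?_
    · have h3 : (α ^ 2 ^ s) ^ 2 = (algebraMap ℚ⟮ζ⟯ K w) ^ 2 := by
        rw [← map_pow, h2, ← pow_mul, ← pow_succ, hα, map_ofNat]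
        norm_num
      rcases sq_eq_sq_iff_eq_or_eq_neg.1 h3 with h4 | h4
      · exact ⟨w, h4.symm⟩
      · exact ⟨-w, by rw [map_neg, h4]⟩
    · rintro hs ⟨z, hz⟩
      refine pow_four_ne_two_of_mem_adjoin hm hζ z.2 ?_
      have : (z : K) = α ^ 2 ^ (s - 1) := hz
      rw [this, ← pow_mul]
      have : 2 ^ (s - 1) * 4 = 2 ^ (s + 1) := by
        rw [show (4 : ℕ) = 2 ^ 2 by norm_num, ← pow_add]
        congr 1
        omega
      rw [this, hα]
      norm_num

open NumberField in
theorem abs_recipSum_residueCond_sub_totient_le {p m i s : ℕ} (hp : p.Prime) (hm : 1 ≤ m)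
    (hi : 2 ^ i ∣ m) (hc : m.primeFactors.card ≤ 2)
    (h : (s = i ∧ (i = 0 ∨ (p ≠ 2 ∧ ¬ p ∣ m))) ∨ (p = 2 ∧ 8 ∣ m ∧ s + 1 = i)) (x : ℕ) :
    |recipSum (ResidueCond p m (2 ^ i)) x - logI 2 x / (m.totient * 2 ^ s : ℕ)| ≤
      20000 * (1 + Real.log (m.totient * 2 ^ s * p : ℕ) + Real.log (logI 2 x)) := by
  obtain ⟨K, _, _, _, ζ, α, hζ, hα, htop⟩ := exists_kummer_field hp.one_lt.le hm hi
  have hrank := finrank_eq_totient_mul_natDegree hm hζ htop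
  rw [natDegree_minpoly_kummer hp hm hi hζ hα h] at hrank
  have hζi : IsIntegral ℤ ζ := hζ.isIntegral (by omega)
  have hαi : IsIntegral ℤ α := by
    refine IsIntegral.of_pow (by positivity : 0 < 2 ^ i) ?_
    rw [hα]
    simpa using isIntegral_algebraMap (R := ℤ) (A := K) (x := (p : ℤ))
  obtain ⟨ζ, rfl⟩ : ∃ z : 𝓞 K, (z : K) = ζ := ⟨⟨ζ, hζi⟩, rfl⟩
  obtain ⟨α, rfl⟩ : ∃ z : 𝓞 K, (z : K) = α := ⟨⟨α, hαi⟩, rfl⟩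
  have key := abs_recipSum_residueCond_sub_le (K := K) (ζ := ζ) (α := α) hp hm hi hc
    (IsPrimitiveRoot.of_map_of_injective (f := algebraMap (𝓞 K) K) hζ
      RingOfIntegers.coe_injective) (RingOfIntegers.ext (by simpa using hα)) htop x
  rwa [hrank] at key

end Degree

section Slices

/-- The exponent `k` with `R_p = R_{p,k}`. -/
def sliceExp (p : ℕ) : ℕ := if p = 2 then 2 else 1

lemma one_le_sliceExp (p : ℕ) : 1 ≤ sliceExp p := by
  unfold sliceExp; split_ifs <;> norm_num

lemma memRp_iff {p r : ℕ} : memRp p r ↔ r.Prime ∧ Odd r ∧ r ≠ p ∧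
    padicValNat 2 (orderOf (p : ZMod r)) = sliceExp p := by
  unfold memRp memR sliceExp
  split_ifs with h
  · subst h; norm_num
  · rfl

lemma dvd_div_two_pow_iff {o n j : ℕ} (hn : n ≠ 0) (ho : o ∣ n) (hj : j ≤ padicValNat 2 n) :
    o ∣ n / 2 ^ j ↔ padicValNat 2 o + j ≤ padicValNat 2 n := by
  have : Fact (Nat.Prime 2) := ⟨Nat.prime_two⟩
  have ho0 : o ≠ 0 := ne_zero_of_dvd_ne_zero hn ho
  have hjn : 2 ^ j ∣ n := (padicValNat_dvd_iff_le hn).2 hj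
  obtain ⟨w, rfl⟩ := hjn
  have hw : w ≠ 0 := by rintro rfl; simp at hn
  rw [Nat.mul_div_cancel_left _ (by positivity), padicValNat.mul (by positivity) hw,
    padicValNat.prime_pow, add_comm j, Nat.add_le_add_iff_right]
  constructor
  · intro h
    obtain ⟨c, rfl⟩ := h
    rw [padicValNat.mul ho0 (by rintro rfl; simp at hw)]
    omega
  · intro h
    obtain ⟨a, b, hb, rfl⟩ := Nat.exists_eq_two_pow_mul_odd ho0
    have hb0 : b ≠ 0 := by rintro rfl; simp at ho0
    have hb2 : padicValNat 2 b = 0 := padicValNat.eq_zero_of_not_dvd hb.not_two_dvd_nat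
    rw [padicValNat.mul (by positivity) hb0, padicValNat.prime_pow, hb2, add_zero] at h
    have hcop : Nat.Coprime b 2 := Nat.coprime_two_right.2 hb
    refine Nat.Coprime.mul_dvd_of_dvd_of_dvd (Nat.Coprime.pow_left _ hcop.symm)
      ((padicValNat_dvd_iff_le hw).2 h) ?_
    exact (Nat.Coprime.pow_right j hcop).dvd_of_dvd_mul_left ((dvd_mul_left _ _).trans ho)

lemma padicValNat_orderOf_eq_iff {p r k : ℕ} (hr : r.Prime) (hp : p.Prime) (hrp : r ≠ p)
    (hk : 1 ≤ k) (hkv : k ≤ padicValNat 2 (r - 1)) :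
    padicValNat 2 (orderOf (p : ZMod r)) = k ↔
      (p : ZMod r) ^ ((r - 1) / 2 ^ (padicValNat 2 (r - 1) - k)) = 1 ∧
      (p : ZMod r) ^ ((r - 1) / 2 ^ (padicValNat 2 (r - 1) - k + 1)) ≠ 1 := by
  have : Fact r.Prime := ⟨hr⟩
  have hn : r - 1 ≠ 0 := by have := hr.two_le; omega
  have hp0 : (p : ZMod r) ≠ 0 := by
    rw [Ne, ZMod.natCast_eq_zero_iff, Nat.prime_dvd_prime_iff_eq hr hp]
    exact hrp
  have ho : orderOf (p : ZMod r) ∣ r - 1 := orderOf_dvd_of_pow_eq_one (ZMod.pow_card_sub_one_eq_one hp0)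
  rw [Ne, ← orderOf_dvd_iff_pow_eq_one, ← orderOf_dvd_iff_pow_eq_one,
    dvd_div_two_pow_iff hn ho (by omega), dvd_div_two_pow_iff hn ho (by omega)]
  omega

/-- Membership in `R_p` together with the residue conditions `q ∣ r - 1` and `v₂(r - 1) = v`. -/
def InSlice (p q v r : ℕ) : Prop := memRp p r ∧ q ∣ r - 1 ∧ padicValNat 2 (r - 1) = v

lemma inSlice_iff {p q t r : ℕ} (hp : p.Prime) (hr : r.Prime) (hq : Odd q) :
    InSlice p q (sliceExp p + t) r ↔ 2 ^ (sliceExp p + t) * q ∣ r - 1 ∧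
      ¬ 2 ^ (sliceExp p + t + 1) * q ∣ r - 1 ∧
      (p : ZMod r) ^ ((r - 1) / 2 ^ t) = 1 ∧ (p : ZMod r) ^ ((r - 1) / 2 ^ (t + 1)) ≠ 1 := by
  have hf : Fact (Nat.Prime 2) := ⟨Nat.prime_two⟩
  have hrf : Fact r.Prime := ⟨hr⟩
  have hn : r - 1 ≠ 0 := by have := hr.two_le; omega
  have hk := one_le_sliceExp p
  have hmul : ∀ w, 2 ^ w * q ∣ r - 1 ↔ w ≤ padicValNat 2 (r - 1) ∧ q ∣ r - 1 := by
    intro w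
    rw [← padicValNat_dvd_iff_le hn]
    exact ⟨fun h => ⟨(dvd_mul_right _ _).trans h, (dvd_mul_left _ _).trans h⟩, fun h =>
      Nat.Coprime.mul_dvd_of_dvd_of_dvd (Nat.Coprime.pow_left _ (Nat.coprime_two_left.2 hq)) h.1 h.2⟩
  rw [hmul, hmul]
  unfold InSlice
  rw [memRp_iff]
  constructor
  · rintro ⟨⟨-, -, hrp, h1⟩, h2, h3⟩
    rw [padicValNat_orderOf_eq_iff hr hp hrp hk (by omega), h3, Nat.add_sub_cancel_left] at h1
    exact ⟨⟨h3.ge, h2⟩, fun h => by omega, h1⟩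
  · rintro ⟨⟨h1, h2⟩, h3, h4, h5⟩
    have hv : padicValNat 2 (r - 1) = sliceExp p + t := by
      by_contra hne
      exact h3 ⟨by omega, h2⟩
    have hrp : r ≠ p := by
      rintro rfl
      have h6 : 2 ^ t ∣ r - 1 := (padicValNat_dvd_iff_le hn).2 (by omega)
      have h7 : (r - 1) / 2 ^ t ≠ 0 := (Nat.div_pos (Nat.le_of_dvd (by omega) h6) (by positivity)).ne'
      rw [CharP.cast_eq_zero, zero_pow h7] at h4
      exact zero_ne_one h4
    refine ⟨⟨hr, ?_, hrp, ?_⟩, h2, hv⟩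
    · refine hr.odd_of_ne_two ?_
      rintro rfl
      simp at hv
      omega
    · rw [padicValNat_orderOf_eq_iff hr hp hrp hk (by omega), hv, Nat.add_sub_cancel_left]
      exact ⟨h4, h5⟩

lemma recipSum_eq_sum_ite (S : ℕ → Prop) (x : ℕ) :
    recipSum S x = ∑ r ∈ (Finset.Icc 1 x).filter Nat.Prime, (if S r then 1 else 0) * (1 / (r : ℝ)) := by
  unfold recipSum
  rw [← Finset.filter_filter, Finset.sum_filter]
  refine Finset.sum_congr rfl fun r _ => ?_
  split_ifs <;> simp

lemma recipSum_inSlice {p q t x : ℕ} (hp : p.Prime) (hq : Odd q) :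
    recipSum (InSlice p q (sliceExp p + t)) x =
      recipSum (ResidueCond p (2 ^ (sliceExp p + t) * q) (2 ^ t)) x -
      recipSum (ResidueCond p (2 ^ (sliceExp p + t) * q) (2 ^ (t + 1))) x -
      recipSum (ResidueCond p (2 ^ (sliceExp p + t + 1) * q) (2 ^ t)) x +
      recipSum (ResidueCond p (2 ^ (sliceExp p + t + 1) * q) (2 ^ (t + 1))) x := by
  simp only [recipSum_eq_sum_ite, ← Finset.sum_sub_distrib, ← Finset.sum_add_distrib, ← sub_mul,
    ← add_mul]
  refine Finset.sum_congr rfl fun r hr => ?_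
  have hr := (Finset.mem_filter.1 hr).2
  congr 1
  have h1 := inSlice_iff (t := t) hp hr hq
  have h2 : 2 ^ (sliceExp p + t + 1) * q ∣ r - 1 → 2 ^ (sliceExp p + t) * q ∣ r - 1 :=
    fun h => (Nat.mul_dvd_mul_right (pow_dvd_pow 2 (Nat.le_succ _)) q).trans h
  have h3 : 2 ^ (sliceExp p + t) * q ∣ r - 1 → (p : ZMod r) ^ ((r - 1) / 2 ^ (t + 1)) = 1 →
      (p : ZMod r) ^ ((r - 1) / 2 ^ t) = 1 := by
    intro h h4
    have h5 : 2 ^ (t + 1) ∣ r - 1 := (pow_dvd_pow 2 (by have := one_le_sliceExp p; omega)).trans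
      ((dvd_mul_right _ _).trans h)
    have h6 : (r - 1) / 2 ^ t = (r - 1) / 2 ^ (t + 1) * 2 := by
      obtain ⟨c, hc⟩ := h5
      rw [hc, Nat.mul_div_cancel_left _ (by positivity), pow_succ, mul_assoc,
        Nat.mul_div_cancel_left _ (by positivity), mul_comm]
    rw [h6, pow_mul, h4, one_pow]
  unfold ResidueCond
  rw [h1]
  by_cases hD : 2 ^ (sliceExp p + t) * q ∣ r - 1 <;>
    by_cases hD' : 2 ^ (sliceExp p + t + 1) * q ∣ r - 1 <;>
    by_cases hP : (p : ZMod r) ^ ((r - 1) / 2 ^ t) = 1 <;>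
    by_cases hP' : (p : ZMod r) ^ ((r - 1) / 2 ^ (t + 1)) = 1 <;> simp_all

lemma recipSum_inSlice_two {q x : ℕ} (hq : Odd q) :
    recipSum (InSlice 2 q 2) x = recipSum (ResidueCond 2 (4 * q) 1) x -
      recipSum (ResidueCond 2 (8 * q) 1) x := by
  simp only [recipSum_eq_sum_ite, ← Finset.sum_sub_distrib, ← sub_mul]
  refine Finset.sum_congr rfl fun r hr => ?_
  have hr := (Finset.mem_filter.1 hr).2
  congr 1
  have h1 := inSlice_iff (p := 2) (t := 0) Nat.prime_two hr hq
  have hf : Fact r.Prime := ⟨hr⟩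
  have h2 : 8 * q ∣ r - 1 → 4 * q ∣ r - 1 :=
    fun h => (Nat.mul_dvd_mul_right (by norm_num) q).trans h
  have h3 : 4 * q ∣ r - 1 → (((2 : ℕ) : ZMod r) ^ (r - 1) = 1) := by
    intro h
    refine ZMod.pow_card_sub_one_eq_one ?_
    rw [Ne, ZMod.natCast_eq_zero_iff, Nat.prime_dvd_prime_iff_eq hr Nat.prime_two]
    rintro rfl
    have := Nat.le_of_dvd (by norm_num) ((dvd_mul_right _ _).trans h)
    omega
  have h4 : 4 * q ∣ r - 1 → ¬ 8 * q ∣ r - 1 → ((2 : ℕ) : ZMod r) ^ ((r - 1) / 2) ≠ 1 := by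
    intro h h5 h6
    have h7 : 4 ∣ r - 1 := (dvd_mul_right _ _).trans h
    have h8 := hr.two_le
    have h9 : (2 : ZMod r) ≠ 0 := by
      intro h0
      have : ((2 : ℕ) : ZMod r) = 0 := by exact_mod_cast h0
      rw [ZMod.natCast_eq_zero_iff, Nat.prime_dvd_prime_iff_eq hr Nat.prime_two] at this
      omega
    have h10 : r / 2 = (r - 1) / 2 := by omega
    have h11 : IsSquare (2 : ZMod r) := by
      rw [ZMod.euler_criterion r h9, h10]
      exact_mod_cast h6
    rw [ZMod.exists_sq_eq_two_iff (by omega)] at h11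
    refine h5 (Nat.Coprime.mul_dvd_of_dvd_of_dvd ?_ (by omega) ((dvd_mul_left _ _).trans h))
    exact Nat.Coprime.pow_left 3 (Nat.coprime_two_left.2 hq)
  simp only [sliceExp, if_true] at h1
  norm_num at h1
  unfold ResidueCond
  rw [h1]
  simp only [Nat.div_one]
  norm_num at h3 h4
  by_cases hD : 4 * q ∣ r - 1 <;> by_cases hD' : 8 * q ∣ r - 1 <;> simp_all

lemma card_primeFactors_two_pow_mul_le {w q : ℕ} (hq : q.Prime) :
    (2 ^ w * q).primeFactors.card ≤ 2 := by
  have h : (2 ^ w * q).primeFactors ⊆ {2, q} := by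
    intro r hr
    have h1 := Nat.prime_of_mem_primeFactors hr
    have h2 := Nat.dvd_of_mem_primeFactors hr
    rcases h1.dvd_mul.1 h2 with h3 | h3
    · simp [(Nat.prime_dvd_prime_iff_eq h1 Nat.prime_two).1 (h1.dvd_of_dvd_pow h3)]
    · simp [(Nat.prime_dvd_prime_iff_eq h1 hq).1 h3]
  exact (Finset.card_le_card h).trans Finset.card_le_two

lemma abs_recipSum_residueCond_two_pow_mul_sub_le {p q w i s j J : ℕ} (hp : p.Prime) (hq : q.Prime)
    (hq2 : q ≠ 2) (hqp : q ≠ p) (hw : 1 ≤ w) (hi : i ≤ w)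
    (h : (s = i ∧ (i = 0 ∨ p ≠ 2)) ∨ (p = 2 ∧ 3 ≤ w ∧ s + 1 = i)) (hj : w - 1 + s = j)
    (hJ : j ≤ J) (x : ℕ) :
    |recipSum (ResidueCond p (2 ^ w * q) (2 ^ i)) x - logI 2 x / (2 ^ j * (q - 1))| ≤
      20000 * (1 + Real.log (2 ^ J * q * p) + Real.log (logI 2 x)) := by
  have hcop : Nat.Coprime (2 ^ w) q :=
    Nat.Coprime.pow_left _ ((Nat.coprime_primes Nat.prime_two hq).2 (Ne.symm hq2))
  have hm : 1 ≤ 2 ^ w * q := Nat.mul_pos (by positivity) hq.pos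
  have hiw : 2 ^ i ∣ 2 ^ w * q := (pow_dvd_pow 2 hi).trans (dvd_mul_right _ _)
  have hcond : (s = i ∧ (i = 0 ∨ (p ≠ 2 ∧ ¬ p ∣ 2 ^ w * q))) ∨
      (p = 2 ∧ 8 ∣ 2 ^ w * q ∧ s + 1 = i) := by
    rcases h with ⟨h1, h2⟩ | ⟨h1, h2, h3⟩
    · refine Or.inl ⟨h1, h2.imp_right fun h3 => ⟨h3, fun h4 => ?_⟩⟩
      rcases hp.dvd_mul.1 h4 with h5 | h5
      · exact h3 ((Nat.prime_dvd_prime_iff_eq hp Nat.prime_two).1 (hp.dvd_of_dvd_pow h5))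
      · exact hqp ((Nat.prime_dvd_prime_iff_eq hp hq).1 h5).symm
    · exact Or.inr ⟨h1, (pow_dvd_pow 2 h2).trans (dvd_mul_right _ _), h3⟩
  have key := abs_recipSum_residueCond_sub_totient_le hp hm hiw
    (card_primeFactors_two_pow_mul_le hq) hcond x
  have htot : (2 ^ w * q).totient * 2 ^ s = 2 ^ j * (q - 1) := by
    rw [Nat.totient_mul hcop, Nat.totient_prime hq, Nat.totient_prime_pow Nat.prime_two (by omega),
      ← hj, pow_add]
    ring
  have hcast : (((2 ^ w * q).totient * 2 ^ s : ℕ) : ℝ) = 2 ^ j * (q - 1) := by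
    rw [htot]
    push_cast [Nat.cast_sub hq.one_lt.le]
    ring
  rw [hcast] at key
  refine key.trans ?_
  have hq1 : (1 : ℝ) < q := by exact_mod_cast hq.one_lt
  have hp1 : (1 : ℝ) < p := by exact_mod_cast hp.one_lt
  have hlog : Real.log (((2 ^ w * q).totient * 2 ^ s * p : ℕ) : ℝ) ≤ Real.log (2 ^ J * q * p) := by
    rw [Nat.cast_mul, hcast]
    refine Real.log_le_log (by have := sub_pos.2 hq1; positivity) ?_
    have : (2 : ℝ) ^ j ≤ 2 ^ J := pow_le_pow_right₀ (by norm_num) hJ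
    gcongr
    linarith
  linarith

lemma abs_recipSum_inSlice_sub_le {p q : ℕ} (hp : p.Prime) (hq : q.Prime) (hq2 : q ≠ 2)
    (hqp : q ≠ p) (t x : ℕ) :
    |recipSum (InSlice p q (sliceExp p + t)) x - logI 2 x / (2 ^ (2 * t + 2) * (q - 1))| ≤
      80000 * (1 + Real.log (2 ^ (2 * t + 2) * q * p) + Real.log (logI 2 x)) := by
  have hodd := hq.odd_of_ne_two hq2
  have hq1 : (0 : ℝ) < q - 1 := sub_pos.2 (by exact_mod_cast hq.one_lt)
  by_cases h2 : p = 2 ∧ t = 0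
  · obtain ⟨rfl, rfl⟩ := h2
    have e1 := abs_recipSum_residueCond_two_pow_mul_sub_le (w := 2) (i := 0) (s := 0) (j := 1)
      (J := 2) hp hq hq2 hqp (by norm_num) (by norm_num) (by simp) rfl (by norm_num) x
    have e2 := abs_recipSum_residueCond_two_pow_mul_sub_le (w := 3) (i := 0) (s := 0) (j := 2)
      (J := 2) hp hq hq2 hqp (by norm_num) (by norm_num) (by simp) rfl le_rfl x
    have hs : InSlice 2 q (sliceExp 2 + 0) = InSlice 2 q 2 := by simp [sliceExp]
    rw [hs, recipSum_inSlice_two hodd]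
    norm_num at e1 e2 ⊢
    have hid : logI 2 x / (2 * ((q : ℝ) - 1)) - logI 2 x / (4 * (q - 1)) =
        logI 2 x / (4 * (q - 1)) := by field_simp; ring
    rw [abs_le] at e1 e2 ⊢
    constructor <;> linarith [e1.1, e1.2, e2.1, e2.2]
  · have hk := one_le_sliceExp p
    obtain ⟨s, hs1, hs2⟩ : ∃ s, sliceExp p + t - 1 + s = 2 * t ∧
        ((s = t ∧ (t = 0 ∨ p ≠ 2)) ∨ (p = 2 ∧ 3 ≤ sliceExp p + t ∧ s + 1 = t)) := by
      by_cases hp2 : p = 2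
      · have : t ≠ 0 := fun h => h2 ⟨hp2, h⟩
        have hk2 : sliceExp p = 2 := by simp [sliceExp, hp2]
        exact ⟨t - 1, by omega, Or.inr ⟨hp2, by omega, by omega⟩⟩
      · refine ⟨t, ?_, Or.inl ⟨rfl, Or.inr hp2⟩⟩
        simp only [sliceExp, hp2, if_false]
        omega
    have hs3 : (s + 1 = t + 1 ∧ (t + 1 = 0 ∨ p ≠ 2)) ∨
        (p = 2 ∧ 3 ≤ sliceExp p + t ∧ s + 1 + 1 = t + 1) := by
      rcases hs2 with ⟨h3, h4⟩ | ⟨h3, h4, h5⟩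
      · by_cases hp2 : p = 2
        · exact absurd ⟨hp2, h4.resolve_right (by simp [hp2])⟩ h2
        · exact Or.inl ⟨by omega, Or.inr hp2⟩
      · exact Or.inr ⟨h3, h4, by omega⟩
    have e1 := abs_recipSum_residueCond_two_pow_mul_sub_le (w := sliceExp p + t) (i := t) (s := s)
      (j := 2 * t) (J := 2 * t + 2) hp hq hq2 hqp (by omega) (by omega) hs2 hs1 (by omega) x
    have e2 := abs_recipSum_residueCond_two_pow_mul_sub_le (w := sliceExp p + t) (i := t + 1)
      (s := s + 1) (j := 2 * t + 1) (J := 2 * t + 2) hp hq hq2 hqp (by omega) (by omega) hs3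
      (by omega) (by omega) x
    have e3 := abs_recipSum_residueCond_two_pow_mul_sub_le (w := sliceExp p + t + 1) (i := t)
      (s := s) (j := 2 * t + 1) (J := 2 * t + 2) hp hq hq2 hqp (by omega) (by omega)
      (hs2.imp_right fun h => ⟨h.1, by omega, h.2.2⟩) (by omega) (by omega) x
    have e4 := abs_recipSum_residueCond_two_pow_mul_sub_le (w := sliceExp p + t + 1) (i := t + 1)
      (s := s + 1) (j := 2 * t + 2) (J := 2 * t + 2) hp hq hq2 hqp (by omega) (by omega)
      (hs3.imp_right fun h => ⟨h.1, by omega, h.2.2⟩) (by omega) le_rfl x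
    rw [recipSum_inSlice hp hodd]
    have hid : logI 2 x / (2 ^ (2 * t) * ((q : ℝ) - 1)) - logI 2 x / (2 ^ (2 * t + 1) * (q - 1)) -
        logI 2 x / (2 ^ (2 * t + 1) * (q - 1)) + logI 2 x / (2 ^ (2 * t + 2) * (q - 1)) =
        logI 2 x / (2 ^ (2 * t + 2) * (q - 1)) := by
      rw [pow_add _ _ 1, pow_add _ _ 2]
      field_simp
      ring
    rw [abs_le] at e1 e2 e3 e4 ⊢
    constructor <;> linarith only [e1.1, e1.2, e2.1, e2.2, e3.1, e3.2, e4.1, e4.2, hid]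

lemma recipSum_eq_add {S T U : ℕ → Prop} {x : ℕ} (h : ∀ r, r.Prime → (S r ↔ T r ∨ U r))
    (hd : ∀ r, r.Prime → T r → ¬ U r) : recipSum S x = recipSum T x + recipSum U x := by
  simp only [recipSum_eq_sum_ite, ← Finset.sum_add_distrib, ← add_mul]
  refine Finset.sum_congr rfl fun r hr => ?_
  have hr := (Finset.mem_filter.1 hr).2
  congr 1
  rw [h r hr]
  have := hd r hr
  by_cases h1 : T r <;> by_cases h2 : U r <;> simp_all

lemma recipSum_memRp_eq_sum (p q x J : ℕ) : recipSum (fun r => memRp p r ∧ q ∣ r - 1) x =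
    ∑ t ∈ Finset.range J, recipSum (InSlice p q (sliceExp p + t)) x +
      recipSum (fun r => (memRp p r ∧ q ∣ r - 1) ∧ sliceExp p + J ≤ padicValNat 2 (r - 1)) x := by
  induction J with
  | zero =>
    rw [Finset.sum_range_zero, zero_add]
    have hle : ∀ r, memRp p r → sliceExp p + 0 ≤ padicValNat 2 (r - 1) := by
      intro r hr
      obtain ⟨h1, h2, h3, h4⟩ := memRp_iff.1 hr
      have hf : Fact r.Prime := ⟨h1⟩
      have hf2 : Fact (Nat.Prime 2) := ⟨Nat.prime_two⟩
      have hn : r - 1 ≠ 0 := by have := h1.two_le; omega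
      have hk := one_le_sliceExp p
      rw [← h4, add_zero, ← padicValNat_dvd_iff_le hn]
      have ho : orderOf (p : ZMod r) ≠ 0 := by
        intro h
        rw [h] at h4
        simp at h4
        omega
      have hp0 : (p : ZMod r) ≠ 0 := by
        intro h
        rw [h] at ho
        exact ho (orderOf_zero (ZMod r))
      exact pow_padicValNat_dvd.trans (orderOf_dvd_of_pow_eq_one (ZMod.pow_card_sub_one_eq_one hp0))
    exact le_antisymm (recipSum_mono fun r _ h => ⟨h, hle r h.1⟩) (recipSum_mono fun r _ h => h.1)
  | succ J ih =>
    rw [ih, Finset.sum_range_succ, add_assoc]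
    congr 1
    refine recipSum_eq_add (fun r _ => ?_) (fun r _ h1 h2 => ?_)
    · unfold InSlice
      constructor
      · rintro ⟨h1, h2⟩
        rcases h2.eq_or_lt with h3 | h3
        · exact Or.inl ⟨h1.1, h1.2, h3.symm⟩
        · exact Or.inr ⟨h1, h3⟩
      · rintro (⟨h1, h2, h3⟩ | ⟨h1, h2⟩)
        · exact ⟨⟨h1, h2⟩, h3.ge⟩
        · exact ⟨h1, by omega⟩
    · have := h1.2.2
      have := h2.2
      omega

lemma sum_one_div_two_pow (J : ℕ) : ∑ t ∈ Finset.range J, 1 / (2 : ℝ) ^ (2 * t + 2) =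
    1 / 3 - 1 / (3 * 2 ^ (2 * J)) := by
  induction J with
  | zero => norm_num
  | succ J ih =>
    rw [Finset.sum_range_succ, ih, show 2 * (J + 1) = 2 * J + 2 by ring, pow_add]
    field_simp
    ring

lemma log_logI_le (ν : ℕ) (x : ℝ) : Real.log (logI ν x) ≤ logI (ν + 1) x := le_max_left _ _

lemma exists_two_pow_le_lt {L : ℝ} (hL : 1 ≤ L) : ∃ J : ℕ, (2 : ℝ) ^ J ≤ L ∧ L < 2 ^ (J + 1) := by
  have h1 : ⌊L⌋₊ ≠ 0 := (Nat.floor_pos.2 hL).ne'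
  refine ⟨Nat.log 2 ⌊L⌋₊, ?_, ?_⟩
  · exact (by exact_mod_cast Nat.pow_log_le_self 2 h1 : ((2 : ℝ) ^ _ ≤ ⌊L⌋₊)).trans
      (Nat.floor_le (by linarith))
  · have h2 : ⌊L⌋₊ + 1 ≤ 2 ^ (Nat.log 2 ⌊L⌋₊ + 1) := Nat.lt_pow_succ_log_self (by norm_num) _
    exact (Nat.lt_floor_add_one L).trans_le (by exact_mod_cast h2)

theorem abs_recipSum_memRp_sub_le {p q : ℕ} (hp : p.Prime) (hq : q.Prime) (hq2 : q ≠ 2)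
    (hqp : q ≠ p) {x : ℕ} (hqx : (q : ℝ) ≤ logI 2 x) :
    |recipSum (fun r => memRp p r ∧ q ∣ r - 1) x - logI 2 x / (3 * (q - 1))| ≤
      80000 * (5 + Real.log p) * (logI 3 x ^ 2 + logI 2 x / (q * logI 3 x)) := by
  set y := logI 2 x with hy
  set L := logI 3 x with hL
  have hy1 : 1 ≤ y := one_le_logI 1 x
  have hL1 : 1 ≤ L := one_le_logI 2 x
  have hlogy : Real.log y ≤ L := log_logI_le 2 x
  obtain ⟨J, hJ1, hJ2⟩ := exists_two_pow_le_lt hL1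
  have hJL : (J : ℝ) ≤ L := by
    have : (J : ℝ) ≤ 2 ^ J := by exact_mod_cast Nat.lt_two_pow_self.le
    linarith
  have hq1 : (2 : ℝ) ≤ q := by exact_mod_cast hq.two_le
  have hp1 : (1 : ℝ) ≤ p := by exact_mod_cast hp.one_lt.le
  have hlp : 0 ≤ Real.log p := Real.log_nonneg hp1
  have htail : recipSum (fun r => (memRp p r ∧ q ∣ r - 1) ∧
      sliceExp p + J ≤ padicValNat 2 (r - 1)) x ≤ 1800 * (y / (q * L)) := by
    have h1 : recipSum (fun r => (memRp p r ∧ q ∣ r - 1) ∧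
        sliceExp p + J ≤ padicValNat 2 (r - 1)) x ≤
        recipSum (fun r => 2 ^ (J + 1) * q ∣ r - 1) x := by
      refine recipSum_mono fun r hr h => ?_
      have hf2 : Fact (Nat.Prime 2) := ⟨Nat.prime_two⟩
      have hn : r - 1 ≠ 0 := by have := hr.two_le; omega
      refine Nat.Coprime.mul_dvd_of_dvd_of_dvd (Nat.Coprime.pow_left _
        ((Nat.coprime_primes Nat.prime_two hq).2 (Ne.symm hq2))) ?_ h.1.2
      rw [padicValNat_dvd_iff_le hn]
      have := one_le_sliceExp p
      omega
    refine h1.trans ((recipSum_dvd_sub_one_le _ x (Nat.mul_pos (by positivity) hq.pos)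
      (card_primeFactors_two_pow_mul_le hq)).trans ?_)
    push_cast
    rw [← mul_div_assoc, ← hy, mul_comm ((2 : ℝ) ^ (J + 1)) (q : ℝ)]
    gcongr
  have hslice : ∀ t ∈ Finset.range J, |recipSum (InSlice p q (sliceExp p + t)) x -
      y / (2 ^ (2 * t + 2) * (q - 1))| ≤ 80000 * (5 + Real.log p) * L := by
    intro t ht
    have ht' := Finset.mem_range.1 ht
    refine (abs_recipSum_inSlice_sub_le hp hq hq2 hqp t x).trans ?_
    have h2 : Real.log (2 ^ (2 * t + 2) * q * p) ≤ 2 * L + L + Real.log p := by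
      have h3 : (2 : ℝ) ^ (2 * t + 2) ≤ L ^ 2 := by
        calc (2 : ℝ) ^ (2 * t + 2) ≤ 2 ^ (J * 2) := pow_le_pow_right₀ (by norm_num) (by omega)
          _ = (2 ^ J) ^ 2 := pow_mul _ _ _
          _ ≤ L ^ 2 := by gcongr
      calc Real.log (2 ^ (2 * t + 2) * q * p) ≤ Real.log (L ^ 2 * y * p) := by
            apply Real.log_le_log (by positivity)
            gcongr
        _ = 2 * Real.log L + Real.log y + Real.log p := by
            rw [Real.log_mul (by positivity) (by positivity), Real.log_mul (by positivity)
              (by positivity), Real.log_pow]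
            norm_num
        _ ≤ 2 * L + L + Real.log p := by
            have := Real.log_le_self (by linarith : 0 ≤ L)
            linarith
    have h4 : Real.log p ≤ Real.log p * L := le_mul_of_one_le_right hlp hL1
    rw [← hy]
    linarith
  have hmain : |∑ t ∈ Finset.range J, y / (2 ^ (2 * t + 2) * ((q : ℝ) - 1)) - y / (3 * (q - 1))| ≤
      4 * (y / (q * L)) := by
    have hQ : (0 : ℝ) < q - 1 := by linarith
    have h1 : ∑ t ∈ Finset.range J, y / (2 ^ (2 * t + 2) * ((q : ℝ) - 1)) - y / (3 * (q - 1)) =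
        -(y / (3 * 2 ^ (2 * J) * (q - 1))) := by
      have : ∀ t ∈ Finset.range J, y / (2 ^ (2 * t + 2) * ((q : ℝ) - 1)) =
          1 / 2 ^ (2 * t + 2) * (y / (q - 1)) := fun t _ => by field_simp
      rw [Finset.sum_congr rfl this, ← Finset.sum_mul, sum_one_div_two_pow]
      field_simp
      ring
    rw [h1, abs_neg, abs_of_nonneg (by positivity), ← mul_div_assoc, div_le_div_iff₀ (by positivity)
      (by positivity)]
    have h2 : L ≤ 2 * 2 ^ (2 * J) := by
      have : (2 : ℝ) ^ J ≤ 2 ^ (2 * J) := pow_le_pow_right₀ (by norm_num) (by omega)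
      rw [pow_succ] at hJ2
      linarith
    have h3 : (q : ℝ) * L ≤ (2 * (q - 1)) * (2 * 2 ^ (2 * J)) := by
      gcongr
      linarith
    nlinarith [mul_le_mul_of_nonneg_left h3 (by linarith : (0 : ℝ) ≤ y),
      (by positivity : 0 ≤ y * 2 ^ (2 * J) * ((q : ℝ) - 1))]
  have hsum : |∑ t ∈ Finset.range J, recipSum (InSlice p q (sliceExp p + t)) x -
      ∑ t ∈ Finset.range J, y / (2 ^ (2 * t + 2) * ((q : ℝ) - 1))| ≤
      80000 * (5 + Real.log p) * L ^ 2 := by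
    rw [← Finset.sum_sub_distrib]
    refine (Finset.abs_sum_le_sum_abs _ _).trans ((Finset.sum_le_card_nsmul _ _ _ hslice).trans ?_)
    rw [Finset.card_range, nsmul_eq_mul, sq]
    have : 0 ≤ 80000 * (5 + Real.log p) * L := by positivity
    nlinarith
  have hnn : 0 ≤ recipSum (fun r => (memRp p r ∧ q ∣ r - 1) ∧
      sliceExp p + J ≤ padicValNat 2 (r - 1)) x := recipSum_nonneg _ _
  rw [recipSum_memRp_eq_sum p q x J]
  have hyq : 0 ≤ y / (q * L) := by positivity
  have hyq2 : 0 ≤ Real.log p * (y / (q * L)) := mul_nonneg hlp hyq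
  rw [abs_le] at hsum hmain ⊢
  constructor <;> linarith only [hsum.1, hsum.2, hmain.1, hmain.2, hnn, htail, hyq, hyq2]

end Slices

section Mertens

lemma theta_eq_sum_Icc_one (N : ℕ) :
    Chebyshev.theta N = ∑ q ∈ (Finset.Icc 1 N).filter Nat.Prime, Real.log q := by
  rw [Chebyshev.theta_eq_sum_Icc, Nat.floor_natCast]
  refine Finset.sum_congr (Finset.ext fun q => ?_) fun _ _ => rfl
  simp only [Finset.mem_filter, Finset.mem_Icc]
  exact ⟨fun h => ⟨⟨h.2.one_lt.le, h.1.2⟩, h.2⟩, fun h => ⟨⟨Nat.zero_le _, h.1.2⟩, h.2⟩⟩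

lemma log_four_lt : Real.log 4 < 1.4 := by
  have : Real.log 4 = 2 * Real.log 2 := by
    rw [show (4 : ℝ) = 2 ^ 2 by norm_num, Real.log_pow]; norm_num
  have := Real.log_two_lt_d9
  linarith

lemma sum_log_prime_le (N : ℕ) :
    ∑ q ∈ (Finset.Icc 1 N).filter Nat.Prime, Real.log q ≤ 1.4 * N := by
  rw [← theta_eq_sum_Icc_one]
  refine (Chebyshev.theta_le_log4_mul_x (Nat.cast_nonneg N)).trans ?_
  have := log_four_lt
  gcongr

lemma log_factorial_eq_sum (N : ℕ) : Real.log (N.factorial) =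
    ∑ q ∈ (Finset.Icc 1 N).filter Nat.Prime, (N.factorial.factorization q : ℝ) * Real.log q := by
  rw [Real.log_nat_eq_sum_factorization, Finsupp.sum]
  apply Finset.sum_subset
  · intro q hq
    rw [Nat.support_factorization, Nat.mem_primeFactors] at hq
    exact Finset.mem_filter.2 ⟨Finset.mem_Icc.2 ⟨hq.1.one_lt.le, (hq.1.dvd_factorial).1 hq.2.1⟩, hq.1⟩
  · intro q _ hq
    rw [Finsupp.notMem_support_iff.1 hq]
    simp

lemma sub_one_mul_factorization_factorial_le {q : ℕ} (hq : q.Prime) (N : ℕ) :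
    ((q : ℝ) - 1) * N.factorial.factorization q ≤ N := by
  have : Fact q.Prime := ⟨hq⟩
  have h := sub_one_mul_padicValNat_factorial (p := q) N
  rw [Nat.factorization_def _ hq]
  have h2 : (q - 1) * padicValNat q N.factorial ≤ N := by omega
  have h3 : (((q - 1) * padicValNat q N.factorial : ℕ) : ℝ) ≤ N := by exact_mod_cast h2
  rwa [Nat.cast_mul, Nat.cast_sub hq.one_lt.le, Nat.cast_one] at h3

lemma div_le_factorization_factorial {q : ℕ} (hq : q.Prime) (N : ℕ) :
    (N : ℝ) / q - 1 ≤ N.factorial.factorization q := by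
  have h : N / q ≤ N.factorial.factorization q := by
    rcases Nat.eq_zero_or_pos (N / q) with h0 | h0
    · omega
    rw [Nat.factorization_factorial hq (Nat.lt_succ_self _)]
    have h1 : 1 ∈ Finset.Ico 1 (Nat.log q N + 1) := by
      have : q ≤ N := by
        by_contra hh
        rw [Nat.div_eq_of_lt (by omega)] at h0
        omega
      have := Nat.log_pos hq.one_lt this
      exact Finset.mem_Ico.2 ⟨le_rfl, by omega⟩
    calc N / q = N / q ^ 1 := by rw [pow_one]
      _ ≤ _ := Finset.single_le_sum (f := fun i => N / q ^ i) (fun _ _ => Nat.zero_le _) h1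
  have h2 := Nat.lt_floor_add_one ((N : ℝ) / q)
  rw [Nat.floor_div_natCast, Nat.floor_natCast] at h2
  have h3 : ((N / q : ℕ) : ℝ) ≤ N.factorial.factorization q := by exact_mod_cast h
  linarith

/-- Upper half of Mertens' first theorem. -/
lemma sum_log_div_le (N : ℕ) :
    ∑ q ∈ (Finset.Icc 1 N).filter Nat.Prime, Real.log q / q ≤ Real.log N + 1.4 := by
  rcases Nat.eq_zero_or_pos N with rfl | hN
  · norm_num
  have hN' : (0 : ℝ) < N := by exact_mod_cast hN
  have h1 : Real.log (N.factorial) ≤ N * Real.log N := by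
    rw [← Real.log_pow]
    exact Real.log_le_log (by exact_mod_cast N.factorial_pos) (by exact_mod_cast N.factorial_le_pow)
  have h2 : N * ∑ q ∈ (Finset.Icc 1 N).filter Nat.Prime, Real.log q / q -
      ∑ q ∈ (Finset.Icc 1 N).filter Nat.Prime, Real.log q ≤ Real.log (N.factorial) := by
    rw [log_factorial_eq_sum, Finset.mul_sum, ← Finset.sum_sub_distrib]
    refine Finset.sum_le_sum fun q hq => ?_
    have hq' := (Finset.mem_filter.1 hq).2
    have := mul_le_mul_of_nonneg_right (div_le_factorization_factorial hq' N)
      (Real.log_nonneg (by exact_mod_cast hq'.one_lt.le : (1 : ℝ) ≤ q))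
    calc _ = ((N : ℝ) / q - 1) * Real.log q := by ring
      _ ≤ _ := this
  have h3 := sum_log_prime_le N
  have h4 : N * ∑ q ∈ (Finset.Icc 1 N).filter Nat.Prime, Real.log q / q ≤
      N * (Real.log N + 1.4) := by linarith
  exact le_of_mul_le_mul_left h4 hN'

lemma log_sub_one_le_sum (N : ℕ) :
    Real.log N - 1 ≤ ∑ q ∈ (Finset.Icc 1 N).filter Nat.Prime, Real.log q / (q - 1) := by
  rcases Nat.eq_zero_or_pos N with rfl | hN
  · norm_num
  have hN' : (0 : ℝ) < N := by exact_mod_cast hN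
  have h1 := Stirling.le_log_factorial_stirling hN.ne'
  have h2 : Real.log (N.factorial) ≤
      N * ∑ q ∈ (Finset.Icc 1 N).filter Nat.Prime, Real.log q / (q - 1) := by
    rw [log_factorial_eq_sum, Finset.mul_sum]
    refine Finset.sum_le_sum fun q hq => ?_
    have hq' := (Finset.mem_filter.1 hq).2
    have hq1 : (1 : ℝ) < q := by exact_mod_cast hq'.one_lt
    have hl : 0 ≤ Real.log q := Real.log_nonneg hq1.le
    have := sub_one_mul_factorization_factorial_le hq' N
    rw [← mul_div_assoc, le_div_iff₀ (by linarith)]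
    nlinarith
  have h3 : 0 ≤ Real.log N := Real.log_natCast_nonneg N
  have h4 : 0 ≤ Real.log (2 * Real.pi) := Real.log_nonneg (by linarith [Real.pi_gt_three])
  have h5 : N * (Real.log N - 1) ≤
      N * ∑ q ∈ (Finset.Icc 1 N).filter Nat.Prime, Real.log q / (q - 1) := by linarith
  exact le_of_mul_le_mul_left h5 hN'

lemma sum_log_div_mul_sub_one_le (N : ℕ) :
    ∑ n ∈ Finset.Icc 2 N, Real.log n / (n * (n - 1)) ≤ 2 := by
  have h : ∀ N : ℕ, ∑ n ∈ Finset.Icc 2 (N + 1), Real.log n / (n * (n - 1)) ≤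
      2 - (2 + Real.log ((N + 1 : ℕ) : ℝ)) / ((N + 1 : ℕ) : ℝ) := by
    intro N
    induction N with
    | zero => norm_num
    | succ N ih =>
      rw [Finset.sum_Icc_succ_top (by omega)]
      obtain ⟨a, ha⟩ : ∃ a : ℝ, a = ((N + 1 : ℕ) : ℝ) := ⟨_, rfl⟩
      have ha1 : 1 ≤ a := by rw [ha]; push_cast; linarith [(Nat.cast_nonneg N : (0 : ℝ) ≤ N)]
      have hb : ((N + 1 + 1 : ℕ) : ℝ) = a + 1 := by rw [ha]; push_cast; ring
      rw [hb]
      rw [← ha] at ih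
      have h1 : Real.log (a + 1) - Real.log a ≤ 1 / a := by
        rw [← Real.log_div (by linarith) (by linarith)]
        refine (Real.log_le_sub_one_of_pos (by positivity)).trans (le_of_eq ?_)
        field_simp; ring
      have h2 : (a + 1) * (Real.log (a + 1) - Real.log a) ≤ 2 := by
        calc _ ≤ (a + 1) * (1 / a) := by gcongr
          _ ≤ (a + a) * (1 / a) := by gcongr
          _ = 2 := by field_simp; ring
      have h3 : Real.log (a + 1) / ((a + 1) * (a + 1 - 1)) ≤
          (2 + Real.log a) / a - (2 + Real.log (a + 1)) / (a + 1) := by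
        rw [div_sub_div _ _ (by linarith) (by linarith), add_sub_cancel_right, mul_comm (a + 1) a]
        gcongr
        linarith
      linarith
  rcases Nat.eq_zero_or_pos N with rfl | hN
  · norm_num
  · obtain ⟨M, rfl⟩ := Nat.exists_eq_succ_of_ne_zero hN.ne'
    refine (h M).trans ?_
    have : 0 ≤ (2 + Real.log ((M + 1 : ℕ) : ℝ)) / ((M + 1 : ℕ) : ℝ) := by
      have := Real.log_natCast_nonneg (M + 1)
      positivity
    linarith

lemma sum_prime_log_div_mul_sub_one_le (N : ℕ) :
    ∑ q ∈ (Finset.Icc 1 N).filter Nat.Prime, Real.log q / (q * (q - 1)) ≤ 2 := by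
  refine (Finset.sum_le_sum_of_subset_of_nonneg (fun q hq => ?_) fun n hn _ => ?_).trans
    (sum_log_div_mul_sub_one_le N)
  · have := Finset.mem_filter.1 hq
    exact Finset.mem_Icc.2 ⟨this.2.two_le, (Finset.mem_Icc.1 this.1).2⟩
  · have : (2 : ℝ) ≤ n := by exact_mod_cast (Finset.mem_Icc.1 hn).1
    exact div_nonneg (Real.log_natCast_nonneg n) (mul_nonneg (by linarith) (by linarith))

lemma sum_log_div_sub_one_eq (N : ℕ) :
    ∑ q ∈ (Finset.Icc 1 N).filter Nat.Prime, Real.log q / ((q : ℝ) - 1) =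
      ∑ q ∈ (Finset.Icc 1 N).filter Nat.Prime, Real.log q / q +
      ∑ q ∈ (Finset.Icc 1 N).filter Nat.Prime, Real.log q / (q * (q - 1)) := by
  rw [← Finset.sum_add_distrib]
  refine Finset.sum_congr rfl fun q hq => ?_
  have hq1 : (1 : ℝ) < q := by exact_mod_cast (Finset.mem_filter.1 hq).2.one_lt
  have : (q : ℝ) - 1 ≠ 0 := by linarith
  field_simp
  ring

/-- Lower half of Mertens' first theorem. -/
lemma log_sub_three_le_sum_log_div (N : ℕ) :
    Real.log N - 3 ≤ ∑ q ∈ (Finset.Icc 1 N).filter Nat.Prime, Real.log q / q := by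
  have h1 := log_sub_one_le_sum N
  rw [sum_log_div_sub_one_eq] at h1
  linarith [sum_prime_log_div_mul_sub_one_le N]

lemma abs_sum_log_div_sub_one_sub_log_le (N : ℕ) :
    |∑ q ∈ (Finset.Icc 1 N).filter Nat.Prime, Real.log q / ((q : ℝ) - 1) - Real.log N| ≤ 4 := by
  have h1 := log_sub_one_le_sum N
  have h2 := sum_log_div_le N
  have h3 := sum_prime_log_div_mul_sub_one_le N
  have h4 := sum_log_div_sub_one_eq N
  rw [abs_le]
  constructor <;> linarith

lemma sum_log_div_sq_tail_le {Y N : ℕ} (hY : 1 ≤ Y) (hN : Y ≤ N) :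
    ∑ q ∈ (Finset.Ioc Y N).filter Nat.Prime, Real.log q / (q : ℝ) ^ 2 ≤ 4.2 / Y := by
  have hY0 : (0 : ℝ) < Y := by exact_mod_cast hY
  have key : ∀ N, Y ≤ N → ∑ q ∈ (Finset.Ioc Y N).filter Nat.Prime, Real.log q / (q : ℝ) ^ 2 ≤
      (∑ q ∈ (Finset.Icc 1 N).filter Nat.Prime, Real.log q) / (N : ℝ) ^ 2 + 2.8 * (1 / Y - 1 / N) := by
    intro N hN
    induction N, hN using Nat.le_induction with
    | base =>
      simp only [Finset.Ioc_self, Finset.filter_empty, Finset.sum_empty, sub_self, mul_zero, add_zero]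
      exact div_nonneg (Finset.sum_nonneg fun q _ => Real.log_natCast_nonneg q) (by positivity)
    | succ N hN ih =>
      have hθ := sum_log_prime_le N
      obtain ⟨θ, hθ'⟩ : ∃ θ : ℝ, θ = ∑ q ∈ (Finset.Icc 1 N).filter Nat.Prime, Real.log q := ⟨_, rfl⟩
      rw [← hθ'] at hθ ih
      have hN0 : (0 : ℝ) < N := by exact_mod_cast (lt_of_lt_of_le hY hN)
      have hkey : θ / (N : ℝ) ^ 2 + 2.8 * (1 / Y - 1 / N) ≤
          θ / ((N : ℝ) + 1) ^ 2 + 2.8 * (1 / Y - 1 / (N + 1)) := by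
        have h1 : θ / (N : ℝ) ^ 2 - θ / ((N : ℝ) + 1) ^ 2 ≤ 2.8 * (1 / N - 1 / (N + 1)) := by
          have e1 : θ / (N : ℝ) ^ 2 - θ / ((N : ℝ) + 1) ^ 2 =
              θ * (2 * N + 1) / (N ^ 2 * (N + 1) ^ 2) := by field_simp; ring
          have e2 : 2.8 * (1 / (N : ℝ) - 1 / (N + 1)) =
              (2.8 * N * (N + 1)) / (N ^ 2 * (N + 1) ^ 2) := by field_simp; ring
          rw [e1, e2]
          refine div_le_div_of_nonneg_right ?_ (by positivity)
          nlinarith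
        linarith
      rw [Finset.sum_filter, Finset.sum_Ioc_succ_top hN, Finset.sum_filter,
        Finset.sum_Icc_succ_top (by omega), ← Finset.sum_filter, ← Finset.sum_filter, ← hθ']
      have h2 : (if (N + 1).Prime then Real.log ((N + 1 : ℕ) : ℝ) / ((N + 1 : ℕ) : ℝ) ^ 2 else 0) =
          (if (N + 1).Prime then Real.log ((N + 1 : ℕ) : ℝ) else 0) / ((N + 1 : ℕ) : ℝ) ^ 2 := by
        split_ifs <;> simp
      rw [h2, add_div, Nat.cast_succ]
      linarith
  refine (key N hN).trans ?_
  have hN0 : (0 : ℝ) < N := by exact_mod_cast (lt_of_lt_of_le hY hN)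
  have h1 : (∑ q ∈ (Finset.Icc 1 N).filter Nat.Prime, Real.log q) / (N : ℝ) ^ 2 ≤ 1.4 / N := by
    rw [div_le_div_iff₀ (by positivity) hN0]
    nlinarith [sum_log_prime_le N]
  have h2 : 1 / (N : ℝ) ≤ 1 / Y := one_div_le_one_div_of_le hY0 (by exact_mod_cast hN)
  have h3 : 0 < 1 / (N : ℝ) := by positivity
  have e1 : 1.4 / (N : ℝ) = 1.4 * (1 / N) := by ring
  have e2 : 4.2 / (Y : ℝ) = 4.2 * (1 / Y) := by ring
  rw [e2]
  rw [e1] at h1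
  linarith

end Mertens

section Mean

/-- The primes up to `Y` different from `2` and `p`. -/
noncomputable def smallPrimes (p Y : ℕ) : Finset ℕ :=
  (Finset.Icc 1 Y).filter (fun q => q.Prime ∧ q ≠ 2 ∧ q ≠ p)

lemma mem_smallPrimes {p Y q : ℕ} :
    q ∈ smallPrimes p Y ↔ q ≤ Y ∧ q.Prime ∧ q ≠ 2 ∧ q ≠ p := by
  simp only [smallPrimes, Finset.mem_filter, Finset.mem_Icc]
  exact ⟨fun h => ⟨h.1.2, h.2⟩, fun h => ⟨⟨h.2.1.one_lt.le, h.1⟩, h.2⟩⟩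

lemma smallPrimes_subset (p Y : ℕ) : smallPrimes p Y ⊆ (Finset.Icc 1 Y).filter Nat.Prime :=
  fun q hq => by
    have := mem_smallPrimes.1 hq
    exact Finset.mem_filter.2 ⟨Finset.mem_Icc.2 ⟨this.2.1.one_lt.le, this.1⟩, this.2.1⟩

/-- The expected size of `log φ(d_p) - log λ(d_p)` for `d ≤ x`. -/
noncomputable def meanWeight (p x : ℕ) : ℝ :=
  ∑ q ∈ smallPrimes p ⌊logI 2 x⌋₊,
    Real.log q * recipSum (fun r => memRp p r ∧ q ∣ r - 1) x

lemma sum_log_div_Ioc_le {Z Y : ℕ} (h : Z ≤ Y) :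
    ∑ q ∈ (Finset.Ioc Z Y).filter Nat.Prime, Real.log q / q ≤ Real.log Y - Real.log Z + 4.4 := by
  have h1 : ∑ q ∈ (Finset.Icc 1 Y).filter Nat.Prime, Real.log q / q =
      ∑ q ∈ (Finset.Icc 1 Z).filter Nat.Prime, Real.log q / q +
      ∑ q ∈ (Finset.Ioc Z Y).filter Nat.Prime, Real.log q / q := by
    rw [← Finset.sum_union, ← Finset.filter_union]
    · congr 2
      ext q
      simp only [Finset.mem_union, Finset.mem_Icc, Finset.mem_Ioc]
      omega
    · refine Finset.disjoint_filter_filter (Finset.disjoint_left.2 fun q hq hq' => ?_)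
      rw [Finset.mem_Icc] at hq
      rw [Finset.mem_Ioc] at hq'
      omega
  linarith [sum_log_div_le Y, log_sub_three_le_sum_log_div Z]

lemma abs_sum_smallPrimes_sub_log_le {p : ℕ} (hp : p.Prime) (Y : ℕ) :
    |∑ q ∈ smallPrimes p Y, Real.log q / ((q : ℝ) - 1) - Real.log Y| ≤ 5 + Real.log p := by
  have h0 : ∀ q : ℕ, q.Prime → 0 ≤ Real.log q / ((q : ℝ) - 1) := fun q hq =>
    div_nonneg (Real.log_natCast_nonneg q) (by
      have : (1 : ℝ) ≤ q := by exact_mod_cast hq.one_lt.le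
      linarith)
  have h1 := Finset.sum_sdiff (f := fun q : ℕ => Real.log q / ((q : ℝ) - 1)) (smallPrimes_subset p Y)
  have hsub : ((Finset.Icc 1 Y).filter Nat.Prime) \ smallPrimes p Y ⊆ {2} ∪ {p} := by
    intro q hq
    rw [Finset.mem_sdiff, mem_smallPrimes, Finset.mem_filter, Finset.mem_Icc] at hq
    simp only [Finset.mem_union, Finset.mem_singleton]
    by_contra hh
    push Not at hh
    exact hq.2 ⟨hq.1.1.2, hq.1.2, hh⟩
  have h2 : ∑ q ∈ ((Finset.Icc 1 Y).filter Nat.Prime) \ smallPrimes p Y,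
      Real.log q / ((q : ℝ) - 1) ≤ Real.log 2 / (2 - 1) + Real.log p / ((p : ℝ) - 1) := by
    refine (Finset.sum_le_sum_of_subset_of_nonneg hsub ?_).trans ?_
    · intro q hq _
      simp only [Finset.mem_union, Finset.mem_singleton] at hq
      rcases hq with rfl | rfl
      · exact h0 _ Nat.prime_two
      · exact h0 _ hp
    · have h3 := Finset.sum_union_inter (s₁ := {2}) (s₂ := {p})
        (f := fun q : ℕ => Real.log q / ((q : ℝ) - 1))
      have h4 : 0 ≤ ∑ q ∈ ({2} : Finset ℕ) ∩ {p}, Real.log q / ((q : ℝ) - 1) := by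
        refine Finset.sum_nonneg fun q hq => h0 q ?_
        rw [Finset.mem_inter, Finset.mem_singleton] at hq
        rw [hq.1]; exact Nat.prime_two
      simp only [Finset.sum_singleton, Nat.cast_ofNat] at h3
      linarith
  have h3 : 0 ≤ ∑ q ∈ ((Finset.Icc 1 Y).filter Nat.Prime) \ smallPrimes p Y,
      Real.log q / ((q : ℝ) - 1) := Finset.sum_nonneg fun q hq =>
    h0 q (Finset.mem_filter.1 (Finset.mem_sdiff.1 hq).1).2
  have h4 : Real.log p / ((p : ℝ) - 1) ≤ Real.log p := by
    have : (2 : ℝ) ≤ p := by exact_mod_cast hp.two_le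
    exact div_le_self (Real.log_natCast_nonneg p) (by linarith)
  have h5 := abs_le.1 (abs_sum_log_div_sub_one_sub_log_le Y)
  have h6 := Real.log_two_lt_d9
  have h7 : Real.log 2 / (2 - 1) = Real.log 2 := by norm_num
  rw [abs_le]
  constructor <;> linarith [Real.log_natCast_nonneg p]

lemma abs_meanWeight_sub_sum_le {p : ℕ} (hp : p.Prime) (x : ℕ) {Z : ℕ}
    (hZ : Z ≤ ⌊logI 2 x⌋₊) :
    |meanWeight p x - ∑ q ∈ smallPrimes p ⌊logI 2 x⌋₊,
      Real.log q * (logI 2 x / (3 * ((q : ℝ) - 1)))| ≤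
    80000 * (5 + Real.log p) * (logI 3 x ^ 2 * (1.4 * Z) +
      logI 2 x / logI 3 x * (Real.log Z + 1.4)) +
    1801 * logI 2 x * (Real.log ⌊logI 2 x⌋₊ - Real.log Z + 4.4) := by
  obtain ⟨y, hy⟩ : ∃ y, y = logI 2 x := ⟨_, rfl⟩
  obtain ⟨L, hL⟩ : ∃ L, L = logI 3 x := ⟨_, rfl⟩
  obtain ⟨B, hB⟩ : ∃ B, B = 80000 * (5 + Real.log p) := ⟨_, rfl⟩
  have hB0 : 0 ≤ B := by rw [hB]; have := Real.log_natCast_nonneg p; positivity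
  have hy1 : 1 ≤ y := hy ▸ one_le_logI 1 x
  have hL1 : 1 ≤ L := hL ▸ one_le_logI 2 x
  rw [meanWeight, ← Finset.sum_sub_distrib, ← hy, ← hL, ← hB]
  rw [← hy] at hZ
  have hle : ∀ q ∈ smallPrimes p ⌊y⌋₊, (q : ℝ) ≤ y := fun q hq =>
    (Nat.cast_le.2 (mem_smallPrimes.1 hq).1).trans (Nat.floor_le (by linarith))
  obtain ⟨g, hg⟩ : ∃ g : ℕ → ℝ, g = fun q : ℕ => |Real.log q * recipSum (fun r => memRp p r ∧ q ∣ r - 1) x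
    - Real.log q * (y / (3 * ((q : ℝ) - 1)))| := ⟨_, rfl⟩
  have hg' : ∀ q : ℕ, g q = Real.log q * |recipSum (fun r => memRp p r ∧ q ∣ r - 1) x -
      y / (3 * ((q : ℝ) - 1))| := by
    intro q
    rw [hg]
    dsimp only
    rw [← mul_sub, abs_mul, abs_of_nonneg (Real.log_natCast_nonneg q)]
  have h1 : ∀ q ∈ smallPrimes p ⌊y⌋₊, g q ≤
      B * (L ^ 2 * Real.log q + y / L * (Real.log q / q)) := by
    intro q hq
    have hq' := mem_smallPrimes.1 hq
    have h := abs_recipSum_memRp_sub_le (x := x) hp hq'.2.1 hq'.2.2.1 hq'.2.2.2 (hy ▸ hle q hq)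
    rw [← hy, ← hL, ← hB] at h
    rw [hg']
    refine (mul_le_mul_of_nonneg_left h (Real.log_natCast_nonneg q)).trans (le_of_eq ?_)
    ring
  have h2 : ∀ q ∈ smallPrimes p ⌊y⌋₊, g q ≤ 1801 * y * (Real.log q / q) := by
    intro q hq
    have hq' := mem_smallPrimes.1 hq
    have hq2 : (2 : ℝ) ≤ q := by exact_mod_cast hq'.2.1.two_le
    have ha : recipSum (fun r => memRp p r ∧ q ∣ r - 1) x ≤ 1800 * y / q := by
      refine (recipSum_mono fun r _ h => h.2).trans ?_
      rw [hy]
      refine recipSum_dvd_sub_one_le q x hq'.2.1.pos ?_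
      rw [hq'.2.1.primeFactors]; simp
    have hb : y / (3 * ((q : ℝ) - 1)) ≤ y / q := by
      gcongr; linarith
    have hc : 0 ≤ y / (3 * ((q : ℝ) - 1)) := div_nonneg (by linarith) (by linarith)
    have hd := recipSum_nonneg (fun r => memRp p r ∧ q ∣ r - 1) x
    have he : |recipSum (fun r => memRp p r ∧ q ∣ r - 1) x - y / (3 * ((q : ℝ) - 1))| ≤
        1801 * y / q := by
      have e : 1801 * y / q = 1800 * y / q + y / q := by ring
      have : 0 ≤ 1800 * y / q := by positivity
      rw [abs_le]
      constructor <;> linarith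
    rw [hg']
    refine (mul_le_mul_of_nonneg_left he (Real.log_natCast_nonneg q)).trans (le_of_eq ?_)
    ring
  have h0 : ∀ q : ℕ, 0 ≤ Real.log q / q := fun q =>
    div_nonneg (Real.log_natCast_nonneg q) (Nat.cast_nonneg q)
  have hfirst : ∑ q ∈ (smallPrimes p ⌊y⌋₊).filter (fun q => q ≤ Z), g q ≤
      B * (L ^ 2 * (1.4 * Z) + y / L * (Real.log Z + 1.4)) := by
    calc _ ≤ ∑ q ∈ (smallPrimes p ⌊y⌋₊).filter (fun q => q ≤ Z),
          B * (L ^ 2 * Real.log q + y / L * (Real.log q / q)) :=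
        Finset.sum_le_sum fun q hq => h1 q (Finset.mem_filter.1 hq).1
      _ ≤ ∑ q ∈ (Finset.Icc 1 Z).filter Nat.Prime,
          B * (L ^ 2 * Real.log q + y / L * (Real.log q / q)) := by
        refine Finset.sum_le_sum_of_subset_of_nonneg (fun q hq => ?_) fun q _ _ => ?_
        · have h := Finset.mem_filter.1 hq
          have h' := mem_smallPrimes.1 h.1
          exact Finset.mem_filter.2 ⟨Finset.mem_Icc.2 ⟨h'.2.1.one_lt.le, h.2⟩, h'.2.1⟩
        · have := h0 q
          have := Real.log_natCast_nonneg q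
          positivity
      _ = B * (L ^ 2 * ∑ q ∈ (Finset.Icc 1 Z).filter Nat.Prime, Real.log q +
          y / L * ∑ q ∈ (Finset.Icc 1 Z).filter Nat.Prime, Real.log q / q) := by
        rw [← Finset.mul_sum, Finset.sum_add_distrib, ← Finset.mul_sum, ← Finset.mul_sum]
      _ ≤ _ := by
        gcongr
        · exact sum_log_prime_le Z
        · exact sum_log_div_le Z
  have hsecond : ∑ q ∈ (smallPrimes p ⌊y⌋₊).filter (fun q => ¬ q ≤ Z), g q ≤
      1801 * y * (Real.log ⌊y⌋₊ - Real.log Z + 4.4) := by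
    calc _ ≤ ∑ q ∈ (smallPrimes p ⌊y⌋₊).filter (fun q => ¬ q ≤ Z), 1801 * y * (Real.log q / q) :=
        Finset.sum_le_sum fun q hq => h2 q (Finset.mem_filter.1 hq).1
      _ ≤ ∑ q ∈ (Finset.Ioc Z ⌊y⌋₊).filter Nat.Prime, 1801 * y * (Real.log q / q) := by
        refine Finset.sum_le_sum_of_subset_of_nonneg (fun q hq => ?_) fun q _ _ => ?_
        · have h := Finset.mem_filter.1 hq
          have h' := mem_smallPrimes.1 h.1
          exact Finset.mem_filter.2 ⟨Finset.mem_Ioc.2 ⟨not_le.1 h.2, h'.1⟩, h'.2.1⟩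
        · have := h0 q
          positivity
      _ = 1801 * y * ∑ q ∈ (Finset.Ioc Z ⌊y⌋₊).filter Nat.Prime, Real.log q / q := by
        rw [Finset.mul_sum]
      _ ≤ _ := by
        gcongr
        exact sum_log_div_Ioc_le hZ
  calc _ ≤ ∑ q ∈ smallPrimes p ⌊y⌋₊, g q := by
        rw [hg]; exact Finset.abs_sum_le_sum_abs _ _
    _ = _ := (Finset.sum_filter_add_sum_filter_not _ (fun q => q ≤ Z) _).symm
    _ ≤ _ := add_le_add hfirst hsecond

lemma log_le_sqrt_of_one_le {y : ℝ} (hy : 1 ≤ y) : Real.log y ^ 2 ≤ y := by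
  have h1 : Real.log (√y / 2) ≤ √y / 2 - 1 :=
    Real.log_le_sub_one_of_pos (by have := Real.sqrt_pos.2 (by linarith : 0 < y); positivity)
  have h2 : Real.log (√y / 2) = Real.log y / 2 - Real.log 2 := by
    rw [Real.log_div (by have := Real.sqrt_pos.2 (by linarith : 0 < y); positivity) (by norm_num),
      Real.log_sqrt (by linarith)]
  have h3 := Real.log_two_lt_d9
  have h4 : Real.log y ≤ √y := by linarith
  have h5 := Real.log_nonneg hy
  calc Real.log y ^ 2 ≤ √y ^ 2 := by gcongr
    _ = y := Real.sq_sqrt (by linarith)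

lemma logI_sq_le (x : ℕ) : logI 3 x ^ 2 ≤ logI 2 x := by
  have hy1 : 1 ≤ logI 2 x := one_le_logI 1 x
  have h : logI 3 x = max (Real.log (logI 2 x)) 1 := rfl
  rw [h]
  rcases max_cases (Real.log (logI 2 (x : ℝ))) 1 with h | h
  · rw [h.1]; exact log_le_sqrt_of_one_le hy1
  · rw [h.1]; linarith

lemma log_floor_ge {t : ℝ} (ht : 1 ≤ t) : Real.log t - 1 ≤ Real.log ⌊t⌋₊ := by
  have h1 : 1 ≤ ⌊t⌋₊ := Nat.one_le_floor_iff t |>.2 ht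
  have h1' : (1 : ℝ) ≤ ⌊t⌋₊ := by exact_mod_cast h1
  have h2 := Nat.lt_floor_add_one t
  have h3 : Real.log t ≤ Real.log (2 * ⌊t⌋₊) := Real.log_le_log (by linarith) (by linarith)
  rw [Real.log_mul (by norm_num) (by linarith)] at h3
  linarith [Real.log_two_lt_d9]

lemma log_floor_le {t : ℝ} (ht : 1 ≤ t) : Real.log ⌊t⌋₊ ≤ Real.log t := by
  have h1 : 1 ≤ ⌊t⌋₊ := Nat.one_le_floor_iff t |>.2 ht
  exact Real.log_le_log (by exact_mod_cast h1) (Nat.floor_le (by linarith))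

theorem abs_meanWeight_sub_le {p : ℕ} (hp : p.Prime) (x : ℕ) :
    |meanWeight p x - 1 / 3 * logI 2 x * logI 3 x| ≤
      (400000 * (5 + Real.log p) + 20000) * (logI 2 x * logI 4 x) := by
  obtain ⟨y, hy⟩ : ∃ y, y = logI 2 x := ⟨_, rfl⟩
  obtain ⟨L, hL⟩ : ∃ L, L = logI 3 x := ⟨_, rfl⟩
  obtain ⟨M, hM⟩ : ∃ M, M = logI 4 x := ⟨_, rfl⟩
  have hy1 : 1 ≤ y := hy ▸ one_le_logI 1 x
  have hL1 : 1 ≤ L := hL ▸ one_le_logI 2 x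
  have hM1 : 1 ≤ M := hM ▸ one_le_logI 3 x
  have hLy : L ^ 2 ≤ y := by rw [hy, hL]; exact logI_sq_le x
  have hlogy : Real.log y ≤ L := by rw [hy, hL]; exact log_logI_le 2 x
  have hlogL : Real.log L ≤ M := by rw [hL, hM]; exact log_logI_le 3 x
  have hLlog : L ≤ Real.log y + 1 := by
    have : L = max (Real.log y) 1 := by rw [hL, hy]; rfl
    rw [this]
    exact max_le (by linarith) (by linarith [Real.log_nonneg hy1])
  obtain ⟨t, ht⟩ : ∃ t, t = y / L ^ 2 := ⟨_, rfl⟩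
  have ht1 : 1 ≤ t := by rw [ht, one_le_div (by positivity)]; exact hLy
  have hty : t ≤ y := by rw [ht]; exact div_le_self (by linarith) (one_le_pow₀ hL1)
  have hZ : ⌊t⌋₊ ≤ ⌊logI 2 x⌋₊ := by rw [← hy]; exact Nat.floor_mono hty
  have h1 := abs_meanWeight_sub_sum_le hp x hZ
  have h2 := abs_sum_smallPrimes_sub_log_le hp ⌊y⌋₊
  rw [← hy, ← hL] at h1
  rw [← hy, ← hL, ← hM]
  have e1 : ∑ q ∈ smallPrimes p ⌊y⌋₊, Real.log q * (y / (3 * ((q : ℝ) - 1))) =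
      y / 3 * ∑ q ∈ smallPrimes p ⌊y⌋₊, Real.log q / ((q : ℝ) - 1) := by
    rw [Finset.mul_sum]
    exact Finset.sum_congr rfl fun q _ => by rw [mul_comm (3 : ℝ), ← div_div]; ring
  rw [e1] at h1
  obtain ⟨σ, hσ⟩ : ∃ σ, σ = ∑ q ∈ smallPrimes p ⌊y⌋₊, Real.log q / ((q : ℝ) - 1) := ⟨_, rfl⟩
  obtain ⟨P, hP⟩ : ∃ P, P = 5 + Real.log p := ⟨_, rfl⟩
  have hP5 : 5 ≤ P := by rw [hP]; linarith [Real.log_natCast_nonneg p]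
  rw [← hσ] at h1 h2
  rw [← hP] at h1 h2 ⊢
  have hY1 := log_floor_ge hy1
  have hY2 := log_floor_le hy1
  have hZ1 := log_floor_ge ht1
  have hZ2 := log_floor_le ht1
  have hZt : (⌊t⌋₊ : ℝ) ≤ t := Nat.floor_le (by linarith)
  have hlogt : Real.log t = Real.log y - 2 * Real.log L := by
    rw [ht, Real.log_div (by linarith) (by positivity), Real.log_pow]; norm_num
  have hL0 : 0 ≤ Real.log L := Real.log_nonneg hL1
  have b1 : L ^ 2 * (1.4 * (⌊t⌋₊ : ℝ)) ≤ 1.4 * y := by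
    calc L ^ 2 * (1.4 * (⌊t⌋₊ : ℝ)) ≤ L ^ 2 * (1.4 * t) := by gcongr
      _ = 1.4 * y := by rw [ht]; field_simp
  have b2 : y / L * (Real.log ⌊t⌋₊ + 1.4) ≤ 2.4 * y := by
    calc y / L * (Real.log ⌊t⌋₊ + 1.4) ≤ y / L * (2.4 * L) := by
          gcongr
          linarith
      _ = 2.4 * y := by field_simp
  have b3 : 1801 * y * (Real.log ⌊y⌋₊ - Real.log ⌊t⌋₊ + 4.4) ≤ 1801 * y * (7.4 * M) := by
    gcongr
    linarith
  have b4 : 80000 * P * (L ^ 2 * (1.4 * (⌊t⌋₊ : ℝ)) + y / L * (Real.log ⌊t⌋₊ + 1.4)) ≤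
      80000 * P * (3.8 * y) := by
    gcongr
    linarith
  have b5 : |y / 3 * σ - 1 / 3 * y * L| ≤ y / 3 * (P + 2) := by
    rw [show y / 3 * σ - 1 / 3 * y * L = y / 3 * (σ - L) by ring, abs_mul,
      abs_of_nonneg (by positivity : 0 ≤ y / 3)]
    gcongr
    rw [abs_le] at h2 ⊢
    constructor <;> linarith
  have b6 : |meanWeight p x - 1 / 3 * y * L| ≤
      80000 * P * (3.8 * y) + 1801 * y * (7.4 * M) + y / 3 * (P + 2) := by
    refine (abs_sub_le _ (y / 3 * σ) _).trans ?_
    linarith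
  refine b6.trans ?_
  have hyM : y ≤ y * M := le_mul_of_one_le_right (by linarith) hM1
  have hPy : P * y ≤ P * (y * M) := by gcongr
  have h5 : y * M ≤ P * (y * M) / 5 := by nlinarith [mul_pos (by linarith : 0 < y) (by linarith : 0 < M)]
  nlinarith

end Mean

section Variance

lemma sum_ite_dvd_eq (x k : ℕ) :
    ∑ d ∈ Finset.Icc 1 x, (if k ∣ d then (1 : ℝ) else 0) = ((x / k : ℕ) : ℝ) := by
  rw [Finset.sum_boole, ← Nat.Ioc_filter_dvd_card_eq_div]
  rfl

lemma sum_ite_dvd_le (x k : ℕ) :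
    ∑ d ∈ Finset.Icc 1 x, (if k ∣ d then (1 : ℝ) else 0) ≤ x / k := by
  rw [sum_ite_dvd_eq]
  exact Nat.cast_div_le

lemma le_sum_ite_dvd {x k : ℕ} :
    (x : ℝ) / k - 1 ≤ ∑ d ∈ Finset.Icc 1 x, (if k ∣ d then (1 : ℝ) else 0) := by
  rw [sum_ite_dvd_eq]
  have h2 := Nat.lt_floor_add_one ((x : ℝ) / k)
  rw [Nat.floor_div_natCast, Nat.floor_natCast] at h2
  linarith

/-- The Turán inequality for the strongly additive function attached to `f`. -/
theorem sum_sq_sub_le (f : ℕ → ℝ) (hf : ∀ r, 0 ≤ f r) (x : ℕ) {μ : ℝ}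
    (hμ : μ = ∑ r ∈ (Finset.Icc 1 x).filter Nat.Prime, f r * (1 / (r : ℝ))) :
    ∑ d ∈ Finset.Icc 1 x, ((∑ r ∈ (Finset.Icc 1 x).filter Nat.Prime,
      f r * (if r ∣ d then 1 else 0)) - μ) ^ 2 ≤
    x * ∑ r ∈ (Finset.Icc 1 x).filter Nat.Prime, f r ^ 2 * (1 / (r : ℝ)) +
      2 * μ * ∑ r ∈ (Finset.Icc 1 x).filter Nat.Prime, f r := by
  obtain ⟨P, hP⟩ : ∃ P, P = (Finset.Icc 1 x).filter Nat.Prime := ⟨_, rfl⟩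
  rw [← hP] at hμ ⊢
  have hprime : ∀ r ∈ P, r.Prime := fun r hr => (Finset.mem_filter.1 (hP ▸ hr)).2
  have hμ0 : 0 ≤ μ := by
    rw [hμ]; exact Finset.sum_nonneg fun r _ => mul_nonneg (hf r) (by positivity)
  obtain ⟨F, hF⟩ : ∃ F : ℕ → ℝ, F = fun d => ∑ r ∈ P, f r * (if r ∣ d then 1 else 0) := ⟨_, rfl⟩
  have h1 : ∑ d ∈ Finset.Icc 1 x, F d ^ 2 ≤ x * μ ^ 2 + x * ∑ r ∈ P, f r ^ 2 * (1 / (r : ℝ)) := by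
    have hpt : ∀ r ∈ P, ∀ s ∈ P, ∑ d ∈ Finset.Icc 1 x,
        (f r * (if r ∣ d then (1 : ℝ) else 0)) * (f s * (if s ∣ d then 1 else 0)) ≤
        x * ((f r * (1 / (r : ℝ))) * (f s * (1 / (s : ℝ)))) +
          (if r = s then x * (f r ^ 2 * (1 / (r : ℝ))) else 0) := by
      intro r hr s hs
      by_cases hrs : r = s
      · subst hrs
        have e : ∀ d, (f r * (if r ∣ d then (1 : ℝ) else 0)) * (f r * (if r ∣ d then 1 else 0)) =
            f r ^ 2 * (if r ∣ d then 1 else 0) := by intro d; split_ifs <;> ring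
        rw [if_pos rfl, Finset.sum_congr rfl fun d _ => e d, ← Finset.mul_sum]
        have := mul_le_mul_of_nonneg_left (sum_ite_dvd_le x r) (sq_nonneg (f r))
        have h3 : 0 ≤ (x : ℝ) * ((f r * (1 / (r : ℝ))) * (f r * (1 / (r : ℝ)))) :=
          mul_nonneg (Nat.cast_nonneg x) (mul_self_nonneg _)
        calc _ ≤ f r ^ 2 * (x / r) := this
          _ = x * (f r ^ 2 * (1 / (r : ℝ))) := by ring
          _ ≤ _ := by linarith
      · have hcop : Nat.Coprime r s := (Nat.coprime_primes (hprime r hr) (hprime s hs)).2 hrs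
        have e : ∀ d, (f r * (if r ∣ d then (1 : ℝ) else 0)) * (f s * (if s ∣ d then 1 else 0)) =
            (f r * f s) * (if r * s ∣ d then 1 else 0) := by
          intro d
          by_cases h : r ∣ d <;> by_cases h' : s ∣ d
          · rw [if_pos h, if_pos h', if_pos (hcop.mul_dvd_of_dvd_of_dvd h h')]; ring
          · rw [if_neg h', if_neg fun h'' => h' (dvd_of_mul_left_dvd h'')]; ring
          · rw [if_neg h, if_neg fun h'' => h (dvd_of_mul_right_dvd h'')]; ring
          · rw [if_neg h', if_neg fun h'' => h' (dvd_of_mul_left_dvd h'')]; ring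
        rw [if_neg hrs, Finset.sum_congr rfl fun d _ => e d, ← Finset.mul_sum]
        have := mul_le_mul_of_nonneg_left (sum_ite_dvd_le x (r * s)) (mul_nonneg (hf r) (hf s))
        refine this.trans (le_of_eq ?_)
        rw [Nat.cast_mul, add_zero, div_eq_mul_one_div, ← one_div_mul_one_div]
        ring
    calc ∑ d ∈ Finset.Icc 1 x, F d ^ 2 = ∑ r ∈ P, ∑ s ∈ P, ∑ d ∈ Finset.Icc 1 x,
          (f r * (if r ∣ d then (1 : ℝ) else 0)) * (f s * (if s ∣ d then 1 else 0)) := by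
          rw [hF]
          simp only [sq, Finset.sum_mul_sum]
          rw [Finset.sum_comm]
          exact Finset.sum_congr rfl fun r _ => Finset.sum_comm
      _ ≤ ∑ r ∈ P, ∑ s ∈ P, (x * ((f r * (1 / (r : ℝ))) * (f s * (1 / (s : ℝ)))) +
          (if r = s then x * (f r ^ 2 * (1 / (r : ℝ))) else 0)) :=
        Finset.sum_le_sum fun r hr => Finset.sum_le_sum fun s hs => hpt r hr s hs
      _ = _ := by
        simp only [Finset.sum_add_distrib, Finset.sum_ite_eq, ← Finset.mul_sum, ← Finset.sum_mul]
        rw [← hμ, Finset.mul_sum, sq]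
        congr 1
        exact Finset.sum_congr rfl fun r hr => if_pos hr
  have h2 : x * μ - ∑ r ∈ P, f r ≤ ∑ d ∈ Finset.Icc 1 x, F d := by
    rw [hF, Finset.sum_comm, hμ, Finset.mul_sum, ← Finset.sum_sub_distrib]
    refine Finset.sum_le_sum fun r _ => ?_
    rw [← Finset.mul_sum]
    have := mul_le_mul_of_nonneg_left (le_sum_ite_dvd (x := x) (k := r)) (hf r)
    calc _ = f r * ((x : ℝ) / r - 1) := by ring
      _ ≤ _ := this
  have h3 : ∑ d ∈ Finset.Icc 1 x, (F d - μ) ^ 2 =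
      ∑ d ∈ Finset.Icc 1 x, F d ^ 2 - 2 * μ * ∑ d ∈ Finset.Icc 1 x, F d + x * μ ^ 2 := by
    simp only [sub_sq, Finset.sum_add_distrib, Finset.sum_sub_distrib, Finset.sum_const,
      Nat.card_Icc, Finset.mul_sum, nsmul_eq_mul, Nat.add_sub_cancel]
    congr 2
    exact Finset.sum_congr rfl fun d _ => by ring
  have h4 := mul_le_mul_of_nonneg_left h2 (by linarith : 0 ≤ 2 * μ)
  calc _ = ∑ d ∈ Finset.Icc 1 x, (F d - μ) ^ 2 := by rw [hF]
    _ ≤ _ := by rw [h3]; nlinarith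

/-- The contribution of the primes `q ≤ Y`, `q ∉ {2, p}`, to `log (r - 1)` for `r ∈ R_p`. -/
noncomputable def primeWeight (p Y r : ℕ) : ℝ :=
  ∑ q ∈ smallPrimes p Y, Real.log q * (if memRp p r ∧ q ∣ r - 1 then 1 else 0)

lemma primeWeight_nonneg (p Y r : ℕ) : 0 ≤ primeWeight p Y r :=
  Finset.sum_nonneg fun q _ => mul_nonneg (Real.log_natCast_nonneg q) (by split_ifs <;> norm_num)

lemma primeWeight_le_log {p Y r : ℕ} (hr : r.Prime) : primeWeight p Y r ≤ Real.log r := by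
  have h0 : r - 1 ≠ 0 := by have := hr.two_le; omega
  have h1 : primeWeight p Y r ≤ ∑ q ∈ (r - 1).primeFactors, Real.log q := by
    rw [primeWeight]
    calc _ ≤ ∑ q ∈ smallPrimes p Y, if q ∣ r - 1 then Real.log q else 0 := by
          refine Finset.sum_le_sum fun q _ => ?_
          have := Real.log_natCast_nonneg q
          split_ifs with h h' h'
          · simp
          · exact absurd h.2 h'
          · simpa using this
          · simp
      _ = ∑ q ∈ (smallPrimes p Y).filter (fun q => q ∣ r - 1), Real.log q :=
          (Finset.sum_filter _ _).symm
      _ ≤ _ := by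
        refine Finset.sum_le_sum_of_subset_of_nonneg (fun q hq => ?_)
          fun q _ _ => Real.log_natCast_nonneg q
        have h := Finset.mem_filter.1 hq
        exact Nat.mem_primeFactors.2 ⟨(mem_smallPrimes.1 h.1).2.1, h.2, h0⟩
  have h2 : ∑ q ∈ (r - 1).primeFactors, Real.log q = Real.log ((∏ q ∈ (r - 1).primeFactors, q : ℕ)) := by
    rw [Nat.cast_prod, Real.log_prod fun q hq => by
      exact_mod_cast (Nat.prime_of_mem_primeFactors hq).ne_zero]
  rw [h2] at h1
  refine h1.trans (Real.log_le_log ?_ ?_)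
  · exact_mod_cast Finset.prod_pos fun q hq => (Nat.prime_of_mem_primeFactors hq).pos
  · exact_mod_cast (Nat.le_of_dvd (by omega) (Nat.prod_primeFactors_dvd (r - 1))).trans (by omega)

lemma sum_primeWeight_eq_meanWeight (p x : ℕ) :
    meanWeight p x = ∑ r ∈ (Finset.Icc 1 x).filter Nat.Prime,
      primeWeight p ⌊logI 2 x⌋₊ r * (1 / (r : ℝ)) := by
  simp only [meanWeight, primeWeight, recipSum_eq_sum_ite, Finset.sum_mul, Finset.mul_sum]
  rw [Finset.sum_comm]
  exact Finset.sum_congr rfl fun r _ => Finset.sum_congr rfl fun q _ => by ring_nf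

lemma sum_smallPrimes_log_div_le (p x : ℕ) :
    ∑ q ∈ smallPrimes p ⌊logI 2 x⌋₊, Real.log q / q ≤ 2.4 * logI 3 x := by
  have h1 : ∑ q ∈ smallPrimes p ⌊logI 2 x⌋₊, Real.log q / q ≤
      ∑ q ∈ (Finset.Icc 1 ⌊logI 2 x⌋₊).filter Nat.Prime, Real.log q / q :=
    Finset.sum_le_sum_of_subset_of_nonneg (smallPrimes_subset _ _) fun q _ _ =>
      div_nonneg (Real.log_natCast_nonneg q) (Nat.cast_nonneg q)
  have h2 := sum_log_div_le ⌊logI 2 x⌋₊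
  have h3 := log_floor_le (one_le_logI 1 x)
  have h4 := log_logI_le 2 x
  have h5 := one_le_logI 2 x
  linarith

lemma meanWeight_le (p x : ℕ) : meanWeight p x ≤ 5000 * (logI 2 x * logI 3 x) := by
  have hy : 1 ≤ logI 2 x := one_le_logI 1 x
  have h1 : meanWeight p x ≤ ∑ q ∈ smallPrimes p ⌊logI 2 x⌋₊, 1800 * logI 2 x * (Real.log q / q) := by
    refine Finset.sum_le_sum fun q hq => ?_
    have hq' := (mem_smallPrimes.1 hq).2.1
    have ha : recipSum (fun r => memRp p r ∧ q ∣ r - 1) x ≤ 1800 * logI 2 x / q := by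
      refine (recipSum_mono fun r _ h => h.2).trans ?_
      refine recipSum_dvd_sub_one_le q x hq'.pos ?_
      rw [hq'.primeFactors]; simp
    refine (mul_le_mul_of_nonneg_left ha (Real.log_natCast_nonneg q)).trans (le_of_eq ?_)
    ring
  rw [← Finset.mul_sum] at h1
  have h2 := mul_le_mul_of_nonneg_left (sum_smallPrimes_log_div_le p x)
    (by linarith : 0 ≤ 1800 * logI 2 x)
  have h3 : 0 ≤ logI 2 x * logI 3 x := by
    have := one_le_logI 2 x
    positivity
  linarith

lemma recipSum_dvd_and_dvd_le {q s : ℕ} (hq : q.Prime) (hs : s.Prime) (p x : ℕ) :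
    recipSum (fun r => (memRp p r ∧ q ∣ r - 1) ∧ (memRp p r ∧ s ∣ r - 1)) x ≤
      1800 * logI 2 x * (1 / (q : ℝ) * (1 / (s : ℝ)) + if q = s then 1 / (q : ℝ) else 0) := by
  have hy : 1 ≤ logI 2 x := one_le_logI 1 x
  by_cases h : q = s
  · subst h
    rw [if_pos rfl]
    have h1 : recipSum (fun r => (memRp p r ∧ q ∣ r - 1) ∧ (memRp p r ∧ q ∣ r - 1)) x ≤
        1800 * logI 2 x / q := by
      refine (recipSum_mono fun r _ h => h.1.2).trans ?_
      refine recipSum_dvd_sub_one_le q x hq.pos ?_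
      rw [hq.primeFactors]; simp
    refine h1.trans ?_
    rw [div_eq_mul_one_div]
    have : 0 ≤ 1 / (q : ℝ) * (1 / (q : ℝ)) := by positivity
    gcongr
    linarith
  · have hcop : Nat.Coprime q s := (Nat.coprime_primes hq hs).2 h
    rw [if_neg h, add_zero, one_div_mul_one_div, ← div_eq_mul_one_div, ← Nat.cast_mul]
    refine (recipSum_mono fun r _ h => hcop.mul_dvd_of_dvd_of_dvd h.1.2 h.2.2).trans ?_
    refine recipSum_dvd_sub_one_le (q * s) x (Nat.mul_pos hq.pos hs.pos) ?_
    rw [hcop.primeFactors_mul, hq.primeFactors, hs.primeFactors]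
    exact (Finset.card_union_le _ _).trans (by simp)

lemma sum_primeWeight_sq_le (p x : ℕ) :
    ∑ r ∈ (Finset.Icc 1 x).filter Nat.Prime,
      primeWeight p ⌊logI 2 x⌋₊ r ^ 2 * (1 / (r : ℝ)) ≤ 15000 * (logI 2 x * logI 3 x ^ 2) := by
  obtain ⟨y, hy⟩ : ∃ y, y = logI 2 x := ⟨_, rfl⟩
  obtain ⟨L, hL⟩ : ∃ L, L = logI 3 x := ⟨_, rfl⟩
  have hy1 : 1 ≤ y := hy ▸ one_le_logI 1 x
  have hL1 : 1 ≤ L := hL ▸ one_le_logI 2 x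
  obtain ⟨Q, hQ⟩ : ∃ Q, Q = smallPrimes p ⌊y⌋₊ := ⟨_, rfl⟩
  have hQprime : ∀ q ∈ Q, q.Prime := fun q hq => (mem_smallPrimes.1 (hQ ▸ hq)).2.1
  have hsum : ∑ q ∈ Q, Real.log q * (1 / (q : ℝ)) ≤ 2.4 * L := by
    have := sum_smallPrimes_log_div_le p x
    rw [← hy, ← hL, ← hQ] at this
    refine le_trans (le_of_eq ?_) this
    exact Finset.sum_congr rfl fun q _ => by ring
  have hsum0 : 0 ≤ ∑ q ∈ Q, Real.log q * (1 / (q : ℝ)) := Finset.sum_nonneg fun q _ =>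
    mul_nonneg (Real.log_natCast_nonneg q) (by positivity)
  have hlog : ∀ q ∈ Q, Real.log q ≤ L := by
    intro q hq
    have h1 := (mem_smallPrimes.1 (hQ ▸ hq)).1
    have h2 : Real.log q ≤ Real.log y := Real.log_le_log
      (by exact_mod_cast (hQprime q hq).pos) ((Nat.cast_le.2 h1).trans (Nat.floor_le (by linarith)))
    refine h2.trans ?_
    rw [hy, hL]
    exact log_logI_le 2 x
  rw [← hy, ← hL]
  calc ∑ r ∈ (Finset.Icc 1 x).filter Nat.Prime, primeWeight p ⌊y⌋₊ r ^ 2 * (1 / (r : ℝ))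
      = ∑ q ∈ Q, ∑ s ∈ Q, Real.log q * Real.log s *
        recipSum (fun r => (memRp p r ∧ q ∣ r - 1) ∧ (memRp p r ∧ s ∣ r - 1)) x := by
        simp only [primeWeight, ← hQ, sq, recipSum_eq_sum_ite, Finset.mul_sum,
          Finset.sum_mul]
        rw [Finset.sum_comm]
        refine Finset.sum_congr rfl fun q _ => ?_
        rw [Finset.sum_comm]
        refine Finset.sum_congr rfl fun s _ => Finset.sum_congr rfl fun r _ => ?_
        by_cases h : memRp p r ∧ q ∣ r - 1 <;> by_cases h' : memRp p r ∧ s ∣ r - 1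
        · rw [if_pos h, if_pos h', if_pos ⟨h, h'⟩]; ring
        · rw [if_neg h',
            if_neg fun hh : (memRp p r ∧ q ∣ r - 1) ∧ memRp p r ∧ s ∣ r - 1 => h' hh.2]; ring
        · rw [if_neg h,
            if_neg fun hh : (memRp p r ∧ q ∣ r - 1) ∧ memRp p r ∧ s ∣ r - 1 => h hh.1]; ring
        · rw [if_neg h,
            if_neg fun hh : (memRp p r ∧ q ∣ r - 1) ∧ memRp p r ∧ s ∣ r - 1 => h hh.1]; ring
    _ ≤ ∑ q ∈ Q, ∑ s ∈ Q, (1800 * y * ((Real.log q * (1 / (q : ℝ))) * (Real.log s * (1 / (s : ℝ))))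
          + if q = s then 1800 * y * (Real.log q * (Real.log q * (1 / (q : ℝ)))) else 0) := by
        refine Finset.sum_le_sum fun q hq => Finset.sum_le_sum fun s hs => ?_
        have h := mul_le_mul_of_nonneg_left (recipSum_dvd_and_dvd_le (hQprime q hq) (hQprime s hs) p x)
          (mul_nonneg (Real.log_natCast_nonneg q) (Real.log_natCast_nonneg s))
        refine h.trans (le_of_eq ?_)
        rw [← hy]
        split_ifs with hqs
        · subst hqs; ring
        · ring
    _ = 1800 * y * ((∑ q ∈ Q, Real.log q * (1 / (q : ℝ))) * (∑ q ∈ Q, Real.log q * (1 / (q : ℝ))) +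
          ∑ q ∈ Q, Real.log q * (Real.log q * (1 / (q : ℝ)))) := by
        simp only [Finset.sum_add_distrib, Finset.sum_ite_eq, ← Finset.mul_sum, ← Finset.sum_mul]
        rw [mul_add, Finset.mul_sum _ _ (1800 * y)]
        congr 1
        exact Finset.sum_congr rfl fun r hr => if_pos hr
    _ ≤ 1800 * y * ((2.4 * L) * (2.4 * L) + L * (2.4 * L)) := by
        gcongr
        calc _ ≤ ∑ q ∈ Q, L * (Real.log q * (1 / (q : ℝ))) := by
              refine Finset.sum_le_sum fun q hq => mul_le_mul_of_nonneg_right (hlog q hq) ?_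
              exact mul_nonneg (Real.log_natCast_nonneg q) (by positivity)
          _ = L * ∑ q ∈ Q, Real.log q * (1 / (q : ℝ)) := by rw [Finset.mul_sum]
          _ ≤ _ := by gcongr
    _ ≤ _ := by
      have : 0 ≤ y * L ^ 2 := by positivity
      nlinarith

/-- The additive function approximating `log φ(d_p) - log λ(d_p)`. -/
noncomputable def additiveWeight (p x d : ℕ) : ℝ :=
  ∑ r ∈ (Finset.Icc 1 x).filter Nat.Prime,
    primeWeight p ⌊logI 2 x⌋₊ r * (if r ∣ d then 1 else 0)

theorem sum_sq_additiveWeight_sub_le (p x : ℕ) :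
    ∑ d ∈ Finset.Icc 1 x, (additiveWeight p x d - meanWeight p x) ^ 2 ≤
      30000 * (x * (logI 2 x * logI 3 x ^ 2)) := by
  have hy1 : 1 ≤ logI 2 x := one_le_logI 1 x
  have hL1 : 1 ≤ logI 3 x := one_le_logI 2 x
  refine (sum_sq_sub_le _ (primeWeight_nonneg p _) x (sum_primeWeight_eq_meanWeight p x)).trans ?_
  have h1 := mul_le_mul_of_nonneg_left (sum_primeWeight_sq_le p x) (Nat.cast_nonneg (α := ℝ) x)
  have h2 : ∑ r ∈ (Finset.Icc 1 x).filter Nat.Prime, primeWeight p ⌊logI 2 x⌋₊ r ≤ 1.4 * x :=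
    (Finset.sum_le_sum fun r hr => primeWeight_le_log (Finset.mem_filter.1 hr).2).trans
      (sum_log_prime_le x)
  have h3 : 0 ≤ ∑ r ∈ (Finset.Icc 1 x).filter Nat.Prime, primeWeight p ⌊logI 2 x⌋₊ r :=
    Finset.sum_nonneg fun r _ => primeWeight_nonneg p _ r
  have h4 : 2 * meanWeight p x * ∑ r ∈ (Finset.Icc 1 x).filter Nat.Prime,
      primeWeight p ⌊logI 2 x⌋₊ r ≤ 2 * (5000 * (logI 2 x * logI 3 x)) * (1.4 * x) := by
    have := meanWeight_le p x
    gcongr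
  have h5 : (x : ℝ) * (logI 2 x * logI 3 x) ≤ x * (logI 2 x * logI 3 x ^ 2) := by
    gcongr
    nlinarith
  have h6 : 0 ≤ (x : ℝ) * (logI 2 x * logI 3 x ^ 2) := by positivity
  nlinarith

end Variance

section Valuation

lemma finset_lcm_ne_zero {T : Finset ℕ} {h : ℕ → ℕ} (h0 : ∀ r ∈ T, h r ≠ 0) : T.lcm h ≠ 0 := by
  rw [Ne, Finset.lcm_eq_zero_iff]
  rintro ⟨r, hr, hr'⟩
  exact h0 r hr hr'

lemma exists_factorization_lcm_eq {T : Finset ℕ} {h : ℕ → ℕ} (hT : T.Nonempty)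
    (h0 : ∀ r ∈ T, h r ≠ 0) (q : ℕ) :
    ∃ r ∈ T, (T.lcm h).factorization q = (h r).factorization q := by
  induction hT using Finset.Nonempty.cons_induction with
  | singleton a => exact ⟨a, Finset.mem_singleton_self a, by simp⟩
  | cons a T ha hT ih =>
    obtain ⟨r, hr, hr'⟩ := ih fun r hr => h0 r (Finset.mem_cons_of_mem hr)
    have ha0 := h0 a (Finset.mem_cons_self a T)
    have hT0 : T.lcm h ≠ 0 := finset_lcm_ne_zero fun r hr => h0 r (Finset.mem_cons_of_mem hr)
    rw [Finset.cons_eq_insert, Finset.lcm_insert]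
    change ∃ s ∈ _, (Nat.lcm (h a) (T.lcm h)).factorization q = _
    rw [Nat.factorization_lcm ha0 hT0, Finsupp.sup_apply]
    rcases le_total ((h a).factorization q) ((T.lcm h).factorization q) with hle | hle
    · exact ⟨r, Finset.mem_insert_of_mem hr, by rw [sup_eq_right.2 hle, hr']⟩
    · exact ⟨a, Finset.mem_insert_self a T, by rw [sup_eq_left.2 hle]⟩

lemma factorization_le_factorization_lcm {T : Finset ℕ} {h : ℕ → ℕ} (h0 : ∀ r ∈ T, h r ≠ 0)
    {r : ℕ} (hr : r ∈ T) (q : ℕ) : (h r).factorization q ≤ (T.lcm h).factorization q :=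
  (Nat.factorization_le_iff_dvd (h0 r hr) (finset_lcm_ne_zero h0)).2 (Finset.dvd_lcm hr) q

lemma factorization_lcm_le_sum {T : Finset ℕ} {h : ℕ → ℕ} (h0 : ∀ r ∈ T, h r ≠ 0) (q : ℕ) :
    (T.lcm h).factorization q ≤ ∑ r ∈ T, (h r).factorization q := by
  rcases T.eq_empty_or_nonempty with rfl | hT
  · simp
  · obtain ⟨r, hr, he⟩ := exists_factorization_lcm_eq hT h0 q
    rw [he]
    exact Finset.single_le_sum (f := fun r => (h r).factorization q) (fun _ _ => Nat.zero_le _) hr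

lemma sum_dvd_add_factorization_lcm_le {T : Finset ℕ} {h : ℕ → ℕ} (h0 : ∀ r ∈ T, h r ≠ 0) {q : ℕ}
    (hq : q.Prime) : ∑ r ∈ T, (if q ∣ h r then 1 else 0) + (T.lcm h).factorization q ≤
      ∑ r ∈ T, (h r).factorization q + 1 := by
  rcases T.eq_empty_or_nonempty with rfl | hT
  · simp
  · obtain ⟨r, hr, he⟩ := exists_factorization_lcm_eq hT h0 q
    rw [he, ← Finset.add_sum_erase T _ hr, ← Finset.add_sum_erase T (fun r => (h r).factorization q) hr]
    have h1 : ∑ s ∈ T.erase r, (if q ∣ h s then 1 else 0) ≤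
        ∑ s ∈ T.erase r, (h s).factorization q := by
      refine Finset.sum_le_sum fun s hs => ?_
      split_ifs with hd
      · exact (hq.dvd_iff_one_le_factorization (h0 s (Finset.mem_of_mem_erase hs))).1 hd
      · exact Nat.zero_le _
    have h2 : (if q ∣ h r then 1 else 0) ≤ 1 := by split_ifs <;> simp
    omega

lemma sum_factorization_le_factorization_lcm_add {T : Finset ℕ} {h : ℕ → ℕ}
    (h0 : ∀ r ∈ T, h r ≠ 0) (q : ℕ) :
    ∑ r ∈ T, (h r).factorization q ≤ (T.lcm h).factorization q +
      ∑ r ∈ T, ∑ s ∈ T,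
        if r ≠ s then min ((h r).factorization q) ((h s).factorization q) else 0 := by
  rcases T.eq_empty_or_nonempty with rfl | hT
  · simp
  · obtain ⟨s, hs, hmax⟩ := Finset.exists_max_image T (fun r => (h r).factorization q) hT
    rw [← Finset.add_sum_erase T _ hs]
    refine Nat.add_le_add (factorization_le_factorization_lcm h0 hs q) ?_
    calc ∑ r ∈ T.erase s, (h r).factorization q
        ≤ ∑ r ∈ T.erase s, ∑ s ∈ T,
          if r ≠ s then min ((h r).factorization q) ((h s).factorization q) else 0 := by
          refine Finset.sum_le_sum fun r hr => ?_
          have hr' := Finset.mem_erase.1 hr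
          have := Finset.single_le_sum (f := fun s =>
            if r ≠ s then min ((h r).factorization q) ((h s).factorization q) else 0)
            (fun _ _ => Nat.zero_le _) hs
          refine le_trans ?_ this
          rw [if_pos hr'.1]
          exact le_min le_rfl (hmax r hr'.2)
      _ ≤ _ := Finset.sum_le_sum_of_subset (Finset.erase_subset s T)

lemma factorization_lt_self_of_le {n q x : ℕ} (hn : n ≠ 0) (h : n ≤ x) : n.factorization q ≤ x :=
  (Nat.factorization_lt q hn).le.trans h

lemma min_factorization_eq_sum {a b q x : ℕ} (hq : q.Prime) (ha : a ≠ 0) (hb : b ≠ 0)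
    (hax : a ≤ x) : min (a.factorization q) (b.factorization q) =
      ∑ k ∈ Finset.Icc 1 x, if q ^ k ∣ a ∧ q ^ k ∣ b then 1 else 0 := by
  have hle := (min_le_left (a.factorization q) (b.factorization q)).trans
    (factorization_lt_self_of_le ha hax)
  rw [← Finset.sum_filter, Finset.sum_const, smul_eq_mul, mul_one]
  have : (Finset.Icc 1 x).filter (fun k => q ^ k ∣ a ∧ q ^ k ∣ b) =
      Finset.Icc 1 (min (a.factorization q) (b.factorization q)) := by
    ext k
    rw [Finset.mem_filter, Finset.mem_Icc, Finset.mem_Icc, hq.pow_dvd_iff_le_factorization ha,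
      hq.pow_dvd_iff_le_factorization hb, ← le_min_iff]
    exact ⟨fun h => ⟨h.1.1, h.2⟩, fun h => ⟨⟨h.1, h.2.trans hle⟩, h.2⟩⟩
  rw [this, Nat.card_Icc, Nat.add_sub_cancel]

lemma factorization_eq_sum {a q x : ℕ} (hq : q.Prime) (ha : a ≠ 0) (hax : a ≤ x) :
    a.factorization q = ∑ k ∈ Finset.Icc 1 x, if q ^ k ∣ a then 1 else 0 := by
  have := min_factorization_eq_sum hq ha ha hax
  simpa using this

lemma log_eq_sum_factorization {n x : ℕ}
    (h : ∀ q, q.Prime → q ∣ n → q ≤ x) : Real.log n =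
      ∑ q ∈ (Finset.Icc 1 x).filter Nat.Prime, (n.factorization q : ℝ) * Real.log q := by
  rw [Real.log_nat_eq_sum_factorization, Finsupp.sum]
  apply Finset.sum_subset
  · intro q hq
    rw [Nat.support_factorization, Nat.mem_primeFactors] at hq
    exact Finset.mem_filter.2 ⟨Finset.mem_Icc.2 ⟨hq.1.one_lt.le, h q hq.1 hq.2.1⟩, hq.1⟩
  · intro q _ hq
    rw [Finsupp.notMem_support_iff.1 hq]
    simp

lemma sum_log_sub_log_lcm_eq {T : Finset ℕ} {h : ℕ → ℕ} {x : ℕ} (h0 : ∀ r ∈ T, h r ≠ 0)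
    (hx : ∀ r ∈ T, h r ≤ x) :
    ∑ r ∈ T, Real.log (h r) - Real.log (T.lcm h : ℕ) =
      ∑ q ∈ (Finset.Icc 1 x).filter Nat.Prime, Real.log q *
        (((∑ r ∈ T, (h r).factorization q : ℕ) : ℝ) - ((T.lcm h).factorization q : ℕ)) := by
  have h1 : ∀ r ∈ T, Real.log (h r) =
      ∑ q ∈ (Finset.Icc 1 x).filter Nat.Prime, ((h r).factorization q : ℝ) * Real.log q :=
    fun r hr => log_eq_sum_factorization fun q _ hd =>
      (Nat.le_of_dvd (Nat.pos_of_ne_zero (h0 r hr)) hd).trans (hx r hr)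
  have h2 := log_eq_sum_factorization (n := T.lcm h) (x := x) fun q hq hd => by
    have hd' : q ∣ ∏ r ∈ T, h r := hd.trans (Finset.lcm_dvd fun r hr => Finset.dvd_prod_of_mem h hr)
    obtain ⟨r, hr, hqr⟩ := (hq.prime.dvd_finsetProd_iff _).1 hd'
    exact (Nat.le_of_dvd (Nat.pos_of_ne_zero (h0 r hr)) hqr).trans (hx r hr)
  rw [Finset.sum_congr rfl h1, h2, Finset.sum_comm, ← Finset.sum_sub_distrib]
  refine Finset.sum_congr rfl fun q _ => ?_
  rw [← Finset.sum_mul, Nat.cast_sum]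
  ring

end Valuation

section Carmichael

lemma totient_prod_prime_pow {T : Finset ℕ} {e : ℕ → ℕ} (hT : ∀ r ∈ T, r.Prime)
    (he : ∀ r ∈ T, e r ≠ 0) :
    Nat.totient (∏ r ∈ T, r ^ e r) = ∏ r ∈ T, r ^ (e r - 1) * (r - 1) := by
  induction T using Finset.induction_on with
  | empty => simp
  | insert a T ha ih =>
    have hcop : Nat.Coprime (a ^ e a) (∏ r ∈ T, r ^ e r) := by
      refine Nat.Coprime.prod_right fun r hr => Nat.Coprime.pow _ _ ?_
      refine (Nat.coprime_primes (hT a (Finset.mem_insert_self a T))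
        (hT r (Finset.mem_insert_of_mem hr))).2 ?_
      rintro rfl
      exact ha hr
    rw [Finset.prod_insert ha, Finset.prod_insert ha, Nat.totient_mul hcop,
      ih (fun r hr => hT r (Finset.mem_insert_of_mem hr)) fun r hr => he r (Finset.mem_insert_of_mem hr),
      Nat.totient_prime_pow (hT a (Finset.mem_insert_self a T))
        (Nat.pos_of_ne_zero (he a (Finset.mem_insert_self a T)))]

lemma carmichael_prod_odd_prime_pow {T : Finset ℕ} {e : ℕ → ℕ} (hT : ∀ r ∈ T, r.Prime)
    (hT2 : ∀ r ∈ T, r ≠ 2) (he : ∀ r ∈ T, e r ≠ 0) :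
    carmichael (∏ r ∈ T, r ^ e r) = T.lcm fun r => r ^ (e r - 1) * (r - 1) := by
  have hne : ∏ r ∈ T, r ^ e r ≠ 0 :=
    Finset.prod_ne_zero_iff.2 fun r hr => pow_ne_zero _ (hT r hr).ne_zero
  rw [carmichael, ← ArithmeticFunction.carmichael_eq_exponent hne,
    ArithmeticFunction.carmichael_finsetProd]
  · refine Finset.lcm_congr rfl fun r hr => ?_
    rw [Function.comp_apply, ArithmeticFunction.carmichael_pow_of_prime_ne_two _ (hT r hr) (hT2 r hr),
      Nat.totient_prime_pow (hT r hr) (Nat.pos_of_ne_zero (he r hr))]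
  · intro r hr s hs hrs
    exact Nat.Coprime.pow _ _ ((Nat.coprime_primes (hT r hr) (hT s hs)).2 hrs)

/-- The logarithm of `φ(n)/λ(n)` up to the contribution of the square part of `n`. -/
lemma log_totient_sub_log_carmichael_bounds {T : Finset ℕ} {e : ℕ → ℕ} (hT : ∀ r ∈ T, r.Prime)
    (hT2 : ∀ r ∈ T, r ≠ 2) (he : ∀ r ∈ T, e r ≠ 0) :
    ∑ r ∈ T, Real.log ((r - 1 : ℕ) : ℝ) - Real.log (T.lcm (fun r => r - 1) : ℕ) ≤
      Real.log (Nat.totient (∏ r ∈ T, r ^ e r)) - Real.log (carmichael (∏ r ∈ T, r ^ e r)) ∧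
    Real.log (Nat.totient (∏ r ∈ T, r ^ e r)) - Real.log (carmichael (∏ r ∈ T, r ^ e r)) ≤
      ∑ r ∈ T, Real.log ((r - 1 : ℕ) : ℝ) - Real.log (T.lcm (fun r => r - 1) : ℕ) +
        ∑ r ∈ T, ((e r - 1 : ℕ) : ℝ) * Real.log r := by
  rw [totient_prod_prime_pow hT he, carmichael_prod_odd_prime_pow hT hT2 he]
  have hr1 : ∀ r ∈ T, r - 1 ≠ 0 := fun r hr => by have := (hT r hr).two_le; omega
  have hpow : ∀ r ∈ T, r ^ (e r - 1) ≠ 0 := fun r hr => pow_ne_zero _ (hT r hr).ne_zero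
  obtain ⟨ℓ, hℓ⟩ : ∃ ℓ, ℓ = T.lcm (fun r => r - 1) := ⟨_, rfl⟩
  obtain ⟨Λ, hΛ⟩ : ∃ Λ, Λ = T.lcm (fun r => r ^ (e r - 1) * (r - 1)) := ⟨_, rfl⟩
  have hℓ0 : ℓ ≠ 0 := hℓ ▸ finset_lcm_ne_zero hr1
  have hΛ0 : Λ ≠ 0 := hΛ ▸ finset_lcm_ne_zero fun r hr => mul_ne_zero (hpow r hr) (hr1 r hr)
  have hW0 : ∏ r ∈ T, r ^ (e r - 1) ≠ 0 := Finset.prod_ne_zero_iff.2 hpow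
  have h1 : ℓ ∣ Λ := by
    rw [hℓ, hΛ]
    exact Finset.lcm_dvd fun r hr => (dvd_mul_left _ _).trans
      (Finset.dvd_lcm (f := fun r => r ^ (e r - 1) * (r - 1)) hr)
  have h2 : Λ ∣ (∏ r ∈ T, r ^ (e r - 1)) * ℓ := by
    rw [hℓ, hΛ]
    exact Finset.lcm_dvd fun r hr => mul_dvd_mul
      (Finset.dvd_prod_of_mem (fun r => r ^ (e r - 1)) hr) (Finset.dvd_lcm (f := fun r => r - 1) hr)
  have h3 : Real.log ℓ ≤ Real.log Λ := Real.log_le_log (by exact_mod_cast Nat.pos_of_ne_zero hℓ0)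
    (by exact_mod_cast Nat.le_of_dvd (Nat.pos_of_ne_zero hΛ0) h1)
  have hlogW : Real.log ((∏ r ∈ T, r ^ (e r - 1) : ℕ) : ℝ) =
      ∑ r ∈ T, ((e r - 1 : ℕ) : ℝ) * Real.log r := by
    rw [Nat.cast_prod, Real.log_prod fun r hr => by exact_mod_cast hpow r hr]
    exact Finset.sum_congr rfl fun r _ => by rw [Nat.cast_pow, Real.log_pow]
  have h4 : Real.log Λ ≤ ∑ r ∈ T, ((e r - 1 : ℕ) : ℝ) * Real.log r + Real.log ℓ := by
    rw [← hlogW, ← Real.log_mul (by exact_mod_cast hW0) (by exact_mod_cast hℓ0), ← Nat.cast_mul]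
    exact Real.log_le_log (by exact_mod_cast Nat.pos_of_ne_zero hΛ0)
      (by exact_mod_cast Nat.le_of_dvd (Nat.pos_of_ne_zero (mul_ne_zero hW0 hℓ0)) h2)
  have h5 : Real.log ((∏ r ∈ T, r ^ (e r - 1) * (r - 1) : ℕ) : ℝ) =
      ∑ r ∈ T, ((e r - 1 : ℕ) : ℝ) * Real.log r + ∑ r ∈ T, Real.log ((r - 1 : ℕ) : ℝ) := by
    rw [Finset.prod_mul_distrib, Nat.cast_mul, Real.log_mul (by exact_mod_cast hW0)
      (by exact_mod_cast Finset.prod_ne_zero_iff.2 hr1), hlogW, Nat.cast_prod,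
      Real.log_prod fun r hr => by exact_mod_cast hr1 r hr]
  rw [h5, ← hℓ, ← hΛ]
  constructor <;> linarith

end Carmichael

section Weights

/-- The number of primes `r ≤ x` dividing `d` with `r ≡ 1` modulo `m`. -/
noncomputable def congruentCount (x m d : ℕ) : ℝ :=
  ∑ r ∈ (Finset.Icc 1 x).filter Nat.Prime,
    (if m ∣ r - 1 then 1 else 0) * (if r ∣ d then (1 : ℝ) else 0)

/-- The number of pairs of distinct primes `r, s ≤ x` dividing `d`, both `≡ 1` modulo `m`. -/
noncomputable def congruentPairs (x m d : ℕ) : ℝ :=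
  ∑ r ∈ (Finset.Icc 1 x).filter Nat.Prime, ∑ s ∈ (Finset.Icc 1 x).filter Nat.Prime,
    if r ≠ s ∧ (m ∣ r - 1 ∧ m ∣ s - 1) ∧ (r ∣ d ∧ s ∣ d) then (1 : ℝ) else 0

/-- The contribution of proper prime powers dividing some `r - 1`, `r ∣ d`. -/
noncomputable def higherPowerWeight (x d : ℕ) : ℝ :=
  ∑ q ∈ (Finset.Icc 1 x).filter Nat.Prime,
    Real.log q * ∑ k ∈ Finset.Ioc 1 x, congruentCount x (q ^ k) d

/-- The contribution of the primes `2` and `p`. -/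
noncomputable def exceptionalWeight (p x d : ℕ) : ℝ :=
  ∑ q ∈ {2} ∪ {p}, Real.log q * congruentCount x q d

/-- The contribution of the primes exceeding `Y`. -/
noncomputable def pairWeight (Y x d : ℕ) : ℝ :=
  ∑ q ∈ (Finset.Ioc Y x).filter Nat.Prime,
    Real.log q * ∑ k ∈ Finset.Icc 1 x, congruentPairs x (q ^ k) d

/-- An upper bound for the logarithm of the quotient of `d` by its radical. -/
noncomputable def nonSquarefreeWeight (x d : ℕ) : ℝ :=
  ∑ r ∈ (Finset.Icc 1 x).filter Nat.Prime,
    Real.log r * ∑ k ∈ Finset.Ioc 1 x, if r ^ k ∣ d then (1 : ℝ) else 0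

/-- The excess of `log φ(d_p) - log λ(d_p)` over its approximation. -/
noncomputable def errorWeight (p x d : ℕ) : ℝ :=
  higherPowerWeight x d + exceptionalWeight p x d + pairWeight ⌊logI 2 x⌋₊ x d +
    nonSquarefreeWeight x d

/-- The prime divisors of `d` lying in `R_p`. -/
noncomputable def rpFactors (p d : ℕ) : Finset ℕ := d.primeFactors.filter (fun r => memRp p r)

lemma rpFactors_eq {p x d : ℕ} (hd : 1 ≤ d) (hdx : d ≤ x) : rpFactors p d =
    ((Finset.Icc 1 x).filter Nat.Prime).filter (fun r => memRp p r ∧ r ∣ d) := by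
  ext r
  simp only [rpFactors, Finset.mem_filter, Nat.mem_primeFactors, Finset.mem_Icc]
  constructor
  · rintro ⟨⟨h1, h2, h3⟩, h4⟩
    exact ⟨⟨⟨h1.one_lt.le, (Nat.le_of_dvd (by omega) h2).trans hdx⟩, h1⟩, h4, h2⟩
  · rintro ⟨⟨_, h1⟩, h4, h2⟩
    exact ⟨⟨h1, h2, by omega⟩, h4⟩

lemma sum_rpFactors_dvd_le {p x d : ℕ} (hd : 1 ≤ d) (hdx : d ≤ x) (m : ℕ) :
    ∑ r ∈ rpFactors p d, (if m ∣ r - 1 then (1 : ℝ) else 0) ≤ congruentCount x m d := by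
  rw [rpFactors_eq hd hdx, Finset.sum_filter, congruentCount]
  refine Finset.sum_le_sum fun r _ => ?_
  split_ifs <;> simp_all

lemma additiveWeight_eq {p x d : ℕ} (hd : 1 ≤ d) (hdx : d ≤ x) : additiveWeight p x d =
    ∑ q ∈ smallPrimes p ⌊logI 2 x⌋₊,
      Real.log q * ∑ r ∈ rpFactors p d, (if q ∣ r - 1 then (1 : ℝ) else 0) := by
  simp only [additiveWeight, primeWeight, Finset.sum_mul]
  rw [Finset.sum_comm]
  refine Finset.sum_congr rfl fun q _ => ?_
  rw [rpFactors_eq hd hdx, Finset.sum_filter (s := (Finset.Icc 1 x).filter Nat.Prime)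
    (p := fun r => memRp p r ∧ r ∣ d), Finset.mul_sum]
  refine Finset.sum_congr rfl fun r _ => ?_
  by_cases h1 : memRp p r <;> by_cases h2 : q ∣ r - 1 <;> by_cases h3 : r ∣ d <;>
    simp [h1, h2, h3]

lemma logI_two_le {x : ℕ} (hx : 1 ≤ x) : logI 2 x ≤ x := by
  have hx' : (1 : ℝ) ≤ x := by exact_mod_cast hx
  have h1 : logI 1 x ≤ x := max_le ((Real.log_le_sub_one_of_pos (by
    change (0 : ℝ) < x; linarith)).trans (by change (x : ℝ) - 1 ≤ x; linarith)) hx'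
  have h2 := one_le_logI 0 x
  exact max_le ((Real.log_le_sub_one_of_pos (by linarith)).trans (by linarith)) hx'

lemma congruentCount_nonneg (x m d : ℕ) : 0 ≤ congruentCount x m d :=
  Finset.sum_nonneg fun r _ => by split_ifs <;> norm_num

lemma congruentPairs_nonneg (x m d : ℕ) : 0 ≤ congruentPairs x m d :=
  Finset.sum_nonneg fun r _ => Finset.sum_nonneg fun s _ => by split_ifs <;> norm_num

section Bounds

variable {p x d : ℕ}

lemma rpFactors_props {r : ℕ} (hdx : d ≤ x) (hr : r ∈ rpFactors p d) :
    r.Prime ∧ r ≠ 2 ∧ d.factorization r ≠ 0 ∧ r - 1 ≠ 0 ∧ r - 1 ≤ x := by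
  have h := Finset.mem_filter.1 hr
  have h1 := Nat.mem_primeFactors.1 h.1
  have h2 := h1.1.two_le
  refine ⟨h1.1, ?_, ?_, by omega, ?_⟩
  · rintro rfl
    exact (Nat.not_odd_iff_even.2 even_two) (memRp_iff.1 h.2).2.1
  · exact (h1.1.factorization_pos_of_dvd h1.2.2 h1.2.1).ne'
  · have := Nat.le_of_dvd (Nat.pos_of_ne_zero h1.2.2) h1.2.1
    omega

lemma cast_sum_factorization_eq {q : ℕ} (hdx : d ≤ x) (hq : q.Prime) :
    ((∑ r ∈ rpFactors p d, (r - 1).factorization q : ℕ) : ℝ) =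
      ∑ k ∈ Finset.Icc 1 x, ∑ r ∈ rpFactors p d, if q ^ k ∣ r - 1 then (1 : ℝ) else 0 := by
  rw [Finset.sum_comm, Nat.cast_sum]
  refine Finset.sum_congr rfl fun r hr => ?_
  obtain ⟨_, _, _, h4, h5⟩ := rpFactors_props hdx hr
  rw [factorization_eq_sum hq h4 h5]
  push_cast
  rfl

lemma cast_sum_factorization_le {q : ℕ} (hd : 1 ≤ d) (hdx : d ≤ x) (hq : q.Prime) :
    ((∑ r ∈ rpFactors p d, (r - 1).factorization q : ℕ) : ℝ) ≤
      ∑ r ∈ rpFactors p d, (if q ∣ r - 1 then (1 : ℝ) else 0) +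
        ∑ k ∈ Finset.Ioc 1 x, congruentCount x (q ^ k) d := by
  rw [cast_sum_factorization_eq hdx hq, ← Finset.add_sum_Ioc_eq_sum_Icc (hd.trans hdx), pow_one]
  gcongr with k _
  exact sum_rpFactors_dvd_le hd hdx _

lemma cast_sum_factorization_sub_le_pairs {q : ℕ} (hd : 1 ≤ d) (hdx : d ≤ x) (hq : q.Prime) :
    ((∑ r ∈ rpFactors p d, (r - 1).factorization q : ℕ) : ℝ) -
      (((rpFactors p d).lcm fun r => r - 1).factorization q : ℕ) ≤
        ∑ k ∈ Finset.Icc 1 x, congruentPairs x (q ^ k) d := by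
  have h1 := sum_factorization_le_factorization_lcm_add (T := rpFactors p d) (h := fun r => r - 1)
    (fun r hr => (rpFactors_props hdx hr).2.2.2.1) q
  have h2 : ((∑ r ∈ rpFactors p d, (r - 1).factorization q : ℕ) : ℝ) ≤
      (((rpFactors p d).lcm fun r => r - 1).factorization q : ℕ) +
      ((∑ r ∈ rpFactors p d, ∑ s ∈ rpFactors p d,
        if r ≠ s then min ((r - 1).factorization q) ((s - 1).factorization q) else 0 : ℕ) : ℝ) := by
    exact_mod_cast h1
  have h3 : ((∑ r ∈ rpFactors p d, ∑ s ∈ rpFactors p d,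
      if r ≠ s then min ((r - 1).factorization q) ((s - 1).factorization q) else 0 : ℕ) : ℝ) =
      ∑ k ∈ Finset.Icc 1 x, ∑ r ∈ rpFactors p d, ∑ s ∈ rpFactors p d,
        if r ≠ s ∧ (q ^ k ∣ r - 1 ∧ q ^ k ∣ s - 1) then (1 : ℝ) else 0 := by
    rw [Finset.sum_comm (s := Finset.Icc 1 x), Nat.cast_sum]
    refine Finset.sum_congr rfl fun r hr => ?_
    rw [Finset.sum_comm (s := Finset.Icc 1 x), Nat.cast_sum]
    refine Finset.sum_congr rfl fun s hs => ?_
    obtain ⟨_, _, _, h4, h5⟩ := rpFactors_props hdx hr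
    obtain ⟨_, _, _, h4', _⟩ := rpFactors_props hdx hs
    by_cases hrs : r = s
    · simp [hrs]
    · rw [if_pos hrs, min_factorization_eq_sum hq h4 h4' h5, Nat.cast_sum]
      refine Finset.sum_congr rfl fun k _ => ?_
      by_cases h : q ^ k ∣ r - 1 ∧ q ^ k ∣ s - 1
      · rw [if_pos h, if_pos ⟨hrs, h⟩, Nat.cast_one]
      · rw [if_neg h, if_neg fun hh : r ≠ s ∧ (q ^ k ∣ r - 1 ∧ q ^ k ∣ s - 1) => h hh.2, Nat.cast_zero]
  have h4 : ∀ k, ∑ r ∈ rpFactors p d, ∑ s ∈ rpFactors p d,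
      (if r ≠ s ∧ (q ^ k ∣ r - 1 ∧ q ^ k ∣ s - 1) then (1 : ℝ) else 0) ≤
      congruentPairs x (q ^ k) d := by
    intro k
    have hsub : rpFactors p d ⊆ (Finset.Icc 1 x).filter Nat.Prime := by
      rw [rpFactors_eq hd hdx]; exact Finset.filter_subset _ _
    have hdvd : ∀ r ∈ rpFactors p d, r ∣ d := fun r hr =>
      Nat.dvd_of_mem_primeFactors (Finset.mem_filter.1 hr).1
    calc _ ≤ ∑ r ∈ rpFactors p d, ∑ s ∈ rpFactors p d,
        (if r ≠ s ∧ (q ^ k ∣ r - 1 ∧ q ^ k ∣ s - 1) ∧ (r ∣ d ∧ s ∣ d) then (1 : ℝ) else 0) := by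
          refine Finset.sum_le_sum fun r hr => Finset.sum_le_sum fun s hs => ?_
          simp [hdvd r hr, hdvd s hs]
      _ ≤ ∑ r ∈ rpFactors p d, ∑ s ∈ (Finset.Icc 1 x).filter Nat.Prime,
        (if r ≠ s ∧ (q ^ k ∣ r - 1 ∧ q ^ k ∣ s - 1) ∧ (r ∣ d ∧ s ∣ d) then (1 : ℝ) else 0) :=
        Finset.sum_le_sum fun r _ => Finset.sum_le_sum_of_subset_of_nonneg hsub
          fun s _ _ => by split_ifs <;> norm_num
      _ ≤ _ := Finset.sum_le_sum_of_subset_of_nonneg hsub fun r _ _ =>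
        Finset.sum_nonneg fun s _ => by split_ifs <;> norm_num
  have h5 := Finset.sum_le_sum fun k (_ : k ∈ Finset.Icc 1 x) => h4 k
  rw [← h3] at h5
  linarith

lemma sum_sub_one_mul_log_le (hd : 1 ≤ d) (hdx : d ≤ x) :
    ∑ r ∈ rpFactors p d, ((d.factorization r - 1 : ℕ) : ℝ) * Real.log r ≤
      nonSquarefreeWeight x d := by
  have hsub : rpFactors p d ⊆ (Finset.Icc 1 x).filter Nat.Prime := by
    rw [rpFactors_eq hd hdx]; exact Finset.filter_subset _ _
  have h : ∀ r ∈ rpFactors p d, ((d.factorization r - 1 : ℕ) : ℝ) * Real.log r =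
      Real.log r * ∑ k ∈ Finset.Ioc 1 x, if r ^ k ∣ d then (1 : ℝ) else 0 := by
    intro r hr
    have hdvd : r ∣ d := Nat.dvd_of_mem_primeFactors (Finset.mem_filter.1 hr).1
    have h1 := factorization_eq_sum (x := x) (rpFactors_props hdx hr).1 (by omega : d ≠ 0) hdx
    rw [← Finset.add_sum_Ioc_eq_sum_Icc (hd.trans hdx), pow_one, if_pos hdvd] at h1
    rw [h1, Nat.add_sub_cancel_left, mul_comm]
    push_cast
    rfl
  rw [Finset.sum_congr rfl h]
  exact Finset.sum_le_sum_of_subset_of_nonneg hsub fun r _ _ =>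
    mul_nonneg (Real.log_natCast_nonneg r) (Finset.sum_nonneg fun k _ => by split_ifs <;> norm_num)

end Bounds

lemma sum_log_sub_log_lcm_ge {p x d : ℕ} (hd : 1 ≤ d) (hdx : d ≤ x) :
    additiveWeight p x d - 1.4 * logI 2 x ≤ ∑ r ∈ rpFactors p d, Real.log ((r - 1 : ℕ) : ℝ) -
      Real.log ((rpFactors p d).lcm (fun r => r - 1) : ℕ) := by
  have hy1 := one_le_logI 1 x
  have h0 : ∀ r ∈ rpFactors p d, r - 1 ≠ 0 := fun r hr => (rpFactors_props hdx hr).2.2.2.1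
  have hYx : ⌊logI 2 x⌋₊ ≤ x := Nat.floor_le_of_le (logI_two_le (hd.trans hdx))
  rw [sum_log_sub_log_lcm_eq (h := fun r => r - 1) h0 fun r hr => (rpFactors_props hdx hr).2.2.2.2,
    additiveWeight_eq hd hdx]
  have h1 : ∑ q ∈ smallPrimes p ⌊logI 2 x⌋₊, Real.log q ≤ 1.4 * logI 2 x := by
    refine (Finset.sum_le_sum_of_subset_of_nonneg (smallPrimes_subset p _) fun q _ _ =>
      Real.log_natCast_nonneg q).trans ((sum_log_prime_le _).trans ?_)
    gcongr
    exact Nat.floor_le (by linarith)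
  have h2 : ∀ q : ℕ, 0 ≤ Real.log q * (((∑ r ∈ rpFactors p d, (r - 1).factorization q : ℕ) : ℝ) -
      (((rpFactors p d).lcm fun r => r - 1).factorization q : ℕ)) := by
    intro q
    have h3 := factorization_lcm_le_sum (h := fun r => r - 1) h0 q
    have h4 : ((((rpFactors p d).lcm fun r => r - 1).factorization q : ℕ) : ℝ) ≤
      ((∑ r ∈ rpFactors p d, (r - 1).factorization q : ℕ) : ℝ) := by exact_mod_cast h3
    exact mul_nonneg (Real.log_natCast_nonneg q) (by linarith)
  have h3 : ∀ q ∈ smallPrimes p ⌊logI 2 x⌋₊,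
      Real.log q * ∑ r ∈ rpFactors p d, (if q ∣ r - 1 then (1 : ℝ) else 0) - Real.log q ≤
      Real.log q * (((∑ r ∈ rpFactors p d, (r - 1).factorization q : ℕ) : ℝ) -
      (((rpFactors p d).lcm fun r => r - 1).factorization q : ℕ)) := by
    intro q hq
    have h4 := sum_dvd_add_factorization_lcm_le (h := fun r => r - 1) h0 (mem_smallPrimes.1 hq).2.1
    have h5 : ∑ r ∈ rpFactors p d, (if q ∣ r - 1 then (1 : ℝ) else 0) +
        (((rpFactors p d).lcm fun r => r - 1).factorization q : ℕ) ≤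
        ((∑ r ∈ rpFactors p d, (r - 1).factorization q : ℕ) : ℝ) + 1 := by exact_mod_cast h4
    have h6 := mul_le_mul_of_nonneg_left (sub_le_sub_right h5
      (1 + (((rpFactors p d).lcm fun r => r - 1).factorization q : ℝ))) (Real.log_natCast_nonneg q)
    linarith
  have h4 := Finset.sum_le_sum h3
  rw [Finset.sum_sub_distrib] at h4
  have h5 := Finset.sum_le_sum_of_subset_of_nonneg ((smallPrimes_subset p ⌊logI 2 x⌋₊).trans
    (Finset.filter_subset_filter _ (Finset.Icc_subset_Icc_right hYx))) fun q _ _ => h2 q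
  linarith

lemma sum_log_sub_log_lcm_le {p x d : ℕ} (hd : 1 ≤ d) (hdx : d ≤ x) :
    ∑ r ∈ rpFactors p d, Real.log ((r - 1 : ℕ) : ℝ) -
      Real.log ((rpFactors p d).lcm (fun r => r - 1) : ℕ) ≤
    additiveWeight p x d + (higherPowerWeight x d + exceptionalWeight p x d +
      pairWeight ⌊logI 2 x⌋₊ x d) := by
  have h0 : ∀ r ∈ rpFactors p d, r - 1 ≠ 0 := fun r hr => (rpFactors_props hdx hr).2.2.2.1
  have hYx : ⌊logI 2 x⌋₊ ≤ x := Nat.floor_le_of_le (logI_two_le (hd.trans hdx))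
  obtain ⟨Y, hY⟩ : ∃ Y, Y = ⌊logI 2 (x : ℝ)⌋₊ := ⟨_, rfl⟩
  rw [← hY] at hYx ⊢
  rw [sum_log_sub_log_lcm_eq (h := fun r => r - 1) h0 fun r hr => (rpFactors_props hdx hr).2.2.2.2,
    additiveWeight_eq hd hdx, ← hY]
  have key : ∀ q ∈ (Finset.Icc 1 x).filter Nat.Prime,
      Real.log q * (((∑ r ∈ rpFactors p d, (r - 1).factorization q : ℕ) : ℝ) -
        (((rpFactors p d).lcm fun r => r - 1).factorization q : ℕ)) ≤
      (if q ∈ smallPrimes p Y then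
        Real.log q * ∑ r ∈ rpFactors p d, (if q ∣ r - 1 then (1 : ℝ) else 0) else 0) +
      (Real.log q * ∑ k ∈ Finset.Ioc 1 x, congruentCount x (q ^ k) d +
      (if q ∈ ({2} ∪ {p} : Finset ℕ) then Real.log q * congruentCount x q d else 0) +
      (if Y < q then Real.log q * ∑ k ∈ Finset.Icc 1 x, congruentPairs x (q ^ k) d else 0)) := by
    intro q hq
    have hq' := Finset.mem_filter.1 hq
    have hl := Real.log_natCast_nonneg q
    have hc := congruentCount_nonneg x q d
    have hs : 0 ≤ ∑ k ∈ Finset.Ioc 1 x, congruentCount x (q ^ k) d :=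
      Finset.sum_nonneg fun k _ => congruentCount_nonneg _ _ _
    have hpr : 0 ≤ ∑ k ∈ Finset.Icc 1 x, congruentPairs x (q ^ k) d :=
      Finset.sum_nonneg fun k _ => congruentPairs_nonneg _ _ _
    have hl1 := mul_nonneg hl hc
    have hl2 := mul_nonneg hl hs
    have hl3 := mul_nonneg hl hpr
    have h1 := cast_sum_factorization_le (p := p) hd hdx hq'.2
    have h2 := cast_sum_factorization_sub_le_pairs (p := p) hd hdx hq'.2
    have h3 : (0 : ℝ) ≤ (((rpFactors p d).lcm fun r => r - 1).factorization q : ℕ) := Nat.cast_nonneg _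
    have h4 := sum_rpFactors_dvd_le (p := p) hd hdx q
    have hn : 0 ≤ ∑ r ∈ rpFactors p d, (if q ∣ r - 1 then (1 : ℝ) else 0) :=
      Finset.sum_nonneg fun r _ => by split_ifs <;> norm_num
    have hl4 := mul_nonneg hl hn
    obtain ⟨A, hA⟩ : ∃ A : ℝ, A = ((∑ r ∈ rpFactors p d, (r - 1).factorization q : ℕ) : ℝ) -
        (((rpFactors p d).lcm fun r => r - 1).factorization q : ℕ) := ⟨_, rfl⟩
    rw [← hA] at h2 ⊢
    have h5 := mul_le_mul_of_nonneg_left (by linarith : A ≤ _) hl (b := A)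
      (c := ∑ r ∈ rpFactors p d, (if q ∣ r - 1 then (1 : ℝ) else 0) +
        ∑ k ∈ Finset.Ioc 1 x, congruentCount x (q ^ k) d)
    have h6 := mul_le_mul_of_nonneg_left h2 hl
    have h7 := mul_le_mul_of_nonneg_left h4 hl
    rw [mul_add] at h5
    by_cases hm : q ∈ smallPrimes p Y
    · rw [if_pos hm]
      split_ifs <;> linarith only [h5, hl1, hl3]
    · rw [if_neg hm]
      by_cases hm2 : q ∈ ({2} ∪ {p} : Finset ℕ)
      · rw [if_pos hm2]
        split_ifs <;> linarith only [h5, hl3, h7]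
      · have hm3 : Y < q := by
          by_contra hh
          simp only [Finset.mem_union, Finset.mem_singleton, not_or] at hm2
          exact hm (mem_smallPrimes.2 ⟨not_lt.1 hh, hq'.2, hm2.1, hm2.2⟩)
        rw [if_neg hm2, if_pos hm3]
        linarith only [h6, hl2]
  refine (Finset.sum_le_sum key).trans ?_
  rw [Finset.sum_add_distrib, Finset.sum_add_distrib, Finset.sum_add_distrib]
  have e1 : ∑ q ∈ (Finset.Icc 1 x).filter Nat.Prime, (if q ∈ smallPrimes p Y then
        Real.log q * ∑ r ∈ rpFactors p d, (if q ∣ r - 1 then (1 : ℝ) else 0) else 0) =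
      ∑ q ∈ smallPrimes p Y,
        Real.log q * ∑ r ∈ rpFactors p d, (if q ∣ r - 1 then (1 : ℝ) else 0) := by
    rw [Finset.sum_ite_mem, Finset.inter_eq_right.2 ((smallPrimes_subset p Y).trans
      (Finset.filter_subset_filter _ (Finset.Icc_subset_Icc_right hYx)))]
  have e2 : ∑ q ∈ (Finset.Icc 1 x).filter Nat.Prime,
      (if q ∈ ({2} ∪ {p} : Finset ℕ) then Real.log q * congruentCount x q d else 0) ≤
      exceptionalWeight p x d := by
    rw [Finset.sum_ite_mem]
    exact Finset.sum_le_sum_of_subset_of_nonneg Finset.inter_subset_right fun q _ _ =>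
      mul_nonneg (Real.log_natCast_nonneg q) (congruentCount_nonneg _ _ _)
  have e3 : ∑ q ∈ (Finset.Icc 1 x).filter Nat.Prime,
      (if Y < q then Real.log q * ∑ k ∈ Finset.Icc 1 x, congruentPairs x (q ^ k) d else 0) =
      pairWeight Y x d := by
    rw [← Finset.sum_filter, pairWeight]
    refine Finset.sum_congr (Finset.ext fun q => ?_) fun _ _ => rfl
    simp only [Finset.mem_filter, Finset.mem_Icc, Finset.mem_Ioc]
    exact ⟨fun h => ⟨⟨h.2, h.1.1.2⟩, h.1.2⟩, fun h => ⟨⟨⟨h.2.one_lt.le, h.1.2⟩, h.2⟩, h.1.1⟩⟩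
  rw [e1, e3]
  have e4 : higherPowerWeight x d = ∑ q ∈ (Finset.Icc 1 x).filter Nat.Prime,
    Real.log q * ∑ k ∈ Finset.Ioc 1 x, congruentCount x (q ^ k) d := rfl
  rw [← e4]
  linarith only [e2]

theorem log_totient_sub_log_carmichael_dPart_bounds {p x d : ℕ} (hd : 1 ≤ d) (hdx : d ≤ x) :
    additiveWeight p x d - 1.4 * logI 2 x ≤
      Real.log (Nat.totient (dPart p d)) - Real.log (carmichael (dPart p d)) ∧
    Real.log (Nat.totient (dPart p d)) - Real.log (carmichael (dPart p d)) ≤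
      additiveWeight p x d + errorWeight p x d := by
  have hb := log_totient_sub_log_carmichael_bounds (T := rpFactors p d) (e := d.factorization)
    (fun r hr => (rpFactors_props hdx hr).1) (fun r hr => (rpFactors_props hdx hr).2.1)
    (fun r hr => (rpFactors_props hdx hr).2.2.1)
  have e : dPart p d = ∏ r ∈ rpFactors p d, r ^ d.factorization r := rfl
  rw [e]
  have h1 := sum_log_sub_log_lcm_ge (p := p) hd hdx
  have h2 := sum_log_sub_log_lcm_le (p := p) hd hdx
  have h3 := sum_sub_one_mul_log_le (p := p) hd hdx
  rw [errorWeight]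
  exact ⟨h1.trans hb.1, hb.2.trans (by linarith only [h2, h3])⟩

end Weights

section Moments

lemma recipSum_prime_pow_dvd_le {q : ℕ} (hq : q.Prime) (k x : ℕ) :
    recipSum (fun r => q ^ k ∣ r - 1) x ≤ 1800 * logI 2 x * ((q : ℝ)⁻¹ ^ k) := by
  have h := recipSum_dvd_sub_one_le (q ^ k) x (Nat.pow_pos hq.pos)
    ((Finset.card_le_card (t := {q}) fun r hr => Finset.mem_singleton.2
      ((Nat.prime_dvd_prime_iff_eq (Nat.prime_of_mem_primeFactors hr) hq).1
        ((Nat.prime_of_mem_primeFactors hr).dvd_of_dvd_pow (Nat.dvd_of_mem_primeFactors hr)))).trans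
      (by simp))
  rwa [Nat.cast_pow, div_eq_mul_inv, ← inv_pow] at h

lemma sum_congruentCount_le (x m : ℕ) :
    ∑ d ∈ Finset.Icc 1 x, congruentCount x m d ≤ x * recipSum (fun r => m ∣ r - 1) x := by
  simp only [congruentCount]
  rw [Finset.sum_comm, recipSum_eq_sum_ite, Finset.mul_sum]
  refine Finset.sum_le_sum fun r _ => ?_
  rw [← Finset.mul_sum]
  refine (mul_le_mul_of_nonneg_left (sum_ite_dvd_le x r) (by split_ifs <;> norm_num)).trans
    (le_of_eq ?_)
  ring_nf

lemma sum_congruentPairs_le (x m : ℕ) :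
    ∑ d ∈ Finset.Icc 1 x, congruentPairs x m d ≤ x * recipSum (fun r => m ∣ r - 1) x ^ 2 := by
  simp only [congruentPairs]
  rw [Finset.sum_comm, recipSum_eq_sum_ite, sq, Finset.sum_mul_sum, Finset.mul_sum]
  refine Finset.sum_le_sum fun r hr => ?_
  rw [Finset.sum_comm, Finset.mul_sum]
  refine Finset.sum_le_sum fun s hs => ?_
  have hrp := (Finset.mem_filter.1 hr).2
  have hsp := (Finset.mem_filter.1 hs).2
  by_cases h : r ≠ s ∧ m ∣ r - 1 ∧ m ∣ s - 1
  · rw [if_pos h.2.1, if_pos h.2.2]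
    have hc : Nat.Coprime r s := (Nat.coprime_primes hrp hsp).2 h.1
    have e : ∀ d, (if r ≠ s ∧ (m ∣ r - 1 ∧ m ∣ s - 1) ∧ (r ∣ d ∧ s ∣ d) then (1 : ℝ) else 0) =
        if r * s ∣ d then 1 else 0 := fun d => by
      have : (r ≠ s ∧ (m ∣ r - 1 ∧ m ∣ s - 1) ∧ (r ∣ d ∧ s ∣ d)) ↔ r * s ∣ d :=
        ⟨fun hh => hc.mul_dvd_of_dvd_of_dvd hh.2.2.1 hh.2.2.2,
          fun hh => ⟨h.1, h.2, (dvd_mul_right r s).trans hh, (dvd_mul_left s r).trans hh⟩⟩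
      simp only [this]
    simp only [e]
    refine (sum_ite_dvd_le x (r * s)).trans (le_of_eq ?_)
    push_cast
    ring
  · rw [Finset.sum_eq_zero fun d _ => if_neg fun hh => h ⟨hh.1, hh.2.1⟩]
    have h1 : (0 : ℝ) ≤ (if m ∣ r - 1 then 1 else 0) * (1 / (r : ℝ)) := by
      split_ifs <;> positivity
    have h2 : (0 : ℝ) ≤ (if m ∣ s - 1 then 1 else 0) * (1 / (s : ℝ)) := by
      split_ifs <;> positivity
    convert mul_nonneg (Nat.cast_nonneg x) (mul_nonneg h1 h2)

lemma sum_Ioc_inv_pow_le {q : ℕ} (hq : q.Prime) (x : ℕ) :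
    ∑ k ∈ Finset.Ioc 1 x, (q : ℝ)⁻¹ ^ k ≤ 1 / (q * (q - 1)) := by
  have hq1 : (1 : ℝ) < q := by exact_mod_cast hq.one_lt
  have h := geom_sum_Ico_le_of_lt_one (x := (q : ℝ)⁻¹) (m := 2) (n := x + 1) (by positivity)
    (inv_lt_one_of_one_lt₀ hq1)
  have e : Finset.Ioc 1 x = Finset.Ico 2 (x + 1) := by
    ext k; simp only [Finset.mem_Ioc, Finset.mem_Ico]; omega
  rw [e]
  refine h.trans (le_of_eq ?_)
  have : (q : ℝ) - 1 ≠ 0 := by linarith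
  field_simp

lemma sum_Icc_inv_pow_sq_le {q : ℕ} (hq : q.Prime) (x : ℕ) :
    ∑ k ∈ Finset.Icc 1 x, ((q : ℝ)⁻¹ ^ k) ^ 2 ≤ 2 / (q : ℝ) ^ 2 := by
  have hq2 : (2 : ℝ) ≤ q := by exact_mod_cast hq.two_le
  have hlt : ((q : ℝ)⁻¹) ^ 2 ≤ 1 / 2 := by
    have : (q : ℝ)⁻¹ ≤ 1 / 2 := by
      rw [inv_eq_one_div]; gcongr
    have h0 : (0 : ℝ) ≤ (q : ℝ)⁻¹ := by positivity
    nlinarith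
  have h := geom_sum_Ico_le_of_lt_one (x := ((q : ℝ)⁻¹) ^ 2) (m := 1) (n := x + 1) (by positivity)
    (by linarith)
  have e : Finset.Icc 1 x = Finset.Ico 1 (x + 1) := by
    ext k; simp only [Finset.mem_Icc, Finset.mem_Ico]; omega
  rw [e]
  simp only [pow_right_comm _ _ 2]
  refine h.trans ?_
  rw [pow_one, div_le_iff₀ (by linarith), inv_pow]
  rw [inv_pow] at hlt
  have hi : (0 : ℝ) ≤ ((q : ℝ) ^ 2)⁻¹ := by positivity
  rw [div_eq_mul_inv]
  nlinarith

lemma sum_higherPowerWeight_le (x : ℕ) :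
    ∑ d ∈ Finset.Icc 1 x, higherPowerWeight x d ≤ 3600 * (x * logI 2 x) := by
  have hy := one_le_logI 1 x
  simp only [higherPowerWeight]
  rw [Finset.sum_comm]
  have key : ∀ q ∈ (Finset.Icc 1 x).filter Nat.Prime, ∑ d ∈ Finset.Icc 1 x,
      Real.log q * ∑ k ∈ Finset.Ioc 1 x, congruentCount x (q ^ k) d ≤
      1800 * (x * logI 2 x) * (Real.log q / (q * (q - 1))) := by
    intro q hq
    have hqp := (Finset.mem_filter.1 hq).2
    have h1 : ∑ k ∈ Finset.Ioc 1 x, ∑ d ∈ Finset.Icc 1 x, congruentCount x (q ^ k) d ≤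
        ∑ k ∈ Finset.Ioc 1 x, 1800 * (x * logI 2 x) * ((q : ℝ)⁻¹ ^ k) :=
      Finset.sum_le_sum fun k _ => (sum_congruentCount_le x _).trans
        ((mul_le_mul_of_nonneg_left (recipSum_prime_pow_dvd_le hqp k x) (Nat.cast_nonneg x)).trans
          (le_of_eq (by ring)))
    rw [← Finset.mul_sum] at h1
    rw [← Finset.mul_sum, Finset.sum_comm]
    have h2 := mul_le_mul_of_nonneg_left (sum_Ioc_inv_pow_le hqp x)
      (show 0 ≤ 1800 * (x * logI 2 x) by positivity)
    refine (mul_le_mul_of_nonneg_left (h1.trans h2) (Real.log_natCast_nonneg q)).trans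
      (le_of_eq ?_)
    ring
  refine (Finset.sum_le_sum key).trans ?_
  rw [← Finset.mul_sum]
  have h := mul_le_mul_of_nonneg_left (sum_prime_log_div_mul_sub_one_le x)
    (show 0 ≤ 1800 * (x * logI 2 x) by positivity)
  linarith

lemma sum_exceptionalWeight_le {p : ℕ} (hp : p.Prime) (x : ℕ) :
    ∑ d ∈ Finset.Icc 1 x, exceptionalWeight p x d ≤ 3600 * (x * logI 2 x) := by
  have hy := one_le_logI 1 x
  simp only [exceptionalWeight]
  rw [Finset.sum_comm]
  have key : ∀ q ∈ ({2} ∪ {p} : Finset ℕ), ∑ d ∈ Finset.Icc 1 x,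
      Real.log q * congruentCount x q d ≤ 1800 * (x * logI 2 x) := by
    intro q hq
    have hqp : q.Prime := by
      simp only [Finset.mem_union, Finset.mem_singleton] at hq
      rcases hq with rfl | rfl
      · exact Nat.prime_two
      · exact hp
    have h0 := recipSum_prime_pow_dvd_le hqp 1 x
    rw [pow_one, pow_one] at h0
    have h1 := (sum_congruentCount_le x q).trans
      (mul_le_mul_of_nonneg_left h0 (Nat.cast_nonneg x))
    rw [← Finset.mul_sum]
    refine (mul_le_mul_of_nonneg_left h1 (Real.log_natCast_nonneg q)).trans ?_
    have hq0 : (0 : ℝ) < q := by exact_mod_cast hqp.pos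
    have hl : Real.log q * (q : ℝ)⁻¹ ≤ 1 := by
      rw [← div_eq_mul_inv, div_le_one hq0]
      linarith [Real.log_le_sub_one_of_pos hq0]
    have h2 := mul_le_mul_of_nonneg_left hl (show 0 ≤ 1800 * (x * logI 2 x) by positivity)
    linarith
  refine (Finset.sum_le_card_nsmul _ _ _ key).trans ?_
  have hc : ((({2} ∪ {p} : Finset ℕ).card : ℕ) : ℝ) ≤ 2 := by
    exact_mod_cast (Finset.card_union_le {2} {p}).trans (by simp)
  rw [nsmul_eq_mul]
  have h2 := mul_le_mul_of_nonneg_right hc (show 0 ≤ 1800 * (x * logI 2 x) by positivity)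
  linarith

lemma sum_pairWeight_le {x : ℕ} (hx : 1 ≤ x) :
    ∑ d ∈ Finset.Icc 1 x, pairWeight ⌊logI 2 x⌋₊ x d ≤ 1800 ^ 2 * 16.8 * (x * logI 2 x) := by
  have hy := one_le_logI 1 x
  have hYx : ⌊logI 2 x⌋₊ ≤ x := Nat.floor_le_of_le (logI_two_le hx)
  have hY1 : 1 ≤ ⌊logI 2 (x : ℝ)⌋₊ := (Nat.one_le_floor_iff _).2 hy
  have hYlt := Nat.lt_floor_add_one (logI 2 (x : ℝ))
  obtain ⟨Y, hY⟩ : ∃ Y, Y = ⌊logI 2 (x : ℝ)⌋₊ := ⟨_, rfl⟩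
  rw [← hY] at hYx hY1 hYlt ⊢
  simp only [pairWeight]
  rw [Finset.sum_comm]
  have key : ∀ q ∈ (Finset.Ioc Y x).filter Nat.Prime, ∑ d ∈ Finset.Icc 1 x,
      Real.log q * ∑ k ∈ Finset.Icc 1 x, congruentPairs x (q ^ k) d ≤
      1800 ^ 2 * (x * logI 2 x ^ 2) * 2 * (Real.log q / (q : ℝ) ^ 2) := by
    intro q hq
    have hqp := (Finset.mem_filter.1 hq).2
    have h1 : ∑ k ∈ Finset.Icc 1 x, ∑ d ∈ Finset.Icc 1 x, congruentPairs x (q ^ k) d ≤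
        ∑ k ∈ Finset.Icc 1 x, 1800 ^ 2 * (x * logI 2 x ^ 2) * ((q : ℝ)⁻¹ ^ k) ^ 2 :=
      Finset.sum_le_sum fun k _ => (sum_congruentPairs_le x _).trans
        ((mul_le_mul_of_nonneg_left (pow_le_pow_left₀ (recipSum_nonneg _ _)
          (recipSum_prime_pow_dvd_le hqp k x) 2) (Nat.cast_nonneg x)).trans
          (le_of_eq (by ring)))
    rw [← Finset.mul_sum] at h1
    rw [← Finset.mul_sum, Finset.sum_comm]
    have h2 := mul_le_mul_of_nonneg_left (sum_Icc_inv_pow_sq_le hqp x)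
      (show 0 ≤ 1800 ^ 2 * (x * logI 2 x ^ 2) by positivity)
    refine (mul_le_mul_of_nonneg_left (h1.trans h2) (Real.log_natCast_nonneg q)).trans
      (le_of_eq ?_)
    ring
  refine (Finset.sum_le_sum key).trans ?_
  rw [← Finset.mul_sum]
  have hY0 : (1 : ℝ) ≤ Y := by exact_mod_cast hY1
  have h := mul_le_mul_of_nonneg_left (sum_log_div_sq_tail_le hY1 hYx)
    (show 0 ≤ 1800 ^ 2 * (x * logI 2 x ^ 2) * 2 by positivity)
  refine h.trans ?_
  have hd : logI 2 x * (4.2 / (Y : ℝ)) ≤ 8.4 := by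
    rw [mul_div_assoc', div_le_iff₀ (by linarith)]
    linarith
  have h2 := mul_le_mul_of_nonneg_left hd (show 0 ≤ 1800 ^ 2 * (x * logI 2 x) * 2 by positivity)
  refine (le_of_eq ?_).trans (h2.trans (le_of_eq ?_)) <;> ring

lemma sum_nonSquarefreeWeight_le (x : ℕ) :
    ∑ d ∈ Finset.Icc 1 x, nonSquarefreeWeight x d ≤ 2 * x := by
  simp only [nonSquarefreeWeight]
  rw [Finset.sum_comm]
  have key : ∀ q ∈ (Finset.Icc 1 x).filter Nat.Prime, ∑ d ∈ Finset.Icc 1 x,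
      Real.log q * ∑ k ∈ Finset.Ioc 1 x, (if q ^ k ∣ d then (1 : ℝ) else 0) ≤
      x * (Real.log q / (q * (q - 1))) := by
    intro q hq
    have hqp := (Finset.mem_filter.1 hq).2
    have h1 : ∑ k ∈ Finset.Ioc 1 x, ∑ d ∈ Finset.Icc 1 x, (if q ^ k ∣ d then (1 : ℝ) else 0) ≤
        ∑ k ∈ Finset.Ioc 1 x, x * ((q : ℝ)⁻¹ ^ k) :=
      Finset.sum_le_sum fun k _ => (sum_ite_dvd_le x _).trans (le_of_eq (by
        rw [Nat.cast_pow, div_eq_mul_inv, inv_pow]))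
    rw [← Finset.mul_sum] at h1
    rw [← Finset.mul_sum, Finset.sum_comm]
    have h2 := mul_le_mul_of_nonneg_left (sum_Ioc_inv_pow_le hqp x) (Nat.cast_nonneg x)
    refine (mul_le_mul_of_nonneg_left (h1.trans h2) (Real.log_natCast_nonneg q)).trans
      (le_of_eq ?_)
    ring
  refine (Finset.sum_le_sum key).trans ?_
  rw [← Finset.mul_sum]
  have h := mul_le_mul_of_nonneg_left (sum_prime_log_div_mul_sub_one_le x) (Nat.cast_nonneg x)
  linarith

theorem sum_errorWeight_le {p x : ℕ} (hp : p.Prime) (hx : 1 ≤ x) :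
    ∑ d ∈ Finset.Icc 1 x, errorWeight p x d ≤ 10 ^ 8 * (x * logI 2 x) := by
  have hy := one_le_logI 1 x
  simp only [errorWeight, Finset.sum_add_distrib]
  have h1 := sum_higherPowerWeight_le x
  have h2 := sum_exceptionalWeight_le hp x
  have h3 := sum_pairWeight_le hx
  have h4 := sum_nonSquarefreeWeight_le x
  have h5 := mul_le_mul_of_nonneg_left hy (Nat.cast_nonneg (α := ℝ) x)
  linarith

lemma errorWeight_nonneg (p x d : ℕ) : 0 ≤ errorWeight p x d := by
  have h (S : Finset ℕ) (f : ℕ → ℝ) (hf : ∀ q, 0 ≤ f q) : 0 ≤ ∑ q ∈ S, Real.log q * f q :=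
    Finset.sum_nonneg fun q _ => mul_nonneg (Real.log_natCast_nonneg q) (hf q)
  refine add_nonneg (add_nonneg (add_nonneg (h _ _ fun q => ?_) (h _ _ fun q => ?_))
    (h _ _ fun q => ?_)) (h _ _ fun q => ?_)
  · exact Finset.sum_nonneg fun k _ => congruentCount_nonneg _ _ _
  · exact congruentCount_nonneg _ _ _
  · exact Finset.sum_nonneg fun k _ => congruentPairs_nonneg _ _ _
  · exact Finset.sum_nonneg fun k _ => by split_ifs <;> norm_num

end Moments

section Conclusion

lemma tendsto_logI_natCast (ν : ℕ) :
    Filter.Tendsto (fun x : ℕ => logI ν (x : ℝ)) Filter.atTop Filter.atTop := by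
  induction ν with
  | zero => exact tendsto_natCast_atTop_atTop
  | succ ν ih =>
    exact Filter.tendsto_atTop_mono (fun x => le_max_left _ _) (Real.tendsto_log_atTop.comp ih)

lemma tendsto_logI_succ_sq_div (ν : ℕ) :
    Filter.Tendsto (fun x : ℕ => logI (ν + 1) (x : ℝ) ^ 2 / logI ν (x : ℝ))
      Filter.atTop (nhds 0) := by
  have h : Filter.Tendsto (fun y : ℝ => (max (Real.log y) 1) ^ 2 / y) Filter.atTop (nhds 0) := by
    refine ((Real.isLittleO_pow_log_id_atTop (n := 2)).tendsto_div_nhds_zero).congr' ?_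
    filter_upwards [Filter.eventually_ge_atTop (Real.exp 1)] with y hy
    rw [max_eq_left, id]
    rwa [Real.le_log_iff_exp_le ((Real.exp_pos 1).trans_le hy)]
  exact h.comp (tendsto_logI_natCast ν)

lemma card_filter_lt_mul_le {s : Finset ℕ} {f : ℕ → ℝ} (hf : ∀ d, 0 ≤ f d) (a : ℝ) :
    (((s.filter fun d => a < f d).card : ℕ) : ℝ) * a ≤ ∑ d ∈ s, f d := by
  rw [← nsmul_eq_mul]
  refine (Finset.card_nsmul_le_sum _ f a fun d hd => (Finset.mem_filter.1 hd).2.le).trans ?_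
  exact Finset.sum_le_sum_of_subset_of_nonneg (Finset.filter_subset _ _) fun d _ _ => hf d

/-- The number of `d ≤ x` violating the estimate, bounded by the second moment of the additive
approximation and the first moment of the error. -/
lemma card_exceptional_le {p x : ℕ} (hp : p.Prime) (hx : 1 ≤ x) {C : ℝ}
    (hC : 400000 * (5 + Real.log p) + 20004 ≤ C) :
    (((Finset.Icc 1 x).filter (fun d =>
        ¬ |Real.log (Nat.totient (dPart p d)) - Real.log (carmichael (dPart p d))
            - (1 / 3) * logI 2 (x : ℝ) * logI 3 (x : ℝ)|
          ≤ C * logI 2 (x : ℝ) * logI 4 (x : ℝ))).card : ℝ) / (x : ℝ) ≤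
      30000 * (logI 3 (x : ℝ) ^ 2 / logI 2 (x : ℝ)) + 10 ^ 8 / logI 4 (x : ℝ) := by
  have hV := sum_sq_additiveWeight_sub_le p x
  have hE := sum_errorWeight_le hp hx
  have hmean := abs_meanWeight_sub_le hp x
  have hbd : ∀ d ∈ Finset.Icc 1 x, _ := fun d hd =>
    log_totient_sub_log_carmichael_dPart_bounds (p := p) (Finset.mem_Icc.1 hd).1
      (Finset.mem_Icc.1 hd).2
  have hy1 := one_le_logI 1 x
  have hM1 := one_le_logI 3 x
  have hx0 : (0 : ℝ) < x := by exact_mod_cast hx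
  obtain ⟨y, hy⟩ : ∃ y, y = logI 2 (x : ℝ) := ⟨_, rfl⟩
  obtain ⟨L, hL⟩ : ∃ L, L = logI 3 (x : ℝ) := ⟨_, rfl⟩
  obtain ⟨M, hM⟩ : ∃ M, M = logI 4 (x : ℝ) := ⟨_, rfl⟩
  simp only [← hy, ← hL, ← hM] at *
  have hyM : 1 ≤ y * M := one_le_mul_of_one_le_of_one_le hy1 hM1
  have hyM' : y ≤ y * M := le_mul_of_one_le_right (by linarith) hM1
  have hA := card_filter_lt_mul_le (s := Finset.Icc 1 x)
    (f := fun d => (additiveWeight p x d - meanWeight p x) ^ 2) (fun d => sq_nonneg _) ((y * M) ^ 2)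
  have hB := card_filter_lt_mul_le (s := Finset.Icc 1 x) (errorWeight_nonneg p x) (y * M)
  have hcard : (Finset.Icc 1 x).filter (fun d =>
      ¬ |Real.log (Nat.totient (dPart p d)) - Real.log (carmichael (dPart p d))
            - (1 / 3) * y * L| ≤ C * y * M) ⊆
      (Finset.Icc 1 x).filter (fun d => (y * M) ^ 2 < (additiveWeight p x d - meanWeight p x) ^ 2) ∪
      (Finset.Icc 1 x).filter (fun d => y * M < errorWeight p x d) := by
    intro d hd
    obtain ⟨hd1, hd2⟩ := Finset.mem_filter.1 hd
    by_contra hcon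
    simp only [Finset.mem_union, Finset.mem_filter, hd1, true_and, not_or, not_lt] at hcon
    refine hd2 ?_
    have h1 := abs_le.1 (abs_le_of_sq_le_sq hcon.1 (by linarith))
    obtain ⟨h2, h3⟩ := hbd d hd1
    have h4 := abs_le.1 hmean
    have h5 := mul_le_mul_of_nonneg_right hC (by linarith : 0 ≤ y * M)
    rw [abs_le]
    constructor <;> linarith [h1.1, h1.2, h4.1, h4.2, hcon.2]
  have hc : ((((Finset.Icc 1 x).filter (fun d =>
      ¬ |Real.log (Nat.totient (dPart p d)) - Real.log (carmichael (dPart p d))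
            - (1 / 3) * y * L| ≤ C * y * M)).card : ℕ) : ℝ) ≤
      (((Finset.Icc 1 x).filter (fun d =>
        (y * M) ^ 2 < (additiveWeight p x d - meanWeight p x) ^ 2)).card : ℕ) +
      (((Finset.Icc 1 x).filter (fun d => y * M < errorWeight p x d)).card : ℕ) := by
    exact_mod_cast (Finset.card_le_card hcard).trans (Finset.card_union_le _ _)
  have hy0 : 0 < y := by linarith
  have hM0 : 0 < M := by linarith
  have h1 : ((((Finset.Icc 1 x).filter (fun d =>
      (y * M) ^ 2 < (additiveWeight p x d - meanWeight p x) ^ 2)).card : ℕ) : ℝ) ≤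
      30000 * (L ^ 2 / y) * x := by
    have hyy : y ^ 2 ≤ (y * M) ^ 2 := pow_le_pow_left₀ hy0.le hyM' 2
    have h := (mul_le_mul_of_nonneg_left hyy (Nat.cast_nonneg _)).trans (hA.trans hV)
    rw [← le_div_iff₀ (by positivity)] at h
    refine h.trans (le_of_eq ?_)
    field_simp
  have h2 : ((((Finset.Icc 1 x).filter (fun d => y * M < errorWeight p x d)).card : ℕ) : ℝ) ≤
      10 ^ 8 / M * x := by
    have h := hB.trans hE
    rw [← le_div_iff₀ (by positivity)] at h
    refine h.trans (le_of_eq ?_)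
    field_simp
  rw [div_le_iff₀ hx0]
  linarith

end Conclusion

/-- For every prime `p` there is a constant `C_p > 0` such that,
as `x → ∞` (over the positive integers), the number of positive integers `d ≤ x`
failing to satisfy
`|log φ(d_p) − log λ(d_p) − (1/3)(log₂ x)(log₃ x)| ≤ C_p (log₂ x)(log₄ x)`
is `o(x)`. -/
theorem rank_stats_stmt16 (p : ℕ) (hp : p.Prime) :
    ∃ C : ℝ, 0 < C ∧
      Filter.Tendsto
        (fun x : ℕ =>
          (((Finset.Icc 1 x).filter (fun d =>
              ¬ |Real.log (Nat.totient (dPart p d)) - Real.log (carmichael (dPart p d))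
                  - (1 / 3) * logI 2 (x : ℝ) * logI 3 (x : ℝ)|
                ≤ C * logI 2 (x : ℝ) * logI 4 (x : ℝ))).card : ℝ) / (x : ℝ))
        Filter.atTop (nhds 0) := by
  have hl := Real.log_natCast_nonneg p
  refine ⟨400000 * (5 + Real.log p) + 20004, by positivity, ?_⟩
  have h1 := (tendsto_logI_succ_sq_div 2).const_mul 30000
  have h2 := (tendsto_logI_natCast 4).const_div_atTop (10 ^ 8)
  have h3 := h1.add h2
  rw [mul_zero, add_zero] at h3
  refine tendsto_of_tendsto_of_tendsto_of_le_of_le' tendsto_const_nhds h3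
    (Filter.Eventually.of_forall fun x => by positivity) ?_
  filter_upwards [Filter.eventually_ge_atTop 1] with x hx
  exact card_exceptional_le hp hx le_rfl
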